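/- arXiv:2204.03754 — 3 statements merged into one kernel-verified Lean document; each statement's English description precedes it below -/
import Mathlib

section
/- Let ε > 0 and k ≥ 1 be fixed. There is a constant C = C(ε, k) such that the following holds. Let X ≥ 3, X^ε ≤ H ≤ X, and 2 ≤ P < Q ≤ X^{1/(log log X)²}; write 𝒫(P, Q) := ∏_{P < p ≤ Q} p (product over primes). Let f be a multiplicative function with |f(n)| ≤ d_k(n) for all n. Then there exists a sequence (a_r)_{r ≥ 1} of complex numbers with |a_r| ≤ d_{k+1}(r) for all r, such that for every sequence (ω_n) of complex numbers with |ω_n| ≤ 1: |∑_{X < n ≤ X+H, gcd(n, 𝒫(P,Q)) > 1} f(n) ω_n − ∑_{X < p r n ≤ X+H, p prime, P < p ≤ Q, r ≤ X^{ε/2}} a_r f(p) f(n) ω_{prn}| ≤ C · (H (log X)^{4k} / P + H / exp((log log X)²)). -/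
open Finset

/-- The `k`-th divisor function: the number of tuples `(n₁, …, n_k)` of positive
integers with `n₁ ⋯ n_k = n`. -/
def dk (k n : ℕ) : ℕ :=
  ((Fintype.piFinset fun _ : Fin k => Finset.range (n + 1)).filter
    fun v => ∏ i, v i = n).card

/-- `𝒫(P, Q) = ∏_{P < p ≤ Q} p`, the product of the primes in `(P, Q]`. -/
noncomputable def primesProdIoc (P Q : ℝ) : ℕ :=
  ∏ p ∈ (Finset.range (⌊Q⌋₊ + 1)).filter
      (fun p : ℕ => p.Prime ∧ P < (p : ℝ) ∧ (p : ℝ) ≤ Q), p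

open scoped ArithmeticFunction.zeta

/-- The `K`-fold Dirichlet power of `ζ`; agrees with `dk K` on positive integers. -/
def tau (K n : ℕ) : ℕ := (ζ ^ K : ArithmeticFunction ℕ) n

lemma tau_zero_left (n : ℕ) : tau 0 n = if n = 1 then 1 else 0 := by
  simp [tau, ArithmeticFunction.one_apply]

lemma tau_succ (K n : ℕ) : tau (K + 1) n = ∑ d ∈ n.divisors, tau K d := by
  rw [tau, pow_succ, ArithmeticFunction.mul_zeta_apply]
  rfl

lemma tau_add (A B n : ℕ) :
    tau (A + B) n = ∑ x ∈ n.divisorsAntidiagonal, tau A x.1 * tau B x.2 := by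
  simp only [tau, pow_add, ArithmeticFunction.mul_apply]

lemma tau_isMultiplicative (K : ℕ) : (ζ ^ K : ArithmeticFunction ℕ).IsMultiplicative := by
  induction K with
  | zero => exact ArithmeticFunction.isMultiplicative_one
  | succ K ih => rw [pow_succ]; exact ih.mul ArithmeticFunction.isMultiplicative_zeta

lemma tau_one_right (K : ℕ) : tau K 1 = 1 := (tau_isMultiplicative K).map_one

lemma tau_one_left {n : ℕ} (hn : n ≠ 0) : tau 1 n = 1 := by
  simp [tau, hn]

lemma tau_prime (K : ℕ) {p : ℕ} (hp : p.Prime) : tau K p = K := by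
  induction K with
  | zero => simp [tau_zero_left, hp.ne_one]
  | succ K ih =>
    rw [tau_succ, hp.divisors, sum_pair hp.one_lt.ne, ih, tau_one_right, add_comm]

lemma tau_mul_le (K m n : ℕ) : tau K (m * n) ≤ tau K m * tau K n := by
  induction K generalizing m n with
  | zero =>
    simp only [tau_zero_left, mul_eq_one]
    split_ifs <;> simp_all
  | succ K ih =>
    rw [tau_succ, tau_succ, tau_succ, sum_mul_sum, ← sum_product', Nat.divisors_mul]
    calc _ ≤ ∑ x ∈ m.divisors ×ˢ n.divisors, tau K (x.1 * x.2) :=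
          sum_image_le_of_nonneg (fun _ _ => Nat.zero_le _)
      _ ≤ _ := sum_le_sum fun x _ => ih _ _

lemma tau_mul_tau_le (A B n : ℕ) : tau A n * tau B n ≤ tau (A * B) n := by
  induction A generalizing n with
  | zero =>
    simp only [tau_zero_left, zero_mul]
    split_ifs with h
    · simp [h, tau_one_right]
    · simp
  | succ A ih =>
    rw [add_mul, one_mul, tau_add (A * B), tau_succ,
      ← Nat.sum_divisorsAntidiagonal (fun d _ => tau A d), sum_mul]
    refine sum_le_sum fun x hx => ?_
    rw [← (Nat.mem_divisorsAntidiagonal.mp hx).1]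
    calc tau A x.1 * tau B (x.1 * x.2) ≤ tau A x.1 * (tau B x.1 * tau B x.2) := by
          gcongr; exact tau_mul_le _ _ _
      _ = (tau A x.1 * tau B x.1) * tau B x.2 := by ring
      _ ≤ _ := by gcongr; exact ih _

lemma tau_pow_le (K J n : ℕ) (hn : n ≠ 0) : tau K n ^ J ≤ tau (K ^ J) n := by
  induction J with
  | zero => simp [tau_one_left hn]
  | succ J ih =>
    rw [pow_succ, pow_succ]
    exact (Nat.mul_le_mul_right _ ih).trans (tau_mul_tau_le _ _ _)

lemma tau_le_add (A B : ℕ) {n : ℕ} (hn : n ≠ 0) : tau A n ≤ tau (A + B) n := by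
  rw [tau_add]
  have : (n, 1) ∈ n.divisorsAntidiagonal := by simp [hn]
  simpa [tau_one_right] using
    single_le_sum (f := fun x : ℕ × ℕ => tau A x.1 * tau B x.2) (fun _ _ => Nat.zero_le _) this

lemma tau_le_of_dvd (K : ℕ) (hK : 1 ≤ K) {m n : ℕ} (h : m ∣ n) (hn : n ≠ 0) :
    tau K m ≤ tau K n := by
  obtain ⟨K, rfl⟩ := Nat.exists_eq_add_of_le' hK
  rw [tau_succ, tau_succ]
  exact sum_le_sum_of_subset (Nat.divisors_subset_of_dvd hn h)

lemma tau_le_pow_cardFactors (K n : ℕ) (hn : n ≠ 0) :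
    tau K n ≤ K ^ ArithmeticFunction.cardFactors n := by
  induction n using induction_on_primes with
  | zero => exact absurd rfl hn
  | one => simp [tau_one_right]
  | prime_mul p n hp ih =>
    have hn' : n ≠ 0 := right_ne_zero_of_mul hn
    rw [ArithmeticFunction.cardFactors_mul hp.ne_zero hn',
      ArithmeticFunction.cardFactors_apply_prime hp, pow_add, pow_one]
    exact (tau_mul_le _ _ _).trans (by rw [tau_prime K hp]; gcongr; exact ih hn')

lemma tau_of_squarefree (B : ℕ) {r : ℕ} (hr : Squarefree r) :
    tau B r = B ^ r.primeFactors.card := by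
  conv_lhs => rw [← Nat.prod_primeFactors_of_squarefree hr, tau]
  rw [(tau_isMultiplicative B).map_prod_of_prime _ (fun p hp => Nat.prime_of_mem_primeFactors hp)]
  exact prod_eq_pow_card fun p hp => tau_prime B (Nat.prime_of_mem_primeFactors hp)

lemma dk_eq_tau (K : ℕ) {n : ℕ} (hn : n ≠ 0) : dk K n = tau K n := by
  induction K generalizing n with
  | zero =>
    rw [tau_zero_left, dk]
    by_cases h : n = 1
    · simp [h]
    · simp [h, Ne.symm h]
  | succ K ih =>
    rw [tau_succ, ← sum_congr rfl fun d hd =>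
      ih (Nat.pos_of_mem_divisors hd).ne', ← Nat.sum_div_divisors n (fun d => dk K d)]
    simp only [dk]
    rw [← card_sigma]
    refine card_nbij' (fun v => ⟨v 0, Fin.tail v⟩) (fun x => Fin.cons x.1 x.2) ?_ ?_ ?_ ?_
    · intro v hv
      simp only [coe_filter, Set.mem_ofPred_eq, Fintype.mem_piFinset, mem_range,
        Fin.prod_univ_succ] at hv
      have h0 : v 0 ∣ n := Dvd.intro _ hv.2
      have h0' : 0 < v 0 := Nat.pos_of_dvd_of_pos h0 (Nat.pos_of_ne_zero hn)
      have h1 : ∏ i, Fin.tail v i = n / v 0 := by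
        rw [← hv.2, Nat.mul_div_cancel_left _ h0']; rfl
      simp only [coe_sigma, Set.mem_sigma_iff, mem_coe, Nat.mem_divisors, mem_filter,
        Fintype.mem_piFinset, mem_range]
      refine ⟨⟨h0, hn⟩, fun i => ?_, h1⟩
      have : Fin.tail v i ∣ n / v 0 := h1 ▸ dvd_prod_of_mem _ (mem_univ i)
      exact Nat.lt_succ_of_le (Nat.le_of_dvd (Nat.div_pos (Nat.le_of_dvd
        (Nat.pos_of_ne_zero hn) h0) h0') this)
    · rintro ⟨d, v⟩ hv
      simp only [coe_sigma, Set.mem_sigma_iff, mem_coe, Nat.mem_divisors, mem_filter,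
        Fintype.mem_piFinset, mem_range] at hv
      simp only [coe_filter, Set.mem_ofPred_eq, Fintype.mem_piFinset, mem_range,
        Fin.prod_univ_succ, Fin.cons_zero, Fin.cons_succ]
      obtain ⟨⟨h0, -⟩, h1, h2⟩ := hv
      refine ⟨fun i => ?_, by rw [h2, Nat.mul_div_cancel' h0]⟩
      refine Fin.cases ?_ (fun j => ?_) i
      · exact Nat.lt_succ_of_le (Nat.le_of_dvd (Nat.pos_of_ne_zero hn) h0)
      · exact (h1 j).trans_le (Nat.succ_le_succ (Nat.div_le_self _ _))
    · intro v _; exact Fin.cons_self_tail v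
    · rintro ⟨d, v⟩ _; simp [Fin.tail_cons]

lemma sum_tau_mul_le_pow (w : ℕ → ℝ) (hw : ∀ n, 0 ≤ w n) (hw1 : w 1 ≤ 1)
    (hmul : ∀ m n, w (m * n) ≤ w m * w n) (K N : ℕ) :
    ∑ a ∈ Icc 1 N, (tau K a : ℝ) * w a ≤ (∑ a ∈ Icc 1 N, w a) ^ K := by
  induction K with
  | zero =>
    simp only [tau_zero_left, pow_zero, Nat.cast_ite, Nat.cast_one, Nat.cast_zero, ite_mul,
      one_mul, zero_mul, sum_ite_eq']
    split_ifs <;> linarith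
  | succ K ih =>
    have hS : 0 ≤ ∑ a ∈ Icc 1 N, w a := sum_nonneg fun _ _ => hw _
    calc ∑ a ∈ Icc 1 N, (tau (K + 1) a : ℝ) * w a
        ≤ ∑ a ∈ Icc 1 N, ∑ x ∈ (Icc 1 N ×ˢ Icc 1 N) with x.1 * x.2 = a,
            ((tau K x.1 : ℝ) * w x.1) * w x.2 := by
          refine sum_le_sum fun a ha => ?_
          have ha' := mem_Icc.mp ha
          rw [tau_succ, ← Nat.sum_divisorsAntidiagonal (fun d _ => tau K d), Nat.cast_sum, sum_mul]
          have hset : (Icc 1 N ×ˢ Icc 1 N).filter (fun x => x.1 * x.2 = a)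
              = a.divisorsAntidiagonal := by
            ext ⟨x, y⟩
            simp only [mem_filter, mem_product, mem_Icc, Nat.mem_divisorsAntidiagonal]
            constructor
            · rintro ⟨-, h⟩; exact ⟨h, by omega⟩
            · rintro ⟨h, -⟩
              have hx : 1 ≤ x := Nat.pos_of_ne_zero (by rintro rfl; omega)
              have hy : 1 ≤ y := Nat.pos_of_ne_zero (by rintro rfl; omega)
              exact ⟨⟨⟨hx, by nlinarith⟩, ⟨hy, by nlinarith⟩⟩, h⟩
          rw [hset]
          refine sum_le_sum fun x hx => ?_
          rw [← (Nat.mem_divisorsAntidiagonal.mp hx).1, mul_assoc]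
          exact mul_le_mul_of_nonneg_left (hmul _ _) (Nat.cast_nonneg _)
      _ ≤ ∑ x ∈ Icc 1 N ×ˢ Icc 1 N, ((tau K x.1 : ℝ) * w x.1) * w x.2 :=
          sum_fiberwise_le_sum_of_sum_fiber_nonneg fun y _ => sum_nonneg fun x _ =>
            mul_nonneg (mul_nonneg (Nat.cast_nonneg _) (hw _)) (hw _)
      _ = (∑ a ∈ Icc 1 N, (tau K a : ℝ) * w a) * ∑ a ∈ Icc 1 N, w a := by
          rw [sum_mul_sum, ← sum_product']
      _ ≤ _ := by rw [pow_succ]; gcongr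

lemma sum_inv_le_one_add_log (N : ℕ) : ∑ a ∈ Icc 1 N, (a : ℝ)⁻¹ ≤ 1 + Real.log N := by
  have := harmonic_le_one_add_log N
  rw [harmonic_eq_sum_Icc] at this
  push_cast at this
  exact this

lemma sum_tau_div_le (K N : ℕ) :
    ∑ a ∈ Icc 1 N, (tau K a : ℝ) * (a : ℝ)⁻¹ ≤ (1 + Real.log N) ^ K := by
  refine (sum_tau_mul_le_pow (fun n => (n : ℝ)⁻¹) (fun n => by positivity) (by simp)
    (fun m n => by push_cast; rw [mul_inv]) K N).trans ?_
  gcongr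
  exact sum_inv_le_one_add_log N

lemma exists_tau_le_rpow (K : ℕ) {ε : ℝ} (hε : 0 < ε) :
    ∃ C : ℝ, 0 < C ∧ ∀ n : ℕ, n ≠ 0 → (tau K n : ℝ) ≤ C * (n : ℝ) ^ ε := by
  obtain ⟨J, hJ⟩ := exists_nat_gt (2 / ε)
  have hJ0 : (0 : ℝ) < J := lt_trans (by positivity) hJ
  have hJn : J ≠ 0 := by rintro rfl; simp at hJ0
  set M : ℕ := K ^ J + 1 with hM
  have hM0 : (0 : ℝ) < M := by positivity
  set D : ℝ := (1 + M) ^ M with hD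
  have hD0 : 0 < D := by positivity
  refine ⟨D ^ (1 / J : ℝ), by positivity, fun n hn => ?_⟩
  have hn1 : (1 : ℝ) ≤ n := by exact_mod_cast Nat.pos_of_ne_zero hn
  have hlog : 0 ≤ Real.log n := Real.log_nonneg hn1
  have h1 : (tau K n : ℝ) ^ J ≤ D * (n : ℝ) ^ (2 : ℝ) := by
    have h2 : (tau (K ^ J) n : ℝ) * (n : ℝ)⁻¹ ≤ (1 + Real.log n) ^ (K ^ J) :=
      (single_le_sum (f := fun a : ℕ => (tau (K ^ J) a : ℝ) * (a : ℝ)⁻¹)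
        (fun _ _ => by positivity) (mem_Icc.mpr ⟨Nat.pos_of_ne_zero hn, le_rfl⟩)).trans
        (sum_tau_div_le _ _)
    have h3 : 1 + Real.log n ≤ (1 + M) * (n : ℝ) ^ (1 / M : ℝ) := by
      have := Real.log_le_rpow_div (x := (n : ℝ)) (by positivity) (ε := 1 / M) (by positivity)
      have h4 : (1 : ℝ) ≤ (n : ℝ) ^ (1 / M : ℝ) := Real.one_le_rpow hn1 (by positivity)
      rw [div_div_eq_mul_div, div_one] at this
      linarith
    have h5 : (1 + Real.log n) ^ (K ^ J) ≤ D * n := by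
      calc (1 + Real.log n) ^ (K ^ J) ≤ (1 + Real.log n) ^ M :=
            pow_le_pow_right₀ (by linarith) (by omega)
        _ ≤ ((1 + M) * (n : ℝ) ^ (1 / M : ℝ)) ^ M := by gcongr
        _ = D * n := by
            rw [mul_pow, ← Real.rpow_natCast ((n : ℝ) ^ (1 / M : ℝ)), ← Real.rpow_mul (by positivity),
              one_div, inv_mul_cancel₀ hM0.ne', Real.rpow_one]
    calc (tau K n : ℝ) ^ J ≤ tau (K ^ J) n := by exact_mod_cast tau_pow_le K J n hn
      _ ≤ (D * n) * n := by
          rw [← div_eq_mul_inv, div_le_iff₀ (by positivity)] at h2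
          exact h2.trans (by gcongr)
      _ = _ := by rw [Real.rpow_two]; ring
  calc (tau K n : ℝ) = ((tau K n : ℝ) ^ J) ^ (1 / J : ℝ) := by
        rw [one_div, Real.pow_rpow_inv_natCast (Nat.cast_nonneg _) hJn]
    _ ≤ (D * (n : ℝ) ^ (2 : ℝ)) ^ (1 / J : ℝ) := by gcongr
    _ = D ^ (1 / J : ℝ) * (n : ℝ) ^ (2 / J : ℝ) := by
        rw [Real.mul_rpow hD0.le (by positivity), ← Real.rpow_mul (by positivity)]
        congr 2; ring
    _ ≤ _ := by
        gcongr
        rw [div_lt_iff₀ hε] at hJ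
        rw [div_le_iff₀ hJ0]; linarith

lemma sum_log_div_prime_le (N : ℕ) :
    ∑ p ∈ Icc 1 N with p.Prime, Real.log p / p ≤ Real.log N + Real.log 4 := by
  rcases Nat.eq_zero_or_pos N with rfl | hN
  · simpa using Real.log_nonneg (by norm_num)
  have hN' : (0 : ℝ) < N := by exact_mod_cast hN
  have hrad : ∀ n ∈ Icc 1 N, ∑ p ∈ Icc 1 N with p.Prime,
      (if p ∣ n then Real.log p else 0) ≤ Real.log N := by
    intro n hn
    have hn' := mem_Icc.mp hn
    rw [← sum_filter]
    have : (((Icc 1 N).filter Nat.Prime).filter (fun p => p ∣ n)) = n.primeFactors := by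
      ext p
      simp only [mem_filter, mem_Icc, Nat.mem_primeFactors]
      constructor
      · rintro ⟨⟨-, h⟩, h'⟩; exact ⟨h, h', by omega⟩
      · rintro ⟨h, h', -⟩
        exact ⟨⟨⟨h.one_le, (Nat.le_of_dvd hn'.1 h').trans hn'.2⟩, h⟩, h'⟩
    rw [this, ← Real.log_prod fun p hp => by
      exact_mod_cast (Nat.prime_of_mem_primeFactors hp).ne_zero, ← Nat.cast_prod]
    have h0 : 0 < ∏ p ∈ n.primeFactors, p :=
      prod_pos fun p hp => (Nat.prime_of_mem_primeFactors hp).pos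
    exact Real.log_le_log (by exact_mod_cast h0) (by
      exact_mod_cast (Nat.le_of_dvd hn'.1 (Nat.prod_primeFactors_dvd n)).trans hn'.2)
  have h1 : ∑ p ∈ Icc 1 N with p.Prime, Real.log p * ((N / p : ℕ) : ℝ) ≤ N * Real.log N := by
    calc ∑ p ∈ Icc 1 N with p.Prime, Real.log p * ((N / p : ℕ) : ℝ)
        = ∑ p ∈ Icc 1 N with p.Prime, ∑ n ∈ Icc 1 N, (if p ∣ n then Real.log p else 0) := by
          refine sum_congr rfl fun p _ => ?_
          rw [← sum_filter, sum_const, nsmul_eq_mul, mul_comm]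
          rw [← Nat.Ioc_filter_dvd_card_eq_div]
          rfl
      _ = ∑ n ∈ Icc 1 N, ∑ p ∈ Icc 1 N with p.Prime, (if p ∣ n then Real.log p else 0) :=
          sum_comm
      _ ≤ ∑ n ∈ Icc 1 N, Real.log N := sum_le_sum hrad
      _ = N * Real.log N := by simp
  have h2 : ∑ p ∈ Icc 1 N with p.Prime, Real.log p ≤ Real.log 4 * N := by
    have := Chebyshev.theta_le_log4_mul_x (x := (N : ℝ)) hN'.le
    rw [Chebyshev.theta] at this
    rw [show Icc 1 N = Ioc 0 N from rfl]
    simpa using this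
  have h3 : ∀ p ∈ (Icc 1 N).filter Nat.Prime, N * (Real.log p / p) ≤
      Real.log p * ((N / p : ℕ) : ℝ) + Real.log p := by
    intro p hp
    have hp' : (0 : ℝ) < p := by exact_mod_cast (mem_filter.mp hp).2.pos
    have h4 : (N : ℝ) / p ≤ ((N / p : ℕ) : ℝ) + 1 := by
      rw [← Nat.floor_div_eq_div (K := ℝ)]
      exact (Nat.lt_floor_add_one _).le
    have h5 : 0 ≤ Real.log p := Real.log_nonneg (by exact_mod_cast (mem_filter.mp hp).2.one_le)
    calc N * (Real.log p / p) = Real.log p * (N / p) := by ring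
      _ ≤ Real.log p * (((N / p : ℕ) : ℝ) + 1) := by gcongr
      _ = _ := by ring
  have h6 := sum_le_sum h3
  rw [← mul_sum, sum_add_distrib] at h6
  have h7 : N * ∑ p ∈ Icc 1 N with p.Prime, Real.log p / p ≤ N * (Real.log N + Real.log 4) := by
    linarith
  exact le_of_mul_le_mul_left h7 hN'

/-- The positive integers up to `N` all of whose prime factors are at most `q`. -/
def smoothUpTo (N q : ℕ) : Finset ℕ :=
  (Icc 1 N).filter fun a => ∀ p ∈ a.primeFactors, p ≤ q

lemma mem_smoothUpTo {N q a : ℕ} :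
    a ∈ smoothUpTo N q ↔ (1 ≤ a ∧ a ≤ N) ∧ ∀ p, p.Prime → p ∣ a → p ≤ q := by
  simp only [smoothUpTo, mem_filter, mem_Icc, Nat.mem_primeFactors]
  exact and_congr_right fun h => ⟨fun H p h1 h2 => H p ⟨h1, h2, by omega⟩,
    fun H p hp => H p hp.1 hp.2.1⟩

lemma sum_factorization_mul_le (N q : ℕ) {p : ℕ} (hp : p.Prime) {s : ℝ} (hs : s ≤ 1 / 4) :
    ∑ a ∈ smoothUpTo N q, (a.factorization p : ℝ) * (a : ℝ) ^ (s - 1) ≤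
      3 * (p : ℝ) ^ (s - 1) * ∑ a ∈ smoothUpTo N q, (a : ℝ) ^ (s - 1) := by
  set F := ∑ a ∈ smoothUpTo N q, (a : ℝ) ^ (s - 1) with hF
  set A := ∑ a ∈ smoothUpTo N q, (a.factorization p : ℝ) * (a : ℝ) ^ (s - 1) with hA
  have hF0 : 0 ≤ F := sum_nonneg fun _ _ => by positivity
  have hp0 : (0 : ℝ) < p := by exact_mod_cast hp.pos
  have hrec : A ≤ (p : ℝ) ^ (s - 1) * (F + A) := by
    have h1 : A = ∑ a ∈ smoothUpTo N q with p ∣ a,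
        (a.factorization p : ℝ) * (a : ℝ) ^ (s - 1) := by
      rw [hA, sum_filter]
      refine sum_congr rfl fun a _ => ?_
      split_ifs with h
      · rfl
      · rw [Nat.factorization_eq_zero_of_not_dvd h]; simp
    have hsub : (smoothUpTo N q).filter (fun a => p ∣ a) ⊆
        (smoothUpTo N q).image (fun b => p * b) := by
      intro a ha
      simp only [mem_smoothUpTo, mem_filter, mem_image] at ha ⊢
      obtain ⟨⟨⟨h1, h2⟩, h3⟩, b, rfl⟩ := ha
      have hb : 1 ≤ b := Nat.pos_of_ne_zero (by rintro rfl; simp at h1)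
      exact ⟨b, ⟨⟨hb, (Nat.le_mul_of_pos_left b hp.pos).trans h2⟩,
        fun l hl hlb => h3 l hl (hlb.mul_left p)⟩, rfl⟩
    calc A ≤ ∑ a ∈ (smoothUpTo N q).image (fun b => p * b),
          (a.factorization p : ℝ) * (a : ℝ) ^ (s - 1) := by
          rw [h1]
          exact sum_le_sum_of_subset_of_nonneg hsub fun _ _ _ => by positivity
      _ = ∑ b ∈ smoothUpTo N q, ((p * b).factorization p : ℝ) * ((p * b : ℕ) : ℝ) ^ (s - 1) :=
          sum_image fun x _ y _ h => Nat.eq_of_mul_eq_mul_left hp.pos h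
      _ = ∑ b ∈ smoothUpTo N q, (p : ℝ) ^ (s - 1) *
            ((b : ℝ) ^ (s - 1) + (b.factorization p : ℝ) * (b : ℝ) ^ (s - 1)) := by
          refine sum_congr rfl fun b hb => ?_
          have hb0 : b ≠ 0 := by
            have := (mem_smoothUpTo.mp hb).1.1
            omega
          rw [Nat.factorization_mul hp.ne_zero hb0, Finsupp.add_apply, hp.factorization_self,
            Nat.cast_mul, Real.mul_rpow hp0.le (Nat.cast_nonneg _)]
          push_cast; ring
      _ = _ := by rw [← mul_sum, sum_add_distrib]
  have hx : (p : ℝ) ^ (s - 1) ≤ 2 / 3 := by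
    calc (p : ℝ) ^ (s - 1) ≤ (p : ℝ) ^ (-(3 / 4) : ℝ) :=
          Real.rpow_le_rpow_of_exponent_le (by exact_mod_cast hp.one_le) (by linarith)
      _ ≤ (2 : ℝ) ^ (-(3 / 4) : ℝ) :=
          Real.rpow_le_rpow_of_nonpos (by norm_num) (by exact_mod_cast hp.two_le) (by norm_num)
      _ ≤ 2 / 3 := by
          have h : ((2 : ℝ) ^ (-(3 / 4) : ℝ)) ^ 4 ≤ (2 / 3) ^ 4 := by
            rw [← Real.rpow_natCast, ← Real.rpow_mul (by norm_num)]
            norm_num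
          exact le_of_pow_le_pow_left₀ (by norm_num) (by norm_num) h
  have hA0 : 0 ≤ A := sum_nonneg fun _ _ => by positivity
  nlinarith

lemma sum_smooth_rpow_le (N : ℕ) {q : ℕ} (hq : 2 ≤ q) {σ B : ℝ} (hσ : 0 ≤ σ)
    (hσ' : σ ≤ 1 / 4) (hB : σ * Real.log q ≤ B) :
    ∑ a ∈ smoothUpTo N q, (a : ℝ) ^ (σ - 1) ≤
      Real.exp (9 * B * Real.exp B) * (1 + Real.log N) := by
  set F : ℝ → ℝ := fun s => ∑ a ∈ smoothUpTo N q, (a : ℝ) ^ (s - 1) with hF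
  have hpos : ∀ a ∈ smoothUpTo N q, (0 : ℝ) < a := fun a ha => by
    exact_mod_cast (mem_smoothUpTo.mp ha).1.1
  have hq0 : (0 : ℝ) < q := by positivity
  have hlogq : 0 ≤ Real.log q := Real.log_nonneg (by exact_mod_cast (by omega : 1 ≤ q))
  set M : ℝ := 3 * Real.exp B * (Real.log q + Real.log 4) with hM
  have hderiv : ∀ s, HasDerivAt F (∑ a ∈ smoothUpTo N q, (a : ℝ) ^ (s - 1) * Real.log a) s := by
    intro s
    refine HasDerivAt.fun_sum fun a ha => ?_
    simpa [mul_comm] using ((hasDerivAt_id s).sub_const 1).const_rpow (hpos a ha)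
  have hle : ∀ s, s ≤ σ → ∑ a ∈ smoothUpTo N q, (a : ℝ) ^ (s - 1) * Real.log a ≤ M * F s := by
    intro s hs
    have hF0 : 0 ≤ F s := sum_nonneg fun _ _ => by positivity
    calc ∑ a ∈ smoothUpTo N q, (a : ℝ) ^ (s - 1) * Real.log a
        = ∑ a ∈ smoothUpTo N q, ∑ p ∈ Icc 1 q with p.Prime,
            Real.log p * ((a.factorization p : ℝ) * (a : ℝ) ^ (s - 1)) := by
          refine sum_congr rfl fun a ha => ?_
          rw [Real.log_nat_eq_sum_factorization, Finsupp.sum, mul_sum, Nat.support_factorization]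
          have hsub : a.primeFactors ⊆ (Icc 1 q).filter Nat.Prime := by
            intro p hp
            have hp' := Nat.mem_primeFactors.mp hp
            exact mem_filter.mpr ⟨mem_Icc.mpr ⟨hp'.1.one_le,
              (mem_smoothUpTo.mp ha).2 p hp'.1 hp'.2.1⟩, hp'.1⟩
          rw [sum_subset hsub]
          · exact sum_congr rfl fun p _ => by ring
          · intro p _ hp
            rw [← Nat.support_factorization, Finsupp.notMem_support_iff] at hp
            simp [hp]
      _ = ∑ p ∈ Icc 1 q with p.Prime, Real.log p *
            ∑ a ∈ smoothUpTo N q, (a.factorization p : ℝ) * (a : ℝ) ^ (s - 1) := by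
          rw [sum_comm]
          exact sum_congr rfl fun p _ => (mul_sum _ _ _).symm
      _ ≤ ∑ p ∈ Icc 1 q with p.Prime, (3 * Real.exp B * F s) * (Real.log p / p) := by
          refine sum_le_sum fun p hp => ?_
          obtain ⟨hp1, hp⟩ := mem_filter.mp hp
          have hpq := (mem_Icc.mp hp1).2
          have hp0 : (0 : ℝ) < p := by exact_mod_cast hp.pos
          have hlp : 0 ≤ Real.log p := Real.log_nonneg (by exact_mod_cast hp.one_le)
          have h1 : (p : ℝ) ^ (s - 1) ≤ Real.exp B / p := by
            rw [Real.rpow_sub_one hp0.ne', Real.rpow_def_of_pos hp0]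
            gcongr
            calc Real.log p * s ≤ Real.log p * σ := by gcongr
              _ ≤ Real.log q * σ := by gcongr
              _ ≤ B := by rw [mul_comm]; exact hB
          calc _ ≤ Real.log p * (3 * (Real.exp B / p) * F s) := by
                gcongr
                exact (sum_factorization_mul_le N q hp (hs.trans hσ')).trans (by gcongr)
            _ = _ := by ring
      _ ≤ (3 * Real.exp B * F s) * (Real.log q + Real.log 4) := by
          rw [← mul_sum]
          gcongr
          exact sum_log_div_prime_le q
      _ = M * F s := by ring
  have hanti : AntitoneOn (fun s => F s * Real.exp (-M * s)) (Set.Icc 0 σ) := by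
    have hd : ∀ s, HasDerivAt (fun s => F s * Real.exp (-M * s))
        ((∑ a ∈ smoothUpTo N q, (a : ℝ) ^ (s - 1) * Real.log a) * Real.exp (-M * s) +
          F s * (Real.exp (-M * s) * (-M))) s := fun s => by
      refine (hderiv s).mul ?_
      simpa using ((hasDerivAt_id s).const_mul (-M)).exp
    refine antitoneOn_of_deriv_nonpos (convex_Icc _ _)
      (fun s _ => (hd s).continuousAt.continuousWithinAt)
      (fun s _ => (hd s).differentiableAt.differentiableWithinAt) fun s hs => ?_
    rw [interior_Icc] at hs
    rw [(hd s).deriv]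
    have := mul_le_mul_of_nonneg_right (hle s hs.2.le) (Real.exp_pos (-M * s)).le
    linarith
  have h0 : F 0 ≤ 1 + Real.log N := by
    refine le_trans ?_ (sum_inv_le_one_add_log N)
    simp only [hF, zero_sub, Real.rpow_neg_one]
    exact sum_le_sum_of_subset_of_nonneg (filter_subset _ _) fun _ _ _ => by positivity
  have h1 := hanti (Set.left_mem_Icc.mpr hσ) (Set.right_mem_Icc.mpr hσ) hσ
  simp only [mul_zero, Real.exp_zero, mul_one] at h1
  have h2 : F σ ≤ Real.exp (M * σ) * F 0 := by
    rw [neg_mul, Real.exp_neg, ← div_eq_mul_inv, div_le_iff₀ (Real.exp_pos _)] at h1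
    linarith
  have hMσ : M * σ ≤ 9 * B * Real.exp B := by
    have h4 : Real.log 4 ≤ 2 * Real.log q := by
      rw [show (4 : ℝ) = 2 ^ 2 by norm_num, Real.log_pow]
      push_cast
      gcongr
      exact_mod_cast hq
    calc M * σ = 3 * Real.exp B * ((Real.log q + Real.log 4) * σ) := by ring
      _ ≤ 3 * Real.exp B * ((3 * Real.log q) * σ) := by gcongr; linarith
      _ = 9 * (σ * Real.log q) * Real.exp B := by ring
      _ ≤ _ := by gcongr
  have hF0 : 0 ≤ F 0 := sum_nonneg fun _ _ => by positivity
  exact h2.trans (by gcongr)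

lemma exists_smooth_mul_prime_mul_rough {Y : ℝ} (hY : 1 ≤ Y) (n : ℕ) (hn : Y < n) :
    ∃ a q b : ℕ, n = a * q * b ∧ q.Prime ∧ (a : ℝ) ≤ Y ∧ Y < ((a * q : ℕ) : ℝ) ∧
      (∀ p, p.Prime → p ∣ a → p ≤ q) ∧ (∀ p, p.Prime → p ∣ b → q ≤ p) := by
  induction n using Nat.strong_induction_on with
  | _ n ih =>
    have hn1 : 1 < n := by exact_mod_cast hY.trans_lt hn
    have hne : n.primeFactors.Nonempty := Nat.nonempty_primeFactors.mpr hn1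
    set l := n.primeFactors.max' hne with hl
    obtain ⟨hlp, hld, -⟩ := Nat.mem_primeFactors.mp (n.primeFactors.max'_mem hne)
    have hmax : ∀ p, p.Prime → p ∣ n → p ≤ l := fun p hp hpn =>
      n.primeFactors.le_max' _ (Nat.mem_primeFactors.mpr ⟨hp, hpn, by omega⟩)
    rw [← hl] at hlp hld
    obtain ⟨m, hm⟩ := hld
    have hm0 : 0 < m := Nat.pos_of_ne_zero (by rintro rfl; omega)
    rcases lt_or_ge Y (m : ℝ) with h | h
    · obtain ⟨a, q, b, h1, h2, h3, h4, h5, h6⟩ := ih m (by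
        rw [hm]; exact lt_mul_of_one_lt_left hm0 hlp.one_lt) h
      refine ⟨a, q, b * l, by rw [hm, h1]; ring, h2, h3, h4, h5, fun p hp hpb => ?_⟩
      rcases (hp.dvd_mul).mp hpb with h7 | h7
      · exact h6 p hp h7
      · rw [(Nat.prime_dvd_prime_iff_eq hp hlp).mp h7]
        refine hmax q h2 ?_
        rw [hm, h1]
        exact Dvd.intro_left (l * a * b) (by ring)
    · refine ⟨m, l, 1, by rw [hm]; ring, hlp, h, by rw [mul_comm, ← hm]; exact hn,
        fun p hp hpm => hmax p hp (hm ▸ hpm.mul_left l), fun p hp hp1 => ?_⟩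
      exact absurd (Nat.dvd_one.mp hp1) hp.ne_one

lemma pow_cardFactors_le {q b : ℕ} (hb : b ≠ 0) (h : ∀ p, p.Prime → p ∣ b → q ≤ p) :
    q ^ ArithmeticFunction.cardFactors b ≤ b := by
  induction b using induction_on_primes with
  | zero => exact absurd rfl hb
  | one => simp
  | prime_mul p b hp ih =>
    have hb' : b ≠ 0 := right_ne_zero_of_mul hb
    rw [ArithmeticFunction.cardFactors_mul hp.ne_zero hb',
      ArithmeticFunction.cardFactors_apply_prime hp, pow_add, pow_one]
    exact Nat.mul_le_mul (h p hp (dvd_mul_right _ _))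
      (ih hb' fun l hl hlb => h l hl (hlb.mul_left p))

lemma exists_tau_rough_le (K : ℕ) {δ : ℝ} (hδ : 0 < δ) :
    ∃ C : ℝ, 0 < C ∧ ∀ (X : ℝ) (q b : ℕ), 1 ≤ X → 2 ≤ q → b ≠ 0 → (b : ℝ) ≤ X ^ 2 →
      (∀ p, p.Prime → p ∣ b → q ≤ p) →
      (tau K b : ℝ) ≤ C * X ^ (min (4 * K / δ / Real.log q) (1 / 4) * (δ / 2)) := by
  obtain ⟨C, hC, hCb⟩ := exists_tau_le_rpow K (ε := δ / 16) (by positivity)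
  refine ⟨max C 1, by positivity, fun X q b hX hq hb hbX hrough => ?_⟩
  have hX0 : 0 < X := by linarith
  have hlogq : 0 < Real.log q := Real.log_pos (by exact_mod_cast (by omega : 1 < q))
  rcases le_total (4 * K / δ / Real.log q) (1 / 4) with h | h
  · rw [min_eq_left h]
    set Ω := ArithmeticFunction.cardFactors b
    have h1 : Ω * Real.log q ≤ 2 * Real.log X := by
      have : ((q : ℝ) ^ Ω) ≤ X ^ 2 :=
        le_trans (by exact_mod_cast pow_cardFactors_le hb hrough) hbX
      have := Real.log_le_log (by positivity) this
      rwa [Real.log_pow, Real.log_pow] at this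
    calc (tau K b : ℝ) ≤ (K : ℝ) ^ Ω := by exact_mod_cast tau_le_pow_cardFactors K b hb
      _ ≤ (Real.exp K) ^ Ω := by
          gcongr
          linarith [Real.add_one_le_exp (K : ℝ)]
      _ = Real.exp (K * Ω) := by rw [← Real.exp_nat_mul]; ring_nf
      _ ≤ X ^ (4 * K / δ / Real.log q * (δ / 2)) := by
          rw [Real.rpow_def_of_pos hX0]
          apply Real.exp_le_exp.mpr
          have : Real.log X * (4 * K / δ / Real.log q * (δ / 2)) =
              K * (2 * Real.log X / Real.log q) := by
            field_simp; ring
          rw [this]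
          gcongr
          rwa [le_div_iff₀ hlogq]
      _ ≤ _ := le_mul_of_one_le_left (by positivity) (le_max_right _ _)
  · rw [min_eq_right h]
    calc (tau K b : ℝ) ≤ C * (b : ℝ) ^ (δ / 16) := hCb b hb
      _ ≤ max C 1 * (X ^ 2) ^ (δ / 16) := by gcongr; exact le_max_left _ _
      _ = _ := by
          rw [← Real.rpow_natCast X 2, ← Real.rpow_mul hX0.le]
          congr 2; push_cast; ring

lemma card_Ioc_filter_dvd_le {y h : ℝ} (hy : 0 ≤ y) {a : ℕ} (ha : 1 ≤ a) (hah : (a : ℝ) ≤ h) :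
    (((Ioc ⌊y⌋₊ ⌊y + h⌋₊).filter (fun n => a ∣ n)).card : ℝ) ≤ 2 * h * (a : ℝ)⁻¹ := by
  have ha0 : (0 : ℝ) < a := by exact_mod_cast ha
  have hsub : (Ioc ⌊y⌋₊ ⌊y + h⌋₊).filter (fun n => a ∣ n) ⊆
      (Ioc ⌊y / a⌋₊ ⌊(y + h) / a⌋₊).image (fun m => a * m) := by
    intro n hn
    obtain ⟨hn1, m, rfl⟩ := mem_filter.mp hn
    obtain ⟨h1, h2⟩ := mem_Ioc.mp hn1
    refine mem_image.mpr ⟨m, mem_Ioc.mpr ⟨?_, ?_⟩, rfl⟩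
    · rw [Nat.floor_div_natCast]
      exact Nat.div_lt_of_lt_mul h1
    · rw [Nat.floor_div_natCast]
      rw [Nat.le_div_iff_mul_le (by omega), mul_comm]
      exact h2
  have hcard := (card_le_card hsub).trans card_image_le
  rw [Nat.card_Ioc] at hcard
  have hmono : ⌊y / a⌋₊ ≤ ⌊(y + h) / a⌋₊ := Nat.floor_le_floor (by gcongr; linarith)
  calc _ ≤ ((⌊(y + h) / a⌋₊ - ⌊y / a⌋₊ : ℕ) : ℝ) := by exact_mod_cast hcard
    _ = (⌊(y + h) / a⌋₊ : ℝ) - ⌊y / a⌋₊ := by rw [Nat.cast_sub hmono]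
    _ ≤ (y + h) / a - (y / a - 1) := by
        gcongr
        · exact Nat.floor_le (div_nonneg (by linarith) ha0.le)
        · linarith [Nat.lt_floor_add_one (y / a)]
    _ = h / a + 1 := by ring
    _ ≤ h / a + h / a := by gcongr; rwa [one_le_div ha0]
    _ = _ := by ring

lemma sum_tau_smooth_le (K N : ℕ) {q : ℕ} (hq : 2 ≤ q) {σ B : ℝ} (hσ : 0 ≤ σ)
    (hσ' : σ ≤ 1 / 4) (hB : σ * Real.log q ≤ B) :
    ∑ a ∈ smoothUpTo N q, (tau K a : ℝ) * (a : ℝ) ^ (σ - 1) ≤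
      (Real.exp (9 * B * Real.exp B) * (1 + Real.log N)) ^ K := by
  set w : ℕ → ℝ := fun a => if ∀ p ∈ a.primeFactors, p ≤ q then (a : ℝ) ^ (σ - 1) else 0 with hw
  have hsum : ∀ g : ℕ → ℝ, ∑ a ∈ smoothUpTo N q, g a * (a : ℝ) ^ (σ - 1) =
      ∑ a ∈ Icc 1 N, g a * w a := fun g => by
    rw [smoothUpTo, sum_filter]
    refine sum_congr rfl fun a _ => ?_
    simp only [hw]
    split_ifs <;> simp
  have hw0 : ∀ n, 0 ≤ w n := fun n => by
    simp only [hw]; split_ifs <;> positivity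
  rw [hsum]
  refine (sum_tau_mul_le_pow w hw0 (by simp [hw]) (fun m n => ?_) K N).trans ?_
  · by_cases hmn : m * n = 0
    · have : w (m * n) = 0 := by
        rw [hmn]
        simp only [hw, Nat.cast_zero]
        rw [Real.zero_rpow (by linarith), ite_self]
      rw [this]
      exact mul_nonneg (hw0 m) (hw0 n)
    by_cases hs : ∀ p ∈ (m * n).primeFactors, p ≤ q
    · obtain ⟨hm, hn⟩ := mul_ne_zero_iff.mp hmn
      rw [Nat.primeFactors_mul hm hn] at hs
      have h1 : ∀ p ∈ m.primeFactors, p ≤ q := fun p hp => hs p (mem_union_left _ hp)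
      have h2 : ∀ p ∈ n.primeFactors, p ≤ q := fun p hp => hs p (mem_union_right _ hp)
      rw [← Nat.primeFactors_mul hm hn] at hs
      simp only [hw]
      rw [if_pos hs, if_pos h1, if_pos h2, Nat.cast_mul,
        Real.mul_rpow (Nat.cast_nonneg _) (Nat.cast_nonneg _)]
    · have : w (m * n) = 0 := if_neg hs
      rw [this]
      exact mul_nonneg (hw0 m) (hw0 n)
  · have := sum_smooth_rpow_le N hq hσ hσ' hB
    have h1 := hsum 1
    simp only [Pi.one_apply, one_mul] at h1
    rw [← h1]
    have h0 : 0 ≤ ∑ a ∈ smoothUpTo N q, (a : ℝ) ^ (σ - 1) := sum_nonneg fun _ _ => by positivity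
    gcongr

/-- The exponent used in Rankin's trick for integers with largest prime factor `q`. -/
noncomputable def rankinExponent (B : ℝ) (q : ℕ) : ℝ := min (B / Real.log q) (1 / 4)

lemma exists_tau_le_sum_divisors (K : ℕ) {δ : ℝ} (hδ : 0 < δ) :
    ∃ C : ℝ, 0 < C ∧ ∀ (X : ℝ) (N n : ℕ), 3 ≤ X → X ^ δ < N + 1 → n ≠ 0 → (n : ℝ) ≤ X ^ 2 →
      (tau K n : ℝ) ≤ C * (∑ a ∈ Icc 1 N with a ∣ n, (tau K a : ℝ) +
        ∑ q ∈ Icc 1 N with q.Prime, ∑ a ∈ smoothUpTo N q with a * q ∣ n ∧ a * q ≤ N,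
          (tau K a : ℝ) * ((a * q : ℕ) : ℝ) ^ rankinExponent (4 * K / δ) q) := by
  obtain ⟨C, hC, hCb⟩ := exists_tau_rough_le K hδ
  refine ⟨1 + C * Real.exp (8 * K / δ) + K * C, by positivity,
    fun X N n hX hN hn hnX => ?_⟩
  set D := 1 + C * Real.exp (8 * K / δ) + K * C with hD
  have hX0 : 0 < X := by linarith
  have hX1 : 1 ≤ X := by linarith
  have hlX : 0 < Real.log X := Real.log_pos (by linarith)
  set S1 := ∑ a ∈ Icc 1 N with a ∣ n, (tau K a : ℝ) with hS1
  set S2 := ∑ q ∈ Icc 1 N with q.Prime, ∑ a ∈ smoothUpTo N q with a * q ∣ n ∧ a * q ≤ N,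
          (tau K a : ℝ) * ((a * q : ℕ) : ℝ) ^ rankinExponent (4 * K / δ) q with hS2
  have hS1' : 0 ≤ S1 := sum_nonneg fun _ _ => by positivity
  have hS2' : 0 ≤ S2 := sum_nonneg fun _ _ => sum_nonneg fun _ _ => by positivity
  have hle_N : ∀ m : ℕ, (m : ℝ) ≤ X ^ δ → m ≤ N := fun m hm => by
    have : (m : ℝ) < N + 1 := hm.trans_lt hN
    exact Nat.lt_succ_iff.mp (by exact_mod_cast this)
  have hterm1 : ∀ a, a ≠ 0 → a ≤ N → a ∣ n → (tau K a : ℝ) ≤ S1 := fun a ha haN han =>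
    single_le_sum (f := fun a => (tau K a : ℝ)) (fun _ _ => by positivity)
      (mem_filter.mpr ⟨mem_Icc.mpr ⟨Nat.pos_of_ne_zero ha, haN⟩, han⟩)
  have hYX : X ^ (δ / 2) ≤ X ^ δ := Real.rpow_le_rpow_of_exponent_le hX1 (by linarith)
  have hC1 : 0 ≤ C * Real.exp (8 * K / δ) := by positivity
  have hC2 : 0 ≤ K * C := by positivity
  rcases le_or_gt (n : ℝ) (X ^ (δ / 2)) with h | h
  · have h1 := hterm1 n hn (hle_N n (h.trans hYX)) dvd_rfl
    calc (tau K n : ℝ) ≤ 1 * (S1 + S2) := by linarith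
      _ ≤ _ := by gcongr; linarith
  obtain ⟨a, q, b, hnab, hq, haY, hYaq, hsm, hro⟩ :=
    exists_smooth_mul_prime_mul_rough (Real.one_le_rpow hX1 (by positivity)) n h
  have ha : a ≠ 0 := by rintro rfl; simp at hnab; exact hn hnab
  have hb : b ≠ 0 := by rintro rfl; simp at hnab; exact hn hnab
  have hlogq : 0 < Real.log q := Real.log_pos (by exact_mod_cast hq.one_lt)
  have hq0 : (0 : ℝ) < q := by exact_mod_cast hq.pos
  rcases lt_or_ge (X ^ (δ / 4)) (q : ℝ) with hqX | hqX
  · have hqb : q * b ∣ n := ⟨a, by rw [hnab]; ring⟩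
    have h1 := hCb X q (q * b) hX1 hq.two_le (mul_ne_zero hq.ne_zero hb)
      (le_trans (by exact_mod_cast Nat.le_of_dvd (Nat.pos_of_ne_zero hn) hqb) hnX)
      (fun p hp hpq => by
        rcases (hp.dvd_mul).mp hpq with h2 | h2
        · exact ((Nat.prime_dvd_prime_iff_eq hp hq).mp h2).ge
        · exact hro p hp h2)
    have h2 : X ^ (min (4 * K / δ / Real.log q) (1 / 4) * (δ / 2)) ≤ Real.exp (8 * K / δ) := by
      rw [Real.rpow_def_of_pos hX0]
      apply Real.exp_le_exp.mpr
      have h3 : δ / 4 * Real.log X ≤ Real.log q := by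
        rw [← Real.log_rpow hX0]
        exact Real.log_le_log (by positivity) hqX.le
      calc Real.log X * (min (4 * K / δ / Real.log q) (1 / 4) * (δ / 2))
          ≤ Real.log X * (4 * K / δ / Real.log q * (δ / 2)) := by
            gcongr; exact min_le_left _ _
        _ = (δ / 4 * Real.log X) * (8 * K / δ) / Real.log q := by ring
        _ ≤ Real.log q * (8 * K / δ) / Real.log q := by gcongr
        _ = 8 * K / δ := by field_simp
    have h3 := hterm1 a ha (hle_N a (haY.trans hYX)) ⟨q * b, by rw [hnab]; ring⟩
    calc (tau K n : ℝ) ≤ tau K a * tau K (q * b) := by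
          rw [hnab, mul_assoc]; exact_mod_cast tau_mul_le K a (q * b)
      _ ≤ S1 * (C * Real.exp (8 * K / δ)) := by
          gcongr
          exact h1.trans (by gcongr)
      _ = C * Real.exp (8 * K / δ) * S1 := by ring
      _ ≤ D * (S1 + S2) := by
          gcongr
          · rw [hD]; linarith
          · linarith
  · have h1 := hCb X q b hX1 hq.two_le hb
      (le_trans (by exact_mod_cast Nat.le_of_dvd (Nat.pos_of_ne_zero hn) ⟨a * q, by rw [hnab]; ring⟩) hnX) hro
    have haq : ((a * q : ℕ) : ℝ) ≤ X ^ δ := by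
      push_cast
      calc (a : ℝ) * q ≤ X ^ (δ / 2) * X ^ (δ / 4) := by gcongr
        _ = X ^ (δ / 2 + δ / 4) := (Real.rpow_add hX0 _ _).symm
        _ ≤ X ^ δ := Real.rpow_le_rpow_of_exponent_le hX1 (by linarith)
    have haqN := hle_N _ haq
    have hσ0 : 0 ≤ rankinExponent (4 * K / δ) q := by
      unfold rankinExponent; positivity
    have h2 : X ^ (min (4 * K / δ / Real.log q) (1 / 4) * (δ / 2)) ≤
        ((a * q : ℕ) : ℝ) ^ rankinExponent (4 * K / δ) q := by
      rw [mul_comm, Real.rpow_mul hX0.le]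
      exact Real.rpow_le_rpow (by positivity) hYaq.le hσ0
    have ha1 : 1 ≤ a := Nat.pos_of_ne_zero ha
    have hmem : a ∈ (smoothUpTo N q).filter (fun a => a * q ∣ n ∧ a * q ≤ N) := by
      refine mem_filter.mpr ⟨mem_smoothUpTo.mpr ⟨⟨ha1, ?_⟩, hsm⟩, ⟨b, hnab⟩, haqN⟩
      exact (Nat.le_mul_of_pos_right a hq.pos).trans haqN
    have hmemq : q ∈ (Icc 1 N).filter Nat.Prime :=
      mem_filter.mpr ⟨mem_Icc.mpr ⟨hq.one_le, (Nat.le_mul_of_pos_left q ha1).trans haqN⟩, hq⟩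
    have h3 : (tau K a : ℝ) * ((a * q : ℕ) : ℝ) ^ rankinExponent (4 * K / δ) q ≤ S2 :=
      (single_le_sum (f := fun a : ℕ => (tau K a : ℝ) *
        ((a * q : ℕ) : ℝ) ^ rankinExponent (4 * K / δ) q) (fun _ _ => by positivity) hmem).trans
        (single_le_sum (f := fun q : ℕ => ∑ a ∈ smoothUpTo N q with a * q ∣ n ∧ a * q ≤ N,
          (tau K a : ℝ) * ((a * q : ℕ) : ℝ) ^ rankinExponent (4 * K / δ) q)
          (fun _ _ => sum_nonneg fun _ _ => by positivity) hmemq)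
    calc (tau K n : ℝ) ≤ tau K a * K * tau K b := by
          rw [hnab]
          have h4 := tau_mul_le K (a * q) b
          have h5 := tau_mul_le K a q
          rw [tau_prime K hq] at h5
          exact_mod_cast h4.trans (Nat.mul_le_mul_right _ h5)
      _ ≤ tau K a * K * (C * ((a * q : ℕ) : ℝ) ^ rankinExponent (4 * K / δ) q) := by
          gcongr
          exact h1.trans (by gcongr)
      _ = K * C * (tau K a * ((a * q : ℕ) : ℝ) ^ rankinExponent (4 * K / δ) q) := by ring
      _ ≤ D * (S1 + S2) := by
          gcongr
          · rw [hD]; linarith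
          · linarith

/-- The mean value of `d_K` over a short interval, up to one extra logarithm. -/
lemma exists_sum_tau_Ioc_le (K : ℕ) {δ : ℝ} (hδ : 0 < δ) :
    ∃ C : ℝ, 0 < C ∧ ∀ X y h : ℝ, 3 ≤ X → 0 ≤ y → X ^ δ ≤ h → y + h ≤ 2 * X →
      ∑ n ∈ Ioc ⌊y⌋₊ ⌊y + h⌋₊, (tau K n : ℝ) ≤ C * h * Real.log X ^ (K + 1) := by
  obtain ⟨C, hC, hCb⟩ := exists_tau_le_sum_divisors K hδ
  set B : ℝ := 4 * K / δ with hB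
  have hB0 : 0 ≤ B := by positivity
  set E := Real.exp (9 * B * Real.exp B) with hE
  refine ⟨C * (2 * 3 ^ (K + 1) * (1 + Real.exp B * E ^ K)), by positivity,
    fun X y h hX hy hh hyh => ?_⟩
  have hX0 : 0 < X := by linarith
  have h1 : 1 ≤ h := (Real.one_le_rpow (by linarith) hδ.le).trans hh
  have hlX : 1 ≤ Real.log X := by
    rw [Real.le_log_iff_exp_le hX0]
    exact (Real.exp_one_lt_d9.le.trans (by norm_num)).trans hX
  set N := ⌊h⌋₊ with hN
  have hNh : (N : ℝ) ≤ h := Nat.floor_le (by linarith)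
  have hN1 : 1 ≤ N := Nat.one_le_floor_iff _ |>.mpr h1
  have hlogN : 1 + Real.log N ≤ 3 * Real.log X := by
    have : Real.log N ≤ Real.log (X ^ 2) :=
      Real.log_le_log (by exact_mod_cast hN1) (by nlinarith)
    rw [Real.log_pow] at this
    push_cast at this
    linarith
  have hlogN0 : 0 ≤ Real.log N := Real.log_natCast_nonneg N
  set I := Ioc ⌊y⌋₊ ⌊y + h⌋₊ with hI
  have hcount : ∀ a : ℕ, 1 ≤ a → a ≤ N → ((I.filter (fun n => a ∣ n)).card : ℝ) ≤
      2 * h * (a : ℝ)⁻¹ := fun a ha haN =>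
    card_Ioc_filter_dvd_le hy ha (le_trans (by exact_mod_cast haN) hNh)
  have hT1 : ∑ n ∈ I, ∑ a ∈ Icc 1 N with a ∣ n, (tau K a : ℝ) ≤
      2 * h * (3 * Real.log X) ^ (K + 1) := by
    calc ∑ n ∈ I, ∑ a ∈ Icc 1 N with a ∣ n, (tau K a : ℝ)
        = ∑ a ∈ Icc 1 N, ∑ n ∈ I with a ∣ n, (tau K a : ℝ) := by
          simp_rw [sum_filter]; exact sum_comm
      _ ≤ ∑ a ∈ Icc 1 N, 2 * h * ((tau K a : ℝ) * (a : ℝ)⁻¹) := by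
          refine sum_le_sum fun a ha => ?_
          obtain ⟨ha1, ha2⟩ := mem_Icc.mp ha
          rw [sum_const, nsmul_eq_mul]
          calc _ ≤ (2 * h * (a : ℝ)⁻¹) * tau K a := by gcongr; exact hcount a ha1 ha2
            _ = _ := by ring
      _ ≤ 2 * h * (1 + Real.log N) ^ K := by
          rw [← mul_sum]; gcongr; exact sum_tau_div_le K N
      _ ≤ 2 * h * (3 * Real.log X) ^ K := by gcongr
      _ ≤ _ := by
          gcongr
          · linarith
          · omega
  have hT2 : ∑ n ∈ I, ∑ q ∈ Icc 1 N with q.Prime,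
      ∑ a ∈ smoothUpTo N q with a * q ∣ n ∧ a * q ≤ N,
        (tau K a : ℝ) * ((a * q : ℕ) : ℝ) ^ rankinExponent B q ≤
      2 * h * (Real.exp B * E ^ K) * (3 * Real.log X) ^ (K + 1) := by
    calc _ = ∑ q ∈ Icc 1 N with q.Prime, ∑ a ∈ smoothUpTo N q with a * q ≤ N,
          ∑ n ∈ I with a * q ∣ n,
            (tau K a : ℝ) * ((a * q : ℕ) : ℝ) ^ rankinExponent B q := by
          rw [sum_comm]
          refine sum_congr rfl fun q _ => ?_
          simp_rw [sum_filter]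
          rw [sum_comm]
          refine sum_congr rfl fun a _ => ?_
          by_cases h2 : a * q ≤ N <;> simp [h2]
      _ ≤ ∑ q ∈ Icc 1 N with q.Prime, ∑ a ∈ smoothUpTo N q,
            (2 * h * (q : ℝ) ^ (rankinExponent B q - 1)) *
              ((tau K a : ℝ) * (a : ℝ) ^ (rankinExponent B q - 1)) := by
          refine sum_le_sum fun q hq => ?_
          have hq' := (mem_filter.mp hq).2
          refine le_trans (sum_le_sum fun a ha => ?_)
            (sum_le_sum_of_subset_of_nonneg (filter_subset _ _) fun _ _ _ => by positivity)
          obtain ⟨ha1, ha2⟩ := mem_filter.mp ha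
          have ha0 : 1 ≤ a := (mem_smoothUpTo.mp ha1).1.1
          have haq : 1 ≤ a * q := Nat.mul_pos ha0 hq'.pos
          have haq0 : (0 : ℝ) < ((a * q : ℕ) : ℝ) := by exact_mod_cast haq
          rw [sum_const, nsmul_eq_mul]
          calc _ ≤ (2 * h * ((a * q : ℕ) : ℝ)⁻¹) *
                ((tau K a : ℝ) * ((a * q : ℕ) : ℝ) ^ rankinExponent B q) := by
                gcongr; exact hcount _ haq ha2
            _ = 2 * h * tau K a * ((a * q : ℕ) : ℝ) ^ (rankinExponent B q - 1) := by
                rw [Real.rpow_sub_one haq0.ne']; ring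
            _ = _ := by
                rw [Nat.cast_mul, Real.mul_rpow (Nat.cast_nonneg _) (Nat.cast_nonneg _)]; ring
      _ ≤ ∑ q ∈ Icc 1 N with q.Prime, (2 * h * (Real.exp B * E ^ K) *
            (3 * Real.log X) ^ K) * (q : ℝ)⁻¹ := by
          refine sum_le_sum fun q hq => ?_
          have hq' := (mem_filter.mp hq).2
          have hq0 : (0 : ℝ) < q := by exact_mod_cast hq'.pos
          have hlogq : 0 < Real.log q := Real.log_pos (by exact_mod_cast hq'.one_lt)
          have hσ0 : 0 ≤ rankinExponent B q := by unfold rankinExponent; positivity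
          have hσB : rankinExponent B q * Real.log q ≤ B := by
            rw [← le_div_iff₀ hlogq]; exact min_le_left _ _
          have hqσ : (q : ℝ) ^ (rankinExponent B q - 1) ≤ Real.exp B * (q : ℝ)⁻¹ := by
            rw [Real.rpow_sub_one hq0.ne', div_eq_mul_inv, Real.rpow_def_of_pos hq0]
            gcongr
            rwa [mul_comm]
          rw [← mul_sum]
          calc _ ≤ (2 * h * (Real.exp B * (q : ℝ)⁻¹)) * (E * (1 + Real.log N)) ^ K := by
                gcongr
                exact sum_tau_smooth_le K N hq'.two_le hσ0 (min_le_right _ _) hσB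
            _ ≤ (2 * h * (Real.exp B * (q : ℝ)⁻¹)) * (E * (3 * Real.log X)) ^ K := by gcongr
            _ = _ := by rw [mul_pow]; ring
      _ ≤ (2 * h * (Real.exp B * E ^ K) * (3 * Real.log X) ^ K) * (3 * Real.log X) := by
          rw [← mul_sum]
          gcongr
          refine le_trans ?_ hlogN
          exact (sum_le_sum_of_subset_of_nonneg (filter_subset _ _) fun _ _ _ => by positivity).trans
            (sum_inv_le_one_add_log N)
      _ = _ := by ring
  calc ∑ n ∈ I, (tau K n : ℝ) ≤ ∑ n ∈ I, C * (∑ a ∈ Icc 1 N with a ∣ n, (tau K a : ℝ) +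
        ∑ q ∈ Icc 1 N with q.Prime, ∑ a ∈ smoothUpTo N q with a * q ∣ n ∧ a * q ≤ N,
          (tau K a : ℝ) * ((a * q : ℕ) : ℝ) ^ rankinExponent B q) := by
        refine sum_le_sum fun n hn => hCb X N n hX (hh.trans_lt (Nat.lt_floor_add_one h)) ?_ ?_
        · have := (mem_Ioc.mp hn).1
          omega
        · have h2 : (n : ℝ) ≤ y + h := (Nat.le_floor_iff (by linarith)).mp (mem_Ioc.mp hn).2
          nlinarith
    _ ≤ C * (2 * h * (3 * Real.log X) ^ (K + 1) +
          2 * h * (Real.exp B * E ^ K) * (3 * Real.log X) ^ (K + 1)) := by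
        rw [← mul_sum, sum_add_distrib]
        gcongr
    _ = _ := by rw [mul_pow]; ring

lemma sum_range_choose_ramare (t : ℕ) (ht : t ≠ 0) :
    ∑ j ∈ range (t + 1), (t.choose j : ℂ) * ((-1) ^ j / (j + 1) * ((t - j : ℕ) : ℂ)) = 1 := by
  have h1 : ∀ j ∈ range (t + 1), (t.choose j : ℂ) * ((-1) ^ j / (j + 1) * ((t - j : ℕ) : ℂ)) =
      -((-1) ^ (j + 1) * (t.choose (j + 1) : ℂ)) := by
    intro j _
    have h2 : (t.choose (j + 1) : ℂ) * (j + 1) = t.choose j * ((t - j : ℕ) : ℂ) := by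
      exact_mod_cast Nat.choose_succ_right_eq t j
    have h3 : (j + 1 : ℂ) ≠ 0 := by exact_mod_cast j.succ_ne_zero
    field_simp
    rw [pow_succ]
    linear_combination (-(-1 : ℂ) ^ j) * h2
  rw [sum_congr rfl h1, sum_neg_distrib]
  have h4 := Int.alternating_sum_range_choose_of_ne ht
  have h5 : ∑ j ∈ range (t + 1), ((-1 : ℂ) ^ j * (t.choose j : ℂ)) = 0 := by exact_mod_cast h4
  have h6 : ∑ j ∈ range (t + 1 + 1), ((-1 : ℂ) ^ j * (t.choose j : ℂ)) = 0 := by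
    rw [sum_range_succ, h5]; simp
  rw [sum_range_succ'] at h6
  simp only [pow_zero, Nat.choose_zero_right, Nat.cast_one, mul_one] at h6
  linear_combination -h6

lemma sum_divisors_card_primeFactors {D : ℕ} (hD : Squarefree D) (g : ℕ → ℂ) :
    ∑ r ∈ D.divisors, g r.primeFactors.card =
      ∑ j ∈ range (D.primeFactors.card + 1), (D.primeFactors.card.choose j : ℂ) * g j := by
  have h : ∑ m ∈ D.primeFactors.powerset, g m.card = _ := sum_powerset_apply_card g
  simp only [nsmul_eq_mul] at h
  rw [← h]
  have hprime : ∀ s ∈ D.primeFactors.powerset, ∀ p ∈ s, p.Prime := fun s hs p hp =>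
    Nat.prime_of_mem_primeFactors (mem_powerset.mp hs hp)
  refine sum_nbij' (fun r => r.primeFactors) (fun s => ∏ p ∈ s, p) ?_ ?_ ?_ ?_ ?_
  · intro r hr
    exact mem_powerset.mpr (Nat.primeFactors_mono (Nat.dvd_of_mem_divisors hr) hD.ne_zero)
  · intro s hs
    refine Nat.mem_divisors.mpr ⟨?_, hD.ne_zero⟩
    rw [← Nat.prod_primeFactors_of_squarefree hD]
    exact prod_dvd_prod_of_subset _ _ _ (mem_powerset.mp hs)
  · intro r hr
    exact Nat.prod_primeFactors_of_squarefree
      (hD.squarefree_of_dvd (Nat.dvd_of_mem_divisors hr))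
  · intro s hs
    exact Nat.primeFactors_prod (hprime s hs)
  · intro r _; rfl

/-- Factorizations `n = p r m` with `p` a prime divisor of `M`, as triples `(p, (r, m))`. -/
def primeTriples (M n : ℕ) : Finset (ℕ × ℕ × ℕ) :=
  (n.divisors ×ˢ (n.divisors ×ˢ n.divisors)).filter
    fun v => v.1 * v.2.1 * v.2.2 = n ∧ v.1.Prime ∧ v.1 ∣ M

lemma mem_primeTriples {M n : ℕ} (hn : n ≠ 0) {v : ℕ × ℕ × ℕ} :
    v ∈ primeTriples M n ↔ v.1 * v.2.1 * v.2.2 = n ∧ v.1.Prime ∧ v.1 ∣ M := by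
  simp only [primeTriples, mem_filter, mem_product, Nat.mem_divisors, and_iff_right_iff_imp]
  rintro ⟨h, -, -⟩
  exact ⟨⟨⟨v.2.1 * v.2.2, by rw [← h]; ring⟩, hn⟩,
    ⟨⟨v.1 * v.2.2, by rw [← h]; ring⟩, hn⟩, ⟨⟨v.1 * v.2.1, by rw [← h]; ring⟩, hn⟩⟩

/-- The coefficients `μ(r) f(r) / (ω(r) + 1)`, supported on the divisors of `M`. -/
noncomputable def ramareCoeff (f : ℕ → ℂ) (M r : ℕ) : ℂ :=
  if r ∣ M then (-1) ^ r.primeFactors.card / (r.primeFactors.card + 1) * f r else 0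

lemma norm_ramareCoeff_le (f : ℕ → ℂ) (M r : ℕ) : ‖ramareCoeff f M r‖ ≤ ‖f r‖ := by
  unfold ramareCoeff
  split_ifs
  · rw [norm_mul, norm_div, norm_pow, norm_neg, norm_one, one_pow]
    refine mul_le_of_le_one_left (norm_nonneg _) ?_
    have : ‖((r.primeFactors.card : ℂ) + 1)‖ = (r.primeFactors.card : ℝ) + 1 := by
      exact_mod_cast Complex.norm_natCast (r.primeFactors.card + 1)
    rw [this]
    exact div_le_one_of_le₀ (by linarith [Nat.cast_nonneg (α := ℝ) r.primeFactors.card])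
      (by positivity)
  · simp

lemma sum_primeTriples_ramareCoeff {f : ℕ → ℂ}
    (hf : ∀ m n : ℕ, m.Coprime n → f (m * n) = f m * f n) {M n : ℕ} (hM : Squarefree M)
    (hn : n ≠ 0) (hsq : ∀ p, p.Prime → p ∣ M → ¬ p ^ 2 ∣ n) :
    ∑ v ∈ primeTriples M n, ramareCoeff f M v.2.1 * f v.1 * f v.2.2 =
      if 1 < n.gcd M then f n else 0 := by
  set D := n.gcd M with hDdef
  have hDM : D ∣ M := Nat.gcd_dvd_right n M
  have hDn : D ∣ n := Nat.gcd_dvd_left n M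
  have hD : Squarefree D := hM.squarefree_of_dvd hDM
  set ω : ℕ → ℕ := fun r => r.primeFactors.card with hω
  have hcop : ∀ p x, p.Prime → p ∣ M → p * x ∣ n → p.Coprime x := by
    intro p x hp hpM hpx
    refine (hp.coprime_iff_not_dvd).mpr fun h => hsq p hp hpM ?_
    rw [sq]
    exact (Nat.mul_dvd_mul_left p h).trans hpx
  calc ∑ v ∈ primeTriples M n, ramareCoeff f M v.2.1 * f v.1 * f v.2.2
      = ∑ v ∈ primeTriples M n with v.2.1 ∣ M, ramareCoeff f M v.2.1 * f v.1 * f v.2.2 := by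
        rw [sum_filter]
        refine sum_congr rfl fun v _ => ?_
        split_ifs with h
        · rfl
        · simp [ramareCoeff, h]
    _ = ∑ x ∈ D.divisors ×ˢ D.primeFactors with ¬ x.2 ∣ x.1,
          (-1 : ℂ) ^ ω x.1 / (ω x.1 + 1) * f n := by
        refine sum_nbij' (fun v => (v.2.1, v.1)) (fun x => (x.2, (x.1, n / (x.2 * x.1))))
          ?_ ?_ ?_ ?_ ?_
        · rintro ⟨p, r, m⟩ hv
          simp only [mem_filter, mem_primeTriples hn] at hv
          obtain ⟨⟨h1, hp, hpM⟩, hrM⟩ := hv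
          have hpr : p * r ∣ n := ⟨m, h1.symm⟩
          simp only [mem_filter, mem_product, Nat.mem_divisors, Nat.mem_primeFactors]
          exact ⟨⟨⟨Nat.dvd_gcd ((dvd_mul_left r p).trans hpr) hrM, hD.ne_zero⟩, hp,
            Nat.dvd_gcd ((dvd_mul_right p r).trans hpr) hpM, hD.ne_zero⟩,
            (hp.coprime_iff_not_dvd).mp (hcop p r hp hpM hpr)⟩
        · rintro ⟨r, p⟩ hx
          simp only [mem_filter, mem_product, Nat.mem_divisors, Nat.mem_primeFactors] at hx
          obtain ⟨⟨⟨hrD, -⟩, hp, hpD, -⟩, hpr⟩ := hx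
          have hprn : p * r ∣ n := ((hp.coprime_iff_not_dvd).mpr hpr).mul_dvd_of_dvd_of_dvd
            (hpD.trans hDn) (hrD.trans hDn)
          simp only [mem_filter, mem_primeTriples hn]
          exact ⟨⟨Nat.mul_div_cancel' hprn, hp, hpD.trans hDM⟩, hrD.trans hDM⟩
        · rintro ⟨p, r, m⟩ hv
          simp only [mem_filter, mem_primeTriples hn] at hv
          obtain ⟨⟨h1, hp, hpM⟩, hrM⟩ := hv
          have hpr0 : 0 < p * r := Nat.pos_of_ne_zero (by rintro h; simp [h] at h1; omega)
          simp only [Prod.mk.injEq, true_and]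
          rw [← h1, Nat.mul_div_cancel_left _ hpr0]
        · rintro ⟨r, p⟩ _; rfl
        · rintro ⟨p, r, m⟩ hv
          simp only [mem_filter, mem_primeTriples hn] at hv
          obtain ⟨⟨h1, hp, hpM⟩, hrM⟩ := hv
          have hprm : p.Coprime (r * m) := hcop p (r * m) hp hpM ⟨1, by rw [← h1]; ring⟩
          have hrm : r.Coprime m := by
            refine Nat.coprime_of_dvd fun l hl hlr hlm => hsq l hl (hlr.trans hrM) ?_
            rw [sq, ← h1, mul_assoc]
            exact (mul_dvd_mul hlr hlm).mul_left p
          have hfn : f n = f p * (f r * f m) := by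
            rw [← h1, mul_assoc, hf _ _ hprm, hf _ _ hrm]
          simp only [ramareCoeff, if_pos hrM, hfn, hω]
          ring
    _ = f n * ∑ r ∈ D.divisors, (-1 : ℂ) ^ ω r / (ω r + 1) * ((ω D - ω r : ℕ) : ℂ) := by
        rw [sum_filter, sum_product, mul_sum]
        refine sum_congr rfl fun r hr => ?_
        have hrD := Nat.dvd_of_mem_divisors hr
        have hcard : (D.primeFactors.filter (fun p => ¬ p ∣ r)).card = ω D - ω r := by
          have : D.primeFactors.filter (fun p => ¬ p ∣ r) = D.primeFactors \ r.primeFactors := by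
            ext p
            simp only [mem_filter, mem_sdiff, Nat.mem_primeFactors]
            have hr0 : r ≠ 0 := (Nat.pos_of_mem_divisors hr).ne'
            tauto
          rw [this, card_sdiff_of_subset (Nat.primeFactors_mono hrD hD.ne_zero)]
        rw [← sum_filter]
        dsimp only
        rw [sum_const, hcard, nsmul_eq_mul]
        ring
    _ = if 1 < D then f n else 0 := by
        have h := sum_divisors_card_primeFactors hD
          (fun j => (-1 : ℂ) ^ j / (j + 1) * ((ω D - j : ℕ) : ℂ))
        simp only [hω] at h ⊢
        rw [h]
        split_ifs with h1
        · rw [sum_range_choose_ramare _ (card_ne_zero.mpr (Nat.nonempty_primeFactors.mpr h1)),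
            mul_one]
        · have : D = 1 := by
            have := Nat.pos_of_ne_zero hD.ne_zero
            omega
          simp [this]

lemma sum_primeTriples_tau_le (k M : ℕ) {n : ℕ} (hn : n ≠ 0) :
    ∑ v ∈ primeTriples M n, tau k v.2.1 * tau k v.1 * tau k v.2.2 ≤ tau (3 * k) n := by
  rw [show 3 * k = k + (k + k) by ring, tau_add]
  simp_rw [tau_add k k, mul_sum]
  rw [sum_sigma']
  set g : (Σ _ : ℕ × ℕ, ℕ × ℕ) → ℕ := fun x => tau k x.1.1 * (tau k x.2.1 * tau k x.2.2)
  set i : ℕ × ℕ × ℕ → Σ _ : ℕ × ℕ, ℕ × ℕ := fun v => ⟨(v.1, v.2.1 * v.2.2), (v.2.1, v.2.2)⟩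
  have hi : ∀ v w, i v = i w → v = w := by
    rintro ⟨p, r, m⟩ ⟨p', r', m'⟩ h
    simp only [i, Sigma.mk.injEq, Prod.mk.injEq, heq_eq_eq] at h
    obtain ⟨⟨rfl, -⟩, rfl, rfl⟩ := h
    rfl
  calc ∑ v ∈ primeTriples M n, tau k v.2.1 * tau k v.1 * tau k v.2.2
      = ∑ v ∈ primeTriples M n, g (i v) := sum_congr rfl fun v _ => by
        simp only [g, i]; ring
    _ = ∑ x ∈ (primeTriples M n).image i, g x := (sum_image fun v _ w _ h => hi v w h).symm
    _ ≤ _ := by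
        refine sum_le_sum_of_subset ?_
        intro x hx
        obtain ⟨⟨p, r, m⟩, hv, rfl⟩ := mem_image.mp hx
        obtain ⟨h1, -, -⟩ := (mem_primeTriples hn).mp hv
        simp only at h1
        simp only [i, mem_sigma, Nat.mem_divisorsAntidiagonal]
        refine ⟨⟨by rw [← h1]; ring, hn⟩, trivial, fun h => hn ?_⟩
        rw [← h1, mul_assoc, h, mul_zero]

lemma norm_sub_sum_primeTriples_le {f : ℕ → ℂ} {k : ℕ} (hfk : ∀ n, n ≠ 0 → ‖f n‖ ≤ tau k n)
    (M R : ℕ) {n : ℕ} (hn : n ≠ 0) :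
    ‖(if 1 < n.gcd M then f n else 0) -
        ∑ v ∈ primeTriples M n with v.2.1 ≤ R, ramareCoeff f M v.2.1 * f v.1 * f v.2.2‖ ≤
      2 * (tau (3 * k) n : ℝ) := by
  have hsum : ‖∑ v ∈ primeTriples M n with v.2.1 ≤ R,
      ramareCoeff f M v.2.1 * f v.1 * f v.2.2‖ ≤ tau (3 * k) n := by
    calc _ ≤ ∑ v ∈ primeTriples M n with v.2.1 ≤ R,
          ((tau k v.2.1 * tau k v.1 * tau k v.2.2 : ℕ) : ℝ) := by
          refine (norm_sum_le _ _).trans (sum_le_sum fun v hv => ?_)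
          have h4 := ((mem_primeTriples hn).mp (mem_filter.mp hv).1).1
          rw [← h4, mul_ne_zero_iff, mul_ne_zero_iff] at hn
          rw [norm_mul, norm_mul]
          push_cast
          gcongr
          · exact (norm_ramareCoeff_le f M _).trans (hfk _ hn.1.2)
          · exact hfk _ hn.1.1
          · exact hfk _ hn.2
      _ ≤ ∑ v ∈ primeTriples M n, ((tau k v.2.1 * tau k v.1 * tau k v.2.2 : ℕ) : ℝ) :=
          sum_le_sum_of_subset_of_nonneg (filter_subset _ _) fun _ _ _ => by positivity
      _ ≤ _ := by exact_mod_cast sum_primeTriples_tau_le k M hn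
  have hfn : ‖if 1 < n.gcd M then f n else 0‖ ≤ tau (3 * k) n := by
    split_ifs
    · refine (hfk n hn).trans ?_
      rw [show 3 * k = k + (k + k) by ring]
      exact_mod_cast tau_le_add k (k + k) hn
    · simp
  refine (norm_sub_le _ _).trans ?_
  linarith

lemma sub_sum_primeTriples_eq_zero {f : ℕ → ℂ}
    (hf : ∀ m n : ℕ, m.Coprime n → f (m * n) = f m * f n) {M : ℕ} (hM : Squarefree M) {R n : ℕ}
    (hn : n ≠ 0) (hsq : ∀ p, p.Prime → p ∣ M → ¬ p ^ 2 ∣ n)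
    (hR : ∀ r, r ∣ M → r ∣ n → r ≤ R) :
    (if 1 < n.gcd M then f n else 0) -
        ∑ v ∈ primeTriples M n with v.2.1 ≤ R, ramareCoeff f M v.2.1 * f v.1 * f v.2.2 = 0 := by
  rw [sub_eq_zero, ← sum_primeTriples_ramareCoeff hf hM hn hsq, sum_filter]
  refine sum_congr rfl fun v hv => ?_
  split_ifs with h3
  · rfl
  · have h4 := ((mem_primeTriples hn).mp hv).1
    have : ¬ v.2.1 ∣ M := fun h => h3 (hR _ h ⟨v.1 * v.2.2, by rw [← h4]; ring⟩)
    simp [ramareCoeff, this]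

lemma prime_dvd_primesProdIoc {P Q : ℝ} {p : ℕ} (hp : p.Prime) :
    p ∣ primesProdIoc P Q ↔ P < p ∧ (p : ℝ) ≤ Q := by
  rw [primesProdIoc, hp.prime.dvd_finsetProd_iff]
  constructor
  · rintro ⟨q, hq, hpq⟩
    obtain ⟨-, hq, h⟩ := mem_filter.mp hq
    rwa [(Nat.prime_dvd_prime_iff_eq hp hq).mp hpq]
  · intro h
    exact ⟨p, mem_filter.mpr ⟨mem_range.mpr (Nat.lt_succ_of_le (Nat.le_floor h.2)), hp, h⟩, dvd_rfl⟩

lemma squarefree_primesProdIoc (P Q : ℝ) : Squarefree (primesProdIoc P Q) := by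
  refine Finset.squarefree_prod_of_pairwise_isCoprime ?_ fun p hp =>
    (mem_filter.mp hp).2.1.prime.squarefree
  intro p hp q hq hpq
  exact Nat.coprime_iff_isRelPrime.mp
    ((Nat.coprime_primes (mem_filter.mp hp).2.1 (mem_filter.mp hq).2.1).mpr hpq)

lemma sum_triples_eq_sum_primeTriples {X H : ℝ} (hX : 0 ≤ X) (hH : 0 ≤ H) (P Q : ℝ) (R : ℕ)
    (g : ℕ × ℕ × ℕ → ℂ) :
    ∑ v ∈ ((Icc 1 ⌊Q⌋₊ ×ˢ (Icc 1 R ×ˢ Icc 1 ⌊X + H⌋₊)).filter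
        (fun v => v.1.Prime ∧ P < (v.1 : ℝ) ∧ (v.1 : ℝ) ≤ Q ∧
          X < ((v.1 * v.2.1 * v.2.2 : ℕ) : ℝ) ∧ ((v.1 * v.2.1 * v.2.2 : ℕ) : ℝ) ≤ X + H)), g v =
      ∑ n ∈ Ioc ⌊X⌋₊ ⌊X + H⌋₊, ∑ v ∈ primeTriples (primesProdIoc P Q) n with v.2.1 ≤ R, g v := by
  have hmem : ∀ n : ℕ, n ∈ Ioc ⌊X⌋₊ ⌊X + H⌋₊ ↔ X < n ∧ (n : ℝ) ≤ X + H := fun n => by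
    rw [mem_Ioc, Nat.floor_lt hX, Nat.le_floor_iff (by positivity)]
  rw [← sum_fiberwise_of_maps_to (g := fun v : ℕ × ℕ × ℕ => v.1 * v.2.1 * v.2.2)
    (t := Ioc ⌊X⌋₊ ⌊X + H⌋₊)]
  swap
  · intro v hv
    rw [hmem]
    exact (mem_filter.mp hv).2.2.2.2
  refine sum_congr rfl fun n hn => sum_congr ?_ fun _ _ => rfl
  have hn0 : n ≠ 0 := by have := mem_Ioc.mp hn; omega
  have hn' := (hmem n).mp hn
  ext ⟨p, r, m⟩
  simp only [mem_filter, mem_product, mem_Icc, mem_primeTriples hn0]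
  constructor
  · rintro ⟨⟨⟨-, ⟨-, hr⟩, -⟩, hp, hP, hQ, -⟩, h⟩
    exact ⟨⟨h, hp, (prime_dvd_primesProdIoc hp).mpr ⟨hP, hQ⟩⟩, hr⟩
  · rintro ⟨⟨h, hp, hpM⟩, hr⟩
    obtain ⟨hP, hQ⟩ := (prime_dvd_primesProdIoc hp).mp hpM
    have h0 := hn0
    rw [← h, mul_ne_zero_iff, mul_ne_zero_iff] at h0
    have hmn : m ≤ n := Nat.le_of_dvd (Nat.pos_of_ne_zero hn0) ⟨p * r, by rw [← h]; ring⟩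
    exact ⟨⟨⟨⟨hp.one_le, Nat.le_floor hQ⟩, ⟨Nat.pos_of_ne_zero h0.1.2, hr⟩,
      Nat.pos_of_ne_zero h0.2, hmn.trans (mem_Ioc.mp hn).2⟩, hp, hP, hQ, by rw [h]; exact hn'⟩, h⟩

lemma sum_inv_sq_Ioc_le {P : ℝ} (hP : 2 ≤ P) (N : ℕ) :
    ∑ p ∈ Ioc ⌊P⌋₊ N, ((p : ℝ) ^ 2)⁻¹ ≤ 2 / P := by
  have hP1 : P < ⌊P⌋₊ + 1 := Nat.lt_floor_add_one P
  have hf : (⌊P⌋₊ : ℝ)⁻¹ ≤ 2 / P := by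
    rw [inv_eq_one_div, div_le_div_iff₀ (by linarith) (by linarith)]
    linarith
  rcases le_total ⌊P⌋₊ N with h | h
  · refine (sum_Ioc_inv_sq_le_sub (by
      rw [Ne, Nat.floor_eq_zero]; linarith) h).trans ?_
    have : (0 : ℝ) ≤ (N : ℝ)⁻¹ := by positivity
    linarith
  · rw [Ioc_eq_empty_of_le h, sum_empty]
    positivity

lemma sum_tau_dvd_le {X H : ℝ} (hX : 0 ≤ X) (hH : 0 ≤ H) (K : ℕ) {d : ℕ} (hd : 0 < d) :
    ∑ n ∈ Ioc ⌊X⌋₊ ⌊X + H⌋₊ with d ∣ n, (tau K n : ℝ) ≤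
      tau K d * ∑ m ∈ Ioc ⌊X / d⌋₊ ⌊X / d + H / d⌋₊, (tau K m : ℝ) := by
  have hd' : (0 : ℝ) < d := by exact_mod_cast hd
  rw [mul_sum]
  have hsub : (Ioc ⌊X⌋₊ ⌊X + H⌋₊).filter (d ∣ ·) ⊆
      (Ioc ⌊X / d⌋₊ ⌊X / d + H / d⌋₊).image (d * ·) := by
    intro n hn
    obtain ⟨hn, m, rfl⟩ := mem_filter.mp hn
    refine mem_image.mpr ⟨m, ?_, rfl⟩
    rw [mem_Ioc, Nat.floor_lt (by positivity), Nat.le_floor_iff (by positivity)] at hn ⊢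
    push_cast at hn
    rw [← add_div, div_lt_iff₀ hd', le_div_iff₀ hd']
    exact ⟨by linarith, by linarith⟩
  calc _ ≤ ∑ n ∈ (Ioc ⌊X / d⌋₊ ⌊X / d + H / d⌋₊).image (d * ·), (tau K n : ℝ) :=
        sum_le_sum_of_subset_of_nonneg hsub fun _ _ _ => by positivity
    _ = ∑ m ∈ Ioc ⌊X / d⌋₊ ⌊X / d + H / d⌋₊, (tau K (d * m) : ℝ) :=
        sum_image fun a _ b _ h => Nat.eq_of_mul_eq_mul_left hd h
    _ ≤ _ := sum_le_sum fun m _ => by exact_mod_cast tau_mul_le K d m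

lemma sum_tau_prime_sq_dvd_le {K : ℕ} {X H P Q W : ℝ} (hX : 0 ≤ X) (hH : 0 ≤ H) (hP : 2 ≤ P)
    (hW : 0 ≤ W)
    (hmain : ∀ p : ℕ, P < p → (p : ℝ) ≤ Q →
      ∑ m ∈ Ioc ⌊X / (p ^ 2 : ℕ)⌋₊ ⌊X / (p ^ 2 : ℕ) + H / (p ^ 2 : ℕ)⌋₊, (tau K m : ℝ) ≤
        H / (p ^ 2 : ℕ) * W)
    {S : Finset ℕ} (hS : S ⊆ Ioc ⌊X⌋₊ ⌊X + H⌋₊)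
    (hbad : ∀ n ∈ S, ∃ p : ℕ, p.Prime ∧ P < (p : ℝ) ∧ (p : ℝ) ≤ Q ∧ p ^ 2 ∣ n) :
    ∑ n ∈ S, (tau K n : ℝ) ≤ 2 * (K : ℝ) ^ 2 * W * H / P := by
  set T := (Ioc ⌊P⌋₊ ⌊Q⌋₊).filter Nat.Prime with hT
  have hTmem : ∀ p ∈ T, p.Prime ∧ P < (p : ℝ) ∧ (p : ℝ) ≤ Q := by
    intro p hp
    obtain ⟨h1, h2⟩ := mem_filter.mp hp
    rw [mem_Ioc, Nat.floor_lt (by linarith), Nat.le_floor_iff' h2.ne_zero] at h1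
    exact ⟨h2, h1⟩
  calc ∑ n ∈ S, (tau K n : ℝ)
      ≤ ∑ n ∈ Ioc ⌊X⌋₊ ⌊X + H⌋₊, ∑ p ∈ T, if p ^ 2 ∣ n then (tau K n : ℝ) else 0 := by
        have hnonneg : ∀ n p : ℕ, 0 ≤ if p ^ 2 ∣ n then (tau K n : ℝ) else 0 := fun n p => by
          split_ifs <;> positivity
        refine (sum_le_sum fun n hn => ?_).trans (sum_le_sum_of_subset_of_nonneg hS
          fun n _ _ => sum_nonneg fun p _ => hnonneg n p)
        obtain ⟨p, hp, h1, h2, h3⟩ := hbad n hn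
        have hpT : p ∈ T := by
          refine mem_filter.mpr ⟨?_, hp⟩
          rw [mem_Ioc, Nat.floor_lt (by linarith)]
          exact ⟨h1, Nat.le_floor h2⟩
        simpa [h3] using single_le_sum (fun p _ => hnonneg n p) hpT
    _ = ∑ p ∈ T, ∑ n ∈ Ioc ⌊X⌋₊ ⌊X + H⌋₊ with p ^ 2 ∣ n, (tau K n : ℝ) := by
        rw [sum_comm]
        simp only [sum_filter]
    _ ≤ ∑ p ∈ T, (K : ℝ) ^ 2 * W * H * ((p : ℝ) ^ 2)⁻¹ := by
        refine sum_le_sum fun p hp => ?_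
        obtain ⟨hpp, h1, h2⟩ := hTmem p hp
        refine (sum_tau_dvd_le hX hH K (pow_pos hpp.pos 2)).trans ?_
        have h3 : (tau K (p ^ 2) : ℝ) ≤ (K : ℝ) ^ 2 := by
          have := tau_mul_le K p p
          rw [tau_prime K hpp, ← sq, ← sq] at this
          exact_mod_cast this
        calc _ ≤ (K : ℝ) ^ 2 * (H / (p ^ 2 : ℕ) * W) := by
              gcongr
              exact hmain p h1 h2
          _ = _ := by push_cast; ring
    _ ≤ ∑ p ∈ Ioc ⌊P⌋₊ ⌊Q⌋₊, (K : ℝ) ^ 2 * W * H * ((p : ℝ) ^ 2)⁻¹ :=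
        sum_le_sum_of_subset_of_nonneg (filter_subset _ _) fun _ _ _ => by positivity
    _ ≤ (K : ℝ) ^ 2 * W * H * (2 / P) := by
        rw [← mul_sum]
        gcongr
        exact sum_inv_sq_Ioc_le hP _
    _ = _ := by ring

/-- If `B ≥ exp (4 / ε)` and `n` has a squarefree divisor exceeding `X ^ (ε / 2)` whose primes are
at most `X ^ (1 / L ^ 2)`, then `d_K(n)` is much smaller than `d_{KB}(n)`. -/
lemma tau_le_exp_mul_tau {ε X L Q : ℝ} (hε : 0 < ε) (hX : 1 < X) (hL : L ≠ 0)
    (hQ : Q ≤ X ^ (1 / L ^ 2)) {K B : ℕ} (hB : Real.exp (4 / ε) ≤ B) {r n : ℕ}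
    (hr : Squarefree r) (hrQ : ∀ p, p.Prime → p ∣ r → (p : ℝ) ≤ Q) (hrn : r ∣ n) (hn : n ≠ 0)
    (hrX : X ^ (ε / 2) < r) :
    (tau K n : ℝ) ≤ Real.exp (-(2 * L ^ 2)) * tau (K * B) n := by
  set w := r.primeFactors.card with hw
  have hL2 : 0 < L ^ 2 := by positivity
  have hrle : (r : ℝ) ≤ X ^ ((w : ℝ) / L ^ 2) := by
    calc (r : ℝ) = ∏ p ∈ r.primeFactors, (p : ℝ) := by
          conv_lhs => rw [← Nat.prod_primeFactors_of_squarefree hr]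
          push_cast; rfl
      _ ≤ ∏ p ∈ r.primeFactors, X ^ (1 / L ^ 2) := by
          refine prod_le_prod (fun _ _ => by positivity) fun p hp => ?_
          exact (hrQ p (Nat.prime_of_mem_primeFactors hp) (Nat.dvd_of_mem_primeFactors hp)).trans hQ
      _ = X ^ ((w : ℝ) / L ^ 2) := by
          rw [prod_const, ← Real.rpow_natCast, ← Real.rpow_mul (by linarith)]
          congr 1
          rw [← hw]; ring
  have hwL : ε / 2 * L ^ 2 < w := by
    have := (Real.rpow_lt_rpow_left_iff hX).mp (hrX.trans_le hrle)
    rwa [lt_div_iff₀ hL2] at this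
  have hBpos : (0 : ℝ) < B := (Real.exp_pos _).trans_le hB
  have hB1 : 1 ≤ B := by exact_mod_cast hBpos
  have hexp : Real.exp (2 * L ^ 2) ≤ tau B n := by
    calc Real.exp (2 * L ^ 2) ≤ Real.exp (w * (4 / ε)) := by
          refine Real.exp_le_exp.mpr ?_
          rw [mul_div_assoc', le_div_iff₀ hε]
          linarith
      _ = Real.exp (4 / ε) ^ w := Real.exp_nat_mul _ _
      _ ≤ (B : ℝ) ^ w := by gcongr
      _ = tau B r := by rw [tau_of_squarefree B hr]; push_cast; rfl
      _ ≤ tau B n := by exact_mod_cast tau_le_of_dvd B hB1 hrn hn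
  have hmul : (tau K n : ℝ) * tau B n ≤ tau (K * B) n := by exact_mod_cast tau_mul_tau_le K B n
  calc (tau K n : ℝ) = Real.exp (-(2 * L ^ 2)) * (tau K n * Real.exp (2 * L ^ 2)) := by
        rw [mul_comm (tau K n : ℝ), ← mul_assoc, ← Real.exp_add]; simp
    _ ≤ Real.exp (-(2 * L ^ 2)) * (tau K n * tau B n) := by gcongr
    _ ≤ _ := by gcongr

lemma exists_sum_tau_exceptional_le {ε : ℝ} (hε : 0 < ε) {k : ℕ} (hk : 1 ≤ k) :
    ∃ C : ℝ, 0 < C ∧ ∀ X H P Q : ℝ, 3 ≤ X → X ^ ε ≤ H → H ≤ X → 2 ≤ P →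
      Q ≤ X ^ (1 / Real.log (Real.log X) ^ 2) → ∀ S ⊆ Ioc ⌊X⌋₊ ⌊X + H⌋₊,
      (∀ n ∈ S, (∃ p, p.Prime ∧ p ∣ primesProdIoc P Q ∧ p ^ 2 ∣ n) ∨
        ∃ r, r ∣ primesProdIoc P Q ∧ r ∣ n ∧ ⌊X ^ (ε / 2)⌋₊ < r) →
      ∑ n ∈ S, (tau (3 * k) n : ℝ) ≤ C * (H * Real.log X ^ (4 * k : ℝ) / P +
        H / Real.exp (Real.log (Real.log X) ^ 2)) := by
  classical
  set K := 3 * k with hK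
  set B := ⌈Real.exp (4 / ε)⌉₊ with hB
  have hBle : Real.exp (4 / ε) ≤ B := Nat.le_ceil _
  obtain ⟨C₁, hC₁, hmean₁⟩ := exists_sum_tau_Ioc_le K (half_pos hε)
  obtain ⟨C₂, hC₂, hmean₂⟩ := exists_sum_tau_Ioc_le (K * B) (half_pos hε)
  set E₁ := 2 * (K : ℝ) ^ 2 * C₁ with hE₁
  set E₂ := C₂ * Real.exp (((K * B : ℕ) + 1 : ℝ) ^ 2 / 4) with hE₂
  set E₃ := C₁ * Real.exp (((K : ℝ) + 1) * (1 + 4 / ε) + 4 / ε) with hE₃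
  have hE₁0 : 0 ≤ E₁ := by positivity
  have hE₂0 : 0 ≤ E₂ := by positivity
  have hE₃0 : 0 < E₃ := by positivity
  refine ⟨E₁ + E₂ + E₃, by positivity, ?_⟩
  intro X H P Q hX hXH hHX hP hQ S hS hbad
  have hX0 : 0 < X := by linarith
  have hX1 : 1 ≤ X := by linarith
  have hH0 : 0 < H := (Real.rpow_pos_of_pos hX0 _).trans_le hXH
  have hlog : 1 < Real.log X := by
    rw [Real.lt_log_iff_exp_lt hX0]
    exact Real.exp_one_lt_three.trans_le hX
  set L := Real.log (Real.log X) with hLdef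
  have hL : 0 < L := Real.log_pos hlog
  have hexpL : Real.log X = Real.exp L := (Real.exp_log (by linarith)).symm
  have hXH' : X ^ (ε / 2) ≤ H :=
    (Real.rpow_le_rpow_of_exponent_le hX1 (by linarith)).trans hXH
  set U := H * Real.log X ^ (4 * k : ℝ) / P with hU
  set V := H / Real.exp (L ^ 2) with hV
  have hU0 : 0 ≤ U := by positivity
  have hV0 : 0 ≤ V := by positivity
  have hSpos : ∀ n ∈ S, n ≠ 0 := fun n hn => by
    have := mem_Ioc.mp (hS hn)
    omega
  rcases lt_or_ge (L ^ 2) (4 / ε) with hcase | hcase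
  · calc ∑ n ∈ S, (tau K n : ℝ) ≤ ∑ n ∈ Ioc ⌊X⌋₊ ⌊X + H⌋₊, (tau K n : ℝ) :=
          sum_le_sum_of_subset_of_nonneg hS fun _ _ _ => by positivity
      _ ≤ C₁ * H * Real.log X ^ (K + 1) := hmean₁ X X H hX hX0.le hXH' (by linarith)
      _ = C₁ * Real.exp ((K + 1) * L + L ^ 2) * V := by
          rw [hV, hexpL, ← Real.exp_nat_mul, Real.exp_add]
          push_cast
          field_simp
      _ ≤ E₃ * V := by
          have : L ≤ 1 + 4 / ε := by nlinarith [sq_nonneg (L - 1)]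
          rw [hE₃]
          gcongr
      _ ≤ (E₁ + E₂ + E₃) * (U + V) := by
          gcongr
          · linarith
          · linarith
  · set S₁ := S.filter fun n => ∃ p, p.Prime ∧ p ∣ primesProdIoc P Q ∧ p ^ 2 ∣ n with hS₁
    set S₂ := S.filter fun n => ¬ ∃ p, p.Prime ∧ p ∣ primesProdIoc P Q ∧ p ^ 2 ∣ n with hS₂
    have hS₁sub : S₁ ⊆ S := filter_subset _ _
    have hbound₁ : ∑ n ∈ S₁, (tau K n : ℝ) ≤ E₁ * U := by
      have h := sum_tau_prime_sq_dvd_le (K := K) (Q := Q) (W := C₁ * Real.log X ^ (K + 1))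
        hX0.le hH0.le hP (by positivity) ?_ (S := S₁) (hS₁sub.trans hS) (fun n hn => by
          obtain ⟨p, hp, hpM, hpn⟩ := (mem_filter.mp hn).2
          obtain ⟨h1, h2⟩ := (prime_dvd_primesProdIoc hp).mp hpM
          exact ⟨p, hp, h1, h2, hpn⟩)
      · refine h.trans ?_
        have hpow : Real.log X ^ (K + 1) ≤ Real.log X ^ (4 * k : ℝ) := by
          rw [show (4 * k : ℝ) = ((4 * k : ℕ) : ℝ) by push_cast; rfl, Real.rpow_natCast]
          exact pow_le_pow_right₀ hlog.le (by omega)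
        calc _ = E₁ * (H * Real.log X ^ (K + 1) / P) := by rw [hE₁]; ring
          _ ≤ _ := by rw [hU]; gcongr
      · intro p hPp hpQ
        have hp1 : (1 : ℝ) ≤ (p ^ 2 : ℕ) := by
          have : (1 : ℝ) ≤ p := by linarith
          push_cast
          exact one_le_pow₀ this
        have hpX : ((p ^ 2 : ℕ) : ℝ) ≤ X ^ (ε / 2) := by
          push_cast
          calc (p : ℝ) ^ 2 ≤ (X ^ (1 / L ^ 2)) ^ 2 := by gcongr; exact hpQ.trans hQ
            _ = X ^ (2 / L ^ 2) := by
              rw [← Real.rpow_natCast, ← Real.rpow_mul hX0.le]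
              congr 1
              push_cast; ring
            _ ≤ X ^ (ε / 2) := by
              refine Real.rpow_le_rpow_of_exponent_le hX1 ?_
              rw [div_le_iff₀ hε] at hcase
              rw [div_le_div_iff₀ (by positivity) (by norm_num)]
              linarith
        refine (hmean₁ X (X / (p ^ 2 : ℕ)) (H / (p ^ 2 : ℕ)) hX (by positivity) ?_ ?_).trans_eq
          (by ring)
        · rw [le_div_iff₀ (by linarith)]
          calc X ^ (ε / 2) * (p ^ 2 : ℕ) ≤ X ^ (ε / 2) * X ^ (ε / 2) := by gcongr
            _ = X ^ ε := by rw [← Real.rpow_add hX0, add_halves]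
            _ ≤ H := hXH
        · linarith [div_le_self hX0.le hp1, div_le_self hH0.le hp1]
    have hbound₂ : ∑ n ∈ S₂, (tau K n : ℝ) ≤ E₂ * V := by
      calc ∑ n ∈ S₂, (tau K n : ℝ)
          ≤ ∑ n ∈ S₂, Real.exp (-(2 * L ^ 2)) * tau (K * B) n := by
            refine sum_le_sum fun n hn => ?_
            obtain ⟨hnS, hn2⟩ := mem_filter.mp hn
            obtain ⟨r, hrM, hrn, hr⟩ := (hbad n hnS).resolve_left hn2
            refine tau_le_exp_mul_tau hε (by linarith) hL.ne' hQ hBle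
              ((squarefree_primesProdIoc P Q).squarefree_of_dvd hrM) (fun p hp hpr => ?_) hrn
              (hSpos n hnS) ((Nat.floor_lt (by positivity)).mp hr)
            exact ((prime_dvd_primesProdIoc hp).mp (hpr.trans hrM)).2
        _ ≤ ∑ n ∈ Ioc ⌊X⌋₊ ⌊X + H⌋₊, Real.exp (-(2 * L ^ 2)) * tau (K * B) n :=
            sum_le_sum_of_subset_of_nonneg ((filter_subset _ S).trans hS)
              fun _ _ _ => by positivity
        _ ≤ Real.exp (-(2 * L ^ 2)) * (C₂ * H * Real.log X ^ (K * B + 1)) := by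
            rw [← mul_sum]
            gcongr
            exact hmean₂ X X H hX hX0.le hXH' (by linarith)
        _ = C₂ * Real.exp (((K * B : ℕ) + 1) * L - L ^ 2) * V := by
            rw [hV, hexpL, ← Real.exp_nat_mul, div_eq_mul_inv, ← Real.exp_neg]
            have : Real.exp (((K * B : ℕ) + 1) * L - L ^ 2) * Real.exp (-L ^ 2) =
                Real.exp (-(2 * L ^ 2)) * Real.exp ((K * B + 1 : ℕ) * L) := by
              rw [← Real.exp_add, ← Real.exp_add]
              congr 1
              push_cast; ring
            linear_combination (-C₂ * H) * this
        _ ≤ E₂ * V := by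
            rw [hE₂]
            gcongr
            nlinarith [sq_nonneg (((K * B : ℕ) + 1 : ℝ) / 2 - L)]
    rw [← sum_filter_add_sum_filter_not S
      (fun n => ∃ p, p.Prime ∧ p ∣ primesProdIoc P Q ∧ p ^ 2 ∣ n)]
    have := mul_nonneg hE₁0 hV0
    have := mul_nonneg hE₂0 hU0
    have := mul_nonneg hE₃0.le (add_nonneg hU0 hV0)
    linarith

/-- Lemma 2.14 (Ramaré-type identity): for a multiplicative `f` with `|f| ≤ d_k`, the
sum of `f(n) ω_n` over `X < n ≤ X+H` with `gcd(n, 𝒫(P,Q)) > 1` equals a trilinear sum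
`∑_{X < prn ≤ X+H, P < p ≤ Q prime, r ≤ X^{ε/2}} a_r f(p) f(n) ω_{prn}` with
`|a_r| ≤ d_{k+1}(r)`, up to `O(H (log X)^{4k}/P + H/exp((log log X)²))`. -/
theorem ramare_identity_decomposition (ε : ℝ) (hε : 0 < ε) (k : ℕ) (hk : 1 ≤ k) :
    ∃ C : ℝ, 0 < C ∧
      ∀ X H P Q : ℝ, 3 ≤ X → X ^ ε ≤ H → H ≤ X →
        2 ≤ P → P < Q → Q ≤ X ^ (1 / Real.log (Real.log X) ^ 2) →
        ∀ f : ℕ → ℂ, (∀ m n : ℕ, m.Coprime n → f (m * n) = f m * f n) →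
          (∀ n, ‖f n‖ ≤ (dk k n : ℝ)) →
          ∃ a : ℕ → ℂ, (∀ r, ‖a r‖ ≤ (dk (k + 1) r : ℝ)) ∧
            ∀ ω : ℕ → ℂ, (∀ n, ‖ω n‖ ≤ 1) →
              ‖(∑ n ∈ (Finset.Ioc ⌊X⌋₊ ⌊X + H⌋₊).filter
                    (fun n => 1 < Nat.gcd n (primesProdIoc P Q)), f n * ω n)
                - ∑ v ∈ ((Finset.Icc 1 ⌊Q⌋₊ ×ˢ
                      (Finset.Icc 1 ⌊X ^ (ε / 2)⌋₊ ×ˢ Finset.Icc 1 ⌊X + H⌋₊)).filter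
                    (fun v => v.1.Prime ∧ P < (v.1 : ℝ) ∧ (v.1 : ℝ) ≤ Q ∧
                      X < ((v.1 * v.2.1 * v.2.2 : ℕ) : ℝ) ∧
                      ((v.1 * v.2.1 * v.2.2 : ℕ) : ℝ) ≤ X + H)),
                    a v.2.1 * f v.1 * f v.2.2 * ω (v.1 * v.2.1 * v.2.2)‖
              ≤ C * (H * Real.log X ^ (4 * k : ℝ) / P +
                  H / Real.exp (Real.log (Real.log X) ^ 2)) := by
  obtain ⟨C, hC, hmain⟩ := exists_sum_tau_exceptional_le hε hk
  refine ⟨2 * C, by positivity, ?_⟩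
  intro X H P Q hX hXH hHX hP _ hQ f hf hfd
  have hfk : ∀ n, n ≠ 0 → ‖f n‖ ≤ tau k n := fun n hn => by
    rw [← dk_eq_tau k hn]
    exact hfd n
  have hX0 : 0 < X := by linarith
  have hH0 : 0 < H := (Real.rpow_pos_of_pos hX0 _).trans_le hXH
  set M := primesProdIoc P Q with hMdef
  set R := ⌊X ^ (ε / 2)⌋₊ with hR
  have hM : Squarefree M := squarefree_primesProdIoc P Q
  refine ⟨ramareCoeff f M, fun r => ?_, fun ω hω => ?_⟩
  · rcases eq_or_ne r 0 with rfl | hr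
    · have : ¬ 0 ∣ M := fun h => hM.ne_zero (zero_dvd_iff.mp h)
      simp [ramareCoeff, this]
    · refine (norm_ramareCoeff_le f M r).trans ((hfk r hr).trans ?_)
      rw [dk_eq_tau (k + 1) hr]
      exact_mod_cast tau_le_add k 1 hr
  classical
  rw [sum_triples_eq_sum_primeTriples hX0.le hH0.le, ← hMdef, sum_filter, ← sum_sub_distrib]
  set δ : ℕ → ℂ := fun n => (if 1 < n.gcd M then f n else 0) -
    ∑ v ∈ primeTriples M n with v.2.1 ≤ R, ramareCoeff f M v.2.1 * f v.1 * f v.2.2 with hδ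
  set bad : ℕ → Prop := fun n => (∃ p, p.Prime ∧ p ∣ M ∧ p ^ 2 ∣ n) ∨
    ∃ r, r ∣ M ∧ r ∣ n ∧ R < r with hbad
  have hpos : ∀ n ∈ Ioc ⌊X⌋₊ ⌊X + H⌋₊, n ≠ 0 := fun n hn => by
    have := mem_Ioc.mp hn
    omega
  calc _ = ‖∑ n ∈ Ioc ⌊X⌋₊ ⌊X + H⌋₊, δ n * ω n‖ := by
        congr 1
        refine sum_congr rfl fun n hn => ?_
        rw [hδ, sub_mul, ite_mul, zero_mul, sum_mul]
        congr 1
        refine sum_congr rfl fun v hv => ?_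
        rw [((mem_primeTriples (hpos n hn)).mp (mem_filter.mp hv).1).1]
    _ ≤ ∑ n ∈ Ioc ⌊X⌋₊ ⌊X + H⌋₊, if bad n then 2 * (tau (3 * k) n : ℝ) else 0 := by
        refine (norm_sum_le _ _).trans (sum_le_sum fun n hn => ?_)
        rw [norm_mul]
        refine (mul_le_of_le_one_right (norm_nonneg _) (hω n)).trans ?_
        split_ifs with h
        · exact norm_sub_sum_primeTriples_le hfk M R (hpos n hn)
        · simp only [hbad] at h
          push Not at h
          exact (norm_eq_zero.mpr
            (sub_sum_primeTriples_eq_zero hf hM (hpos n hn) h.1 h.2)).le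
    _ = 2 * ∑ n ∈ Ioc ⌊X⌋₊ ⌊X + H⌋₊ with bad n, (tau (3 * k) n : ℝ) := by
        rw [mul_sum, sum_filter]
    _ ≤ 2 * (C * (H * Real.log X ^ (4 * k : ℝ) / P +
          H / Real.exp (Real.log (Real.log X) ^ 2))) := by
        gcongr
        exact hmain X H P Q hX hXH hHX hP hQ _ (filter_subset _ _)
          fun n hn => (mem_filter.mp hn).2
    _ = _ := by ring
end

section
/- Let d ≥ 0. There exists a constant C_d such that the following holds. Let 0 < δ < 1/2 and let P : ℤ → ℝ/ℤ be a polynomial of degree at most d. Let A ≥ 1 and let I be an interval with |I| ≥ 2A. Suppose that ‖P(a·)‖_{C^∞((1/a)I)} ≤ 1/δ for at least δA integers a ∈ [A, 2A], where P(a·) is the polynomial n ↦ P(an) and (1/a)I := {t/a : t ∈ I}. Then either |I| ≤ C_d δ^{−C_d} A, or there exists an integer q with 1 ≤ q ≤ C_d δ^{−C_d} such that ‖qP‖_{C^∞(I)} ≤ C_d δ^{−C_d}. -/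
open Finset

/-- The distance from a real number to the nearest integer, `‖x‖_{ℝ/ℤ}`. -/
noncomputable def rzNorm (x : ℝ) : ℝ := |x - round x|

/-- The polynomial `n ↦ ∑_{j=0}^{d} α_j n^j` evaluated on the integers. -/
noncomputable def polyEval (d : ℕ) (α : ℕ → ℝ) (n : ℤ) : ℝ :=
  ∑ j ∈ Finset.range (d + 1), α j * (n : ℝ) ^ j

/-- The difference operator `∂₁ P(n) = P(n) - P(n-1)`. -/
def diffOp (P : ℤ → ℝ) : ℤ → ℝ := fun n => P n - P (n - 1)

/-- The smoothness norm `‖P‖_{C^∞(I)} = sup_{0 ≤ j ≤ d} sup_{n ∈ I ∩ ℤ} |I|^j ‖∂₁^j P(n)‖_{ℝ/ℤ}`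
of a (mod 1 reduced) polynomial on the interval `I = [a, b]`. -/
noncomputable def smoothNorm (d : ℕ) (P : ℤ → ℝ) (a b : ℝ) : ℝ :=
  sSup {r : ℝ | ∃ j : ℕ, j ≤ d ∧ ∃ n : ℤ, a ≤ (n : ℝ) ∧ (n : ℝ) ≤ b ∧
    r = (b - a) ^ j * rzNorm (diffOp^[j] P n)}

open Polynomial

lemma rzNorm_nonneg (x : ℝ) : 0 ≤ rzNorm x := abs_nonneg _

lemma rzNorm_le_half (x : ℝ) : rzNorm x ≤ 1 / 2 := abs_sub_round x

lemma rzNorm_le_abs_sub_intCast (x : ℝ) (k : ℤ) : rzNorm x ≤ |x - k| := round_le x k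

lemma rzNorm_le_abs (x : ℝ) : rzNorm x ≤ |x| := by
  simpa using rzNorm_le_abs_sub_intCast x 0

lemma rzNorm_add_intCast (x : ℝ) (k : ℤ) : rzNorm (x + k) = rzNorm x := by
  simp [rzNorm, round_add_intCast]

lemma rzNorm_add_le (x y : ℝ) : rzNorm (x + y) ≤ rzNorm x + rzNorm y := by
  refine (rzNorm_le_abs_sub_intCast _ (round x + round y)).trans ?_
  refine le_trans (le_of_eq ?_) (abs_add_le (x - round x) (y - round y))
  push_cast
  ring_nf

lemma rzNorm_neg_le (x : ℝ) : rzNorm (-x) ≤ rzNorm x := by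
  refine (rzNorm_le_abs_sub_intCast _ (-round x)).trans (le_of_eq ?_)
  rw [rzNorm, ← abs_neg]
  push_cast
  ring_nf

lemma rzNorm_sub_le (x y : ℝ) : rzNorm (x - y) ≤ rzNorm x + rzNorm y := by
  rw [sub_eq_add_neg]
  exact (rzNorm_add_le _ _).trans (by gcongr; exact rzNorm_neg_le y)

lemma rzNorm_natCast_mul_le (q : ℕ) (x : ℝ) : rzNorm (q * x) ≤ q * rzNorm x := by
  refine (rzNorm_le_abs_sub_intCast _ (q * round x)).trans (le_of_eq ?_)
  push_cast
  rw [← mul_sub, abs_mul, Nat.abs_cast, rzNorm]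

/-- The forward difference `p(X + h) - p(X)`. -/
noncomputable def polyDiff (h : ℝ) (p : ℝ[X]) : ℝ[X] := taylor h p - p

lemma eval_polyDiff (h x : ℝ) (p : ℝ[X]) :
    (polyDiff h p).eval x = p.eval (x + h) - p.eval x := by
  simp [polyDiff, taylor_eval]

lemma natDegree_polyDiff_le {d : ℕ} {p : ℝ[X]} (hp : p.natDegree ≤ d + 1) (h : ℝ) :
    (polyDiff h p).natDegree ≤ d := by
  rw [natDegree_le_iff_coeff_eq_zero]
  intro n hn
  rw [polyDiff, coeff_sub, taylor_coeff, eval_eq_sum_range' (n := 1)]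
  · simp [hasseDeriv_coeff]
  · have := natDegree_hasseDeriv_le p n
    omega

lemma coeff_polyDiff {d : ℕ} {p : ℝ[X]} (hp : p.natDegree ≤ d + 1) (h : ℝ) :
    (polyDiff h p).coeff d = (d + 1) * h * p.coeff (d + 1) := by
  rw [polyDiff, coeff_sub, taylor_coeff, eval_eq_sum_range' (n := 2)]
  · simp [hasseDeriv_coeff, Finset.sum_range_succ, add_comm 1 d]
    ring
  · have := natDegree_hasseDeriv_le p d
    omega

lemma polyDiff_eq_zero {p : ℝ[X]} (hp : p.natDegree ≤ 0) (h : ℝ) : polyDiff h p = 0 := by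
  rw [eq_C_of_natDegree_le_zero hp]
  simp [polyDiff]

lemma diffOp_eval (m c : ℝ) (p : ℝ[X]) :
    diffOp (fun n : ℤ => p.eval (m * n - c)) =
      fun n : ℤ => (-polyDiff (-m) p).eval (m * n - c) := by
  funext n
  simp only [diffOp, eval_neg, eval_polyDiff]
  push_cast
  ring_nf

lemma diffOp_iterate_add (j : ℕ) (f g : ℤ → ℝ) (n : ℤ) :
    diffOp^[j] (fun n => f n + g n) n = diffOp^[j] f n + diffOp^[j] g n := by
  induction j generalizing f g with
  | zero => rfl
  | succ j ih =>
    simp only [Function.iterate_succ_apply]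
    rw [← ih]
    refine congrFun (congrArg diffOp^[j] (funext fun n => ?_)) n
    simp only [diffOp]
    ring

lemma diffOp_iterate_const_mul (j : ℕ) (c : ℝ) (f : ℤ → ℝ) (n : ℤ) :
    diffOp^[j] (fun n => c * f n) n = c * diffOp^[j] f n := by
  induction j generalizing f with
  | zero => rfl
  | succ j ih =>
    simp only [Function.iterate_succ_apply]
    rw [← ih]
    refine congrFun (congrArg diffOp^[j] (funext fun n => ?_)) n
    simp only [diffOp]
    ring

lemma exists_diffOp_iterate_intCast (j : ℕ) (f : ℤ → ℤ) (n : ℤ) :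
    ∃ k : ℤ, diffOp^[j] (fun n => (f n : ℝ)) n = k := by
  induction j generalizing f with
  | zero => exact ⟨f n, rfl⟩
  | succ j ih =>
    obtain ⟨k, hk⟩ := ih (fun n => f n - f (n - 1))
    refine ⟨k, ?_⟩
    rw [← hk, Function.iterate_succ_apply]
    refine congrFun (congrArg diffOp^[j] (funext fun n => ?_)) n
    simp [diffOp]

lemma diffOp_iterate_zero (j : ℕ) : diffOp^[j] (fun _ => 0) = fun _ => 0 := by
  induction j with
  | zero => rfl
  | succ j ih =>
    rw [Function.iterate_succ_apply', ih]
    funext n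
    simp [diffOp]

lemma diffOp_iterate_eval_eq (m : ℝ) (e : ℕ) (p : ℝ[X]) (hp : p.natDegree ≤ e) (n : ℤ) :
    diffOp^[e] (fun n : ℤ => p.eval (m * n)) n = e.factorial * m ^ e * p.coeff e := by
  induction e generalizing p with
  | zero =>
    rw [eq_C_of_natDegree_le_zero hp]
    simp
  | succ e ih =>
    have h := diffOp_eval m 0 p
    simp only [sub_zero] at h
    rw [Function.iterate_succ_apply, h, ih _ (by simpa using natDegree_polyDiff_le hp (-m)),
      coeff_neg, coeff_polyDiff hp, Nat.factorial_succ]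
    push_cast
    ring

/-- Finite differences of a polynomial of degree at most `D` on an interval of length `L`. -/
lemma exists_abs_diffOp_iterate_eval_le (j D : ℕ) (p : ℝ[X]) (hp : p.natDegree ≤ D) :
    ∃ B : ℕ, ∀ (c L : ℝ) (n : ℤ), 1 ≤ L → |n - c| ≤ L →
      L ^ j * |diffOp^[j] (fun n : ℤ => p.eval (n - c)) n| ≤ B * L ^ D := by
  induction j generalizing D p with
  | zero =>
    obtain ⟨B, hB⟩ := exists_nat_ge (∑ i ∈ Finset.range (D + 1), |p.coeff i|)
    refine ⟨B, fun c L n hL hn => ?_⟩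
    simp only [pow_zero, one_mul, Function.iterate_zero, id]
    rw [eval_eq_sum_range' (Nat.lt_succ_of_le hp)]
    refine (Finset.abs_sum_le_sum_abs _ _).trans ?_
    refine le_trans ?_ (mul_le_mul_of_nonneg_right hB (by positivity))
    rw [Finset.sum_mul]
    refine Finset.sum_le_sum fun i hi => ?_
    rw [abs_mul, abs_pow]
    refine mul_le_mul_of_nonneg_left ?_ (abs_nonneg _)
    exact (pow_le_pow_left₀ (abs_nonneg _) hn i).trans
      (pow_le_pow_right₀ hL (by simpa [Nat.lt_succ_iff] using hi))
  | succ j ih =>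
    have h (c : ℝ) : diffOp (fun n : ℤ => p.eval (n - c)) =
        fun n : ℤ => (-polyDiff (-1) p).eval (n - c) := by
      simpa using diffOp_eval 1 c p
    rcases D with _ | D
    · refine ⟨0, fun c L n hL hn => ?_⟩
      rw [Function.iterate_succ_apply, h, polyDiff_eq_zero hp]
      simp [diffOp_iterate_zero]
    · obtain ⟨B, hB⟩ := ih D (-polyDiff (-1) p) (by simpa using natDegree_polyDiff_le hp (-1))
      refine ⟨B, fun c L n hL hn => ?_⟩
      rw [Function.iterate_succ_apply, h]
      have := mul_le_mul_of_nonneg_left (hB c L n hL hn) (zero_le_one.trans hL)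
      calc _ = _ := by ring
        _ ≤ _ := this
        _ = _ := by ring

lemma exists_forall_abs_diffOp_iterate_pow_le (d D : ℕ) :
    ∃ B : ℕ, ∀ j ≤ d, ∀ (c L : ℝ) (n : ℤ), 1 ≤ L → |n - c| ≤ L →
      L ^ j * |diffOp^[j] (fun n : ℤ => (n - c) ^ D) n| ≤ B * L ^ D := by
  choose B hB using fun j => exists_abs_diffOp_iterate_eval_le j D (X ^ D) (by simp)
  refine ⟨∑ j ∈ Finset.range (d + 1), B j, fun j hj c L n hL hn => ?_⟩
  have h := hB j c L n hL hn
  simp only [eval_pow, eval_X] at h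
  refine h.trans (mul_le_mul_of_nonneg_right ?_ (by positivity))
  exact_mod_cast Finset.single_le_sum (f := B) (fun _ _ => Nat.zero_le _)
    (Finset.mem_range.2 (Nat.lt_succ_of_le hj))

lemma card_le_of_abs_sub_le {T : Finset ℤ} {R : ℝ} (hR : 0 ≤ R)
    (h : ∀ x ∈ T, ∀ y ∈ T, |(x : ℝ) - y| ≤ R) : (#T : ℝ) ≤ R + 1 := by
  rcases T.eq_empty_or_nonempty with rfl | hT
  · simp
    linarith
  have hsub : T ⊆ Finset.Icc (T.min' hT) (T.min' hT + ⌊R⌋) := by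
    intro x hx
    refine Finset.mem_Icc.2 ⟨T.min'_le x hx, ?_⟩
    have h1 := (le_abs_self _).trans (h x hx _ (T.min'_mem hT))
    have h2 : x - T.min' hT ≤ ⌊R⌋ := Int.le_floor.2 (by push_cast; exact h1)
    linarith
  have hc : (#T : ℤ) ≤ ⌊R⌋ + 1 := by
    have h1 := Finset.card_le_card hsub
    rw [Int.card_Icc] at h1
    have h2 := Int.floor_nonneg.2 hR
    omega
  calc (#T : ℝ) = ((#T : ℤ) : ℝ) := by simp
    _ ≤ ((⌊R⌋ + 1 : ℤ) : ℝ) := by exact_mod_cast hc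
    _ ≤ R + 1 := by push_cast; linarith [Int.floor_le R]

lemma card_le_of_fiber_le {α β : Type*} [DecidableEq β] (s : Finset α) (f : α → β) {u v : ℝ}
    (hu : 0 ≤ u) (hf : ∀ y, (#{x ∈ s | f x = y} : ℝ) ≤ u) (hv : (#(s.image f) : ℝ) ≤ v) :
    (#s : ℝ) ≤ u * v := by
  have h := Finset.card_le_mul_card_image (f := f) s ⌊u⌋₊ fun y _ => Nat.le_floor (hf y)
  calc (#s : ℝ) ≤ ⌊u⌋₊ * #(s.image f) := by exact_mod_cast h
    _ ≤ u * v := mul_le_mul (Nat.floor_le hu) hv (Nat.cast_nonneg _) hu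

/-- Counting the visits of a slow rotation to a neighbourhood of `0`. -/
lemma card_le_of_rzNorm_rotation_le {T : Finset ℤ} {θ c ε M : ℝ} (hθ : θ ≠ 0) (hε : 0 ≤ ε)
    (hM : 0 ≤ M) (hT : ∀ x ∈ T, ∀ y ∈ T, |(x : ℝ) - y| ≤ M)
    (h : ∀ t ∈ T, rzNorm (c + t * θ) ≤ ε) :
    (#T : ℝ) ≤ (2 * ε / |θ| + 1) * (|θ| * M + 2 * ε + 1) := by
  have hθ' : 0 < |θ| := abs_pos.2 hθ
  refine card_le_of_fiber_le T (fun t : ℤ => round (c + t * θ)) (by positivity) ?_ ?_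
  · intro k
    refine card_le_of_abs_sub_le (by positivity) ?_
    simp only [Finset.mem_filter]
    rintro x ⟨hx, hxk⟩ y ⟨hy, hyk⟩
    have h1 := h x hx
    have h2 := h y hy
    rw [rzNorm, hxk] at h1
    rw [rzNorm, hyk] at h2
    rw [le_div_iff₀ hθ', ← abs_mul]
    rw [abs_le] at *
    constructor <;> linarith
  · refine card_le_of_abs_sub_le (by positivity) ?_
    simp only [Finset.mem_image]
    rintro _ ⟨x, hx, rfl⟩ _ ⟨y, hy, rfl⟩
    have h1 := h x hx
    have h2 := h y hy
    have h3 := mul_le_mul_of_nonneg_left (hT x hx y hy) hθ'.le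
    rw [← abs_mul] at h3
    rw [rzNorm] at h1 h2
    rw [abs_le] at *
    constructor <;> linarith

lemma exists_pos_rzNorm_mul_le {K ε α : ℝ} {x : ℤ} {N : ℕ} {H : Finset ℤ} (hK : 2 ≤ K)
    (hH : H ⊆ Finset.Ico x (x + N)) (hN : 24 * K ^ 2 ≤ N) (hcard : N ≤ K * #H)
    (h : ∀ n ∈ H, rzNorm (α * n) ≤ ε) :
    ∃ q : ℕ, 1 ≤ q ∧ (q : ℝ) ≤ 3 * K ∧ rzNorm (q * α) ≤ 2 * ε := by
  have hg0 : 0 < ⌈2 * K⌉₊ := Nat.ceil_pos.2 (by linarith)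
  have hg1 : 2 * K ≤ ⌈2 * K⌉₊ := Nat.le_ceil _
  have hg2 : (⌈2 * K⌉₊ : ℝ) < 2 * K + 1 := Nat.ceil_lt_add_one (by linarith)
  set g := ⌈2 * K⌉₊
  obtain ⟨y, hy, z, hz, hne, hyz⟩ : ∃ y ∈ H, ∃ z ∈ H, y ≠ z ∧ (y - x) / g = (z - x) / g := by
    refine Finset.exists_ne_map_eq_of_card_lt_of_maps_to
      (t := Finset.Icc (0 : ℤ) (N / g : ℕ)) ?_ ?_
    · have h1 : ((N / g : ℕ) : ℝ) * (2 * K) ≤ N := by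
        have : ((N / g : ℕ) : ℝ) * g ≤ N := by exact_mod_cast Nat.div_mul_le_self N g
        nlinarith [Nat.cast_nonneg (α := ℝ) (N / g)]
      have h2 : ((N / g : ℕ) : ℝ) + 1 < #H := by nlinarith
      simp only [Int.card_Icc]
      have h3 : N / g + 1 < #H := by exact_mod_cast h2
      generalize N / g = w at h3 ⊢
      omega
    · intro n hn
      have := Finset.mem_Ico.1 (hH hn)
      simp only [Finset.coe_Icc, Set.mem_Icc]
      refine ⟨Int.ediv_nonneg (by linarith) (by positivity), ?_⟩
      push_cast
      exact Int.ediv_le_ediv (by exact_mod_cast hg0) (by linarith)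
  have key : ∀ y ∈ H, ∀ z ∈ H, y < z → (y - x) / g = (z - x) / g →
      ∃ q : ℕ, 1 ≤ q ∧ (q : ℝ) ≤ 3 * K ∧ rzNorm (q * α) ≤ 2 * ε := by
    intro y hy z hz hlt hyz
    have hq : (((z - y).toNat : ℕ) : ℤ) = z - y := Int.toNat_of_nonneg (by linarith)
    have hq' : (((z - y).toNat : ℕ) : ℝ) = z - y := by exact_mod_cast congrArg (Int.cast (R := ℝ)) hq
    refine ⟨(z - y).toNat, by omega, ?_, ?_⟩
    · have h1 := Int.emod_add_mul_ediv (y - x) g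
      have h2 := Int.emod_add_mul_ediv (z - x) g
      have h3 := Int.emod_nonneg (y - x) (b := g) (by positivity)
      have h4 := Int.emod_lt_of_pos (z - x) (b := g) (by positivity)
      rw [hyz] at h1
      have h5 : (z - y : ℤ) ≤ g := by linarith
      have h6 : (z - y : ℝ) ≤ g := by exact_mod_cast h5
      rw [hq']
      linarith
    · rw [hq', show ((z : ℝ) - y) * α = α * z - α * y by ring]
      linarith [rzNorm_sub_le (α * z) (α * y), h y hy, h z hz]
  rcases hne.lt_or_gt with hlt | hlt
  · exact key y hy z hz hlt hyz
  · exact key z hz y hy hlt hyz.symm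

/-- The linear case of Vinogradov's lemma. -/
lemma exists_rzNorm_mul_le_of_linear {K ε α : ℝ} {x : ℤ} {N : ℕ} {H : Finset ℤ} (hK : 2 ≤ K)
    (hH : H ⊆ Finset.Ico x (x + N)) (hN : 24 * K ^ 2 ≤ N) (hcard : N ≤ K * #H)
    (hε : 0 ≤ ε) (hεK : 8 * K * ε ≤ 1) (h : ∀ n ∈ H, rzNorm (α * n) ≤ ε) :
    ∃ q : ℕ, 1 ≤ q ∧ (q : ℝ) ≤ 3 * K ∧ rzNorm (q * α) * N ≤ 48 * K ^ 2 * ε := by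
  obtain ⟨q, hq1, hqK, hqα⟩ := exists_pos_rzNorm_mul_le hK hH hN hcard h
  refine ⟨q, hq1, hqK, ?_⟩
  have hq0 : (0 : ℝ) < q := by exact_mod_cast hq1
  have hq0' : (0 : ℤ) < q := by exact_mod_cast hq1
  set θ : ℝ := q * α - round (q * α) with hθdef
  have hθr : rzNorm (q * α) = |θ| := rfl
  rw [hθr] at hqα ⊢
  by_cases hθ : θ = 0
  · rw [hθ]
    simp
    positivity
  have hθ' : 0 < |θ| := abs_pos.2 hθ
  have hcount : (#H : ℝ) ≤ ((2 * ε / |θ| + 1) * (|θ| * (N / q) + 2 * ε + 1)) * q := by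
    refine card_le_of_fiber_le H (fun n : ℤ => n % q) (by positivity) ?_ ?_
    · intro r
      set F : Finset ℤ := {n ∈ H | n % q = r}
      have hF : ∀ n ∈ F, n ∈ H ∧ n = r + q * (n / q) := by
        intro n hn
        obtain ⟨h1, h2⟩ := Finset.mem_filter.1 hn
        exact ⟨h1, by rw [← h2, Int.emod_add_mul_ediv]⟩
      have hinj : Set.InjOn (fun n : ℤ => n / q) (F : Set ℤ) := by
        intro y hy z hz hyz
        have h1 := (hF y hy).2
        have h2 := (hF z hz).2
        simp only at hyz
        rw [h1, h2, hyz]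
      rw [← Finset.card_image_of_injOn hinj]
      refine card_le_of_rzNorm_rotation_le (c := α * r) hθ hε (by positivity) ?_ ?_
      · simp only [Finset.mem_image]
        rintro _ ⟨y, hy, rfl⟩ _ ⟨z, hz, rfl⟩
        obtain ⟨hyH, hyq⟩ := hF y hy
        obtain ⟨hzH, hzq⟩ := hF z hz
        have h1 := Finset.mem_Ico.1 (hH hyH)
        have h2 := Finset.mem_Ico.1 (hH hzH)
        rw [le_div_iff₀ hq0]
        generalize y / q = s at *
        generalize z / q = t at *
        have h3 : |s - t| * q ≤ N := by
          rw [← abs_of_pos hq0', ← abs_mul, abs_le]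
          constructor <;> nlinarith
        exact_mod_cast h3
      · simp only [Finset.mem_image]
        rintro _ ⟨y, hy, rfl⟩
        obtain ⟨hyH, hyq⟩ := hF y hy
        have h1 := h y hyH
        rw [← rzNorm_add_intCast _ (y / q * round (q * α))]
        have h2 : (y : ℝ) = r + q * (y / q : ℤ) := by exact_mod_cast hyq
        rw [h2] at h1
        convert h1 using 2
        rw [hθdef]
        push_cast
        ring
    · have : H.image (fun n : ℤ => n % q) ⊆ Finset.Ico 0 (q : ℤ) := by
        intro r hr
        obtain ⟨n, -, rfl⟩ := Finset.mem_image.1 hr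
        exact Finset.mem_Ico.2 ⟨Int.emod_nonneg _ hq0'.ne', Int.emod_lt_of_pos _ hq0'⟩
      have := Finset.card_le_card this
      simp only [Int.card_Ico] at this
      exact_mod_cast (by omega : #(H.image (fun n : ℤ => n % q)) ≤ q)
  have hexp : ((2 * ε / |θ| + 1) * (|θ| * (N / q) + 2 * ε + 1)) * q * |θ| =
      (2 * ε + |θ|) * (|θ| * N + q * (2 * ε + 1)) := by
    field_simp
    ring
  have h1 : (#H : ℝ) * |θ| ≤ (2 * ε + |θ|) * (|θ| * N + q * (2 * ε + 1)) := by
    rw [← hexp]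
    exact mul_le_mul_of_nonneg_right hcount hθ'.le
  have hε1 : 2 * ε ≤ 1 := by nlinarith
  have h2 : N * |θ| ≤ K * ((2 * ε + |θ|) * (|θ| * N + q * (2 * ε + 1))) := by
    calc N * |θ| ≤ K * #H * |θ| := mul_le_mul_of_nonneg_right hcard hθ'.le
      _ = K * (#H * |θ|) := by ring
      _ ≤ _ := by gcongr
  have h3 : K * ((2 * ε + |θ|) * (|θ| * N)) ≤ |θ| * N / 2 := by
    have : K * (2 * ε + |θ|) ≤ 1 / 2 := by nlinarith
    have h0 : 0 ≤ |θ| * N := by positivity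
    nlinarith
  have h4 : K * ((2 * ε + |θ|) * (q * (2 * ε + 1))) ≤ 6 * K ^ 2 * (2 * ε + |θ|) := by
    have : (q : ℝ) * (2 * ε + 1) ≤ 3 * K * 2 := by gcongr; linarith
    calc K * ((2 * ε + |θ|) * (q * (2 * ε + 1))) ≤ K * ((2 * ε + |θ|) * (3 * K * 2)) := by gcongr
      _ = _ := by ring
  have h5 : 24 * K ^ 2 * |θ| ≤ N * |θ| := by gcongr
  nlinarith

lemma natCast_le_pow {K : ℝ} (hK : 2 ≤ K) (n : ℕ) : (n : ℝ) ≤ K ^ n := by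
  calc (n : ℝ) ≤ (2 : ℝ) ^ n := by exact_mod_cast (Nat.lt_two_pow_self (n := n)).le
    _ ≤ K ^ n := pow_le_pow_left₀ (by norm_num) hK n

/-- Popular differences of a dense subset of an interval. -/
lemma exists_popular_differences {K : ℝ} {x : ℤ} {N : ℕ} {S : Finset ℤ} (hK : 2 ≤ K)
    (hS : S ⊆ Finset.Ico x (x + N)) (hcard : N ≤ K * #S) (hN : 1 ≤ N) :
    ∃ H ⊆ Finset.Ico (-N : ℤ) N, (2 * N : ℝ) ≤ 4 * K * #H ∧
      ∀ h ∈ H, (N : ℝ) ≤ 4 * K ^ 2 * #{n ∈ S | n + h ∈ S} := by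
  set I := Finset.Ico (-N : ℤ) N with hI
  set r : ℤ → ℕ := fun h => #{n ∈ S | n + h ∈ S}
  have hN' : (1 : ℝ) ≤ N := by exact_mod_cast hN
  have hS0 : (0 : ℝ) < #S := by
    by_contra! hneg
    nlinarith
  have hsum : ∑ h ∈ I, r h = #S * #S := by
    rw [← Finset.card_product, Finset.card_eq_sum_card_fiberwise (f := fun z => z.2 - z.1) (t := I)]
    · refine Finset.sum_congr rfl fun h _ => ?_
      refine Finset.card_bij (fun n _ => (n, n + h)) ?_ ?_ ?_
      · intro n hn
        simpa using hn
      · intro n _ n' _ hnn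
        exact (Prod.mk.inj hnn).1
      · rintro ⟨n, n'⟩ hn
        simp only [Finset.mem_filter, Finset.mem_product] at hn
        have : n + h = n' := by linarith [hn.2]
        refine ⟨n, ?_, by rw [this]⟩
        simp only [Finset.mem_filter]
        rw [this]
        exact hn.1
    · rintro ⟨n, n'⟩ hn
      simp only [Finset.coe_product, Set.mem_prod, Finset.mem_coe] at hn
      have h1 := Finset.mem_Ico.1 (hS hn.1)
      have h2 := Finset.mem_Ico.1 (hS hn.2)
      simp only [hI, Finset.coe_Ico, Set.mem_Ico]
      constructor <;> linarith
  refine ⟨{h ∈ I | (#S : ℝ) ≤ 4 * K * r h}, Finset.filter_subset _ _, ?_, ?_⟩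
  · have hle : ∀ h ∈ I, (r h : ℝ) ≤
        (if (#S : ℝ) ≤ 4 * K * r h then (#S : ℝ) else 0) + #S / (4 * K) := by
      intro h _
      split_ifs with hh
      · have : (r h : ℝ) ≤ #S := by exact_mod_cast Finset.card_filter_le _ _
        have : (0 : ℝ) ≤ #S / (4 * K) := by positivity
        linarith
      · rw [zero_add, le_div_iff₀ (by positivity)]
        linarith
    have h1 := Finset.sum_le_sum hle
    rw [Finset.sum_add_distrib, ← Finset.sum_filter, Finset.sum_const, Finset.sum_const,
      nsmul_eq_mul, nsmul_eq_mul, ← Nat.cast_sum, hsum] at h1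
    have h2 : #I = 2 * N := by
      simp [hI]
      omega
    rw [h2] at h1
    push_cast at h1
    set w : ℝ := (#{h ∈ I | (#S : ℝ) ≤ 4 * K * r h} : ℝ)
    have h3 : 2 * (N : ℝ) * (#S / (4 * K)) ≤ #S * #S / 2 := by
      rw [mul_div_assoc', div_le_div_iff₀ (by positivity) (by positivity)]
      nlinarith
    have h4 : (#S : ℝ) ≤ 2 * w := by
      by_contra! hneg
      nlinarith
    nlinarith
  · intro h hh
    have := (Finset.mem_filter.1 hh).2
    calc (N : ℝ) ≤ K * #S := hcard
      _ ≤ K * (4 * K * r h) := by gcongr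
      _ = _ := by ring

/-- The leading coefficient form of Vinogradov's lemma. -/
lemma exists_rzNorm_mul_coeff_le (d : ℕ) : ∃ C : ℕ, ∀ (K ε : ℝ) (x : ℤ) (N : ℕ) (S : Finset ℤ)
    (p : ℝ[X]), 2 ≤ K → S ⊆ Finset.Ico x (x + N) → K ^ C ≤ N → N ≤ K * #S → 0 ≤ ε →
    K ^ C * ε ≤ 1 → p.natDegree ≤ d → (∀ n ∈ S, rzNorm (p.eval (n : ℝ)) ≤ ε) →
    ∃ q : ℕ, 1 ≤ q ∧ (q : ℝ) ≤ K ^ C ∧ rzNorm (q * p.coeff d) * N ^ d ≤ K ^ C * ε := by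
  induction d with
  | zero =>
    refine ⟨0, fun K ε x N S p hK hS hN hcard hε hεK hp h => ⟨1, le_rfl, by simp, ?_⟩⟩
    obtain ⟨n, hn⟩ : S.Nonempty := by
      rw [Finset.nonempty_iff_ne_empty]
      rintro rfl
      simp at hcard hN
      omega
    have := h n hn
    rw [eq_C_of_natDegree_le_zero hp] at this
    simpa using this
  | succ d ih =>
    obtain ⟨C, hC⟩ := ih
    refine ⟨12 * C + d + 13, fun K ε x N S p hK hS hN hcard hε hεK hp h => ?_⟩
    have hK0 : 0 < K := by linarith
    have hK1 : 1 ≤ K := by linarith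
    have hmono : ∀ {i j : ℕ}, i ≤ j → K ^ i ≤ K ^ j := fun hij => pow_le_pow_right₀ hK1 hij
    have hN1 : (1 : ℝ) ≤ N := (one_le_pow₀ hK1).trans hN
    have hNd : (1 : ℝ) ≤ (N : ℝ) ^ d := one_le_pow₀ hN1
    have h4 : 4 ≤ K ^ 2 := by nlinarith
    have h64 : (64 : ℝ) ≤ K ^ 6 :=
      le_trans (by norm_num) (pow_le_pow_left₀ (by norm_num) hK 6)
    have h32 : (32 : ℝ) ≤ K ^ 5 :=
      le_trans (by norm_num) (pow_le_pow_left₀ (by norm_num) hK 5)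
    have h8 : (8 : ℝ) ≤ K ^ 3 :=
      le_trans (by norm_num) (pow_le_pow_left₀ (by norm_num) hK 3)
    obtain ⟨H, hHI, hHcard, hHpop⟩ := exists_popular_differences hK hS hcard (by exact_mod_cast hN1)
    have hstep : ∀ k ∈ H, ∃ q : ℕ, 1 ≤ q ∧ (q : ℝ) ≤ K ^ (4 * C) ∧
        rzNorm (q * (d + 1) * p.coeff (d + 1) * k) * N ^ d ≤ K ^ (4 * C) * (2 * ε) := by
      intro k hk
      obtain ⟨q, hq1, hqC, hq⟩ := hC (K ^ 4) (2 * ε) x N {n ∈ S | n + k ∈ S} (polyDiff k p)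
        (by nlinarith) ((Finset.filter_subset _ _).trans hS)
        (by rw [← pow_mul]; exact (hmono (by omega)).trans hN)
        ((hHpop k hk).trans (by gcongr; nlinarith [sq_nonneg (K ^ 2)])) (by positivity)
        (by
          rw [← pow_mul]
          calc K ^ (4 * C) * (2 * ε) ≤ K ^ (4 * C) * (K * ε) := by gcongr
            _ = K ^ (4 * C + 1) * ε := by ring
            _ ≤ K ^ (12 * C + d + 13) * ε := mul_le_mul_of_nonneg_right (hmono (by omega)) hε
            _ ≤ 1 := hεK)
        (natDegree_polyDiff_le hp _)
        (by
          intro n hn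
          rw [Finset.mem_filter] at hn
          have h1 := h n hn.1
          have h2 := h _ hn.2
          push_cast at h2
          rw [eval_polyDiff]
          linarith [rzNorm_sub_le (p.eval ((n : ℝ) + k)) (p.eval (n : ℝ))])
      rw [← pow_mul] at hqC hq
      refine ⟨q, hq1, hqC, ?_⟩
      rw [coeff_polyDiff hp] at hq
      convert hq using 3
      ring
    choose! f hf1 hfC hf using hstep
    have hH0 : 0 < (#H : ℝ) := by
      by_contra! hneg
      nlinarith
    obtain ⟨q, hq, hqcard⟩ := Finset.exists_le_card_fiber_of_nsmul_le_card_of_maps_to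
      (s := H) (t := Finset.Icc 1 ⌊K ^ (4 * C)⌋₊) (f := f) (b := (#H : ℝ) / K ^ (4 * C))
      (fun k hk => Finset.mem_Icc.2 ⟨hf1 k hk, Nat.le_floor (hfC k hk)⟩)
      (by
        rw [Finset.nonempty_Icc]
        exact Nat.le_floor (by simpa using one_le_pow₀ hK1))
      (by
        rw [nsmul_eq_mul, Nat.card_Icc, mul_div_assoc', div_le_iff₀ (by positivity), mul_comm]
        gcongr
        simpa using Nat.floor_le (by positivity : 0 ≤ K ^ (4 * C)))
    rw [div_le_iff₀ (by positivity)] at hqcard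
    obtain ⟨hq1, hqC⟩ := Finset.mem_Icc.1 hq
    have hqC' : (q : ℝ) ≤ K ^ (4 * C) := (Nat.le_floor_iff (by positivity)).1 hqC
    obtain ⟨q', hq'1, hq'K, hq'⟩ := exists_rzNorm_mul_le_of_linear (K := K ^ (4 * C + 3))
      (ε := K ^ (4 * C) * (2 * ε) / N ^ d) (α := q * (d + 1) * p.coeff (d + 1)) (x := -N)
      (N := 2 * N) (H := {k ∈ H | f k = q})
      (hK.trans (by simpa using hmono (show 1 ≤ 4 * C + 3 by omega)))
      (by
        refine (Finset.filter_subset _ _).trans (hHI.trans ?_)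
        refine Finset.Ico_subset_Ico_right ?_
        push_cast
        linarith)
      (by
        calc 24 * (K ^ (4 * C + 3)) ^ 2 ≤ K ^ 5 * (K ^ (4 * C + 3)) ^ 2 := by gcongr; linarith
          _ = K ^ (8 * C + 11) := by ring
          _ ≤ K ^ (12 * C + d + 13) := hmono (by omega)
          _ ≤ N := hN
          _ ≤ (2 * N : ℕ) := by push_cast; linarith)
      (by
        calc ((2 * N : ℕ) : ℝ) ≤ 4 * K * #H := by push_cast; exact hHcard
          _ ≤ K ^ 2 * K * (#{k ∈ H | f k = q} * K ^ (4 * C)) := by gcongr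
          _ = _ := by ring)
      (by positivity)
      (by
        rw [mul_div_assoc', div_le_one (by positivity)]
        refine le_trans ?_ hNd
        calc 8 * K ^ (4 * C + 3) * (K ^ (4 * C) * (2 * ε))
            ≤ K ^ 3 * K ^ (4 * C + 3) * (K ^ (4 * C) * (K * ε)) := by gcongr
          _ = K ^ (8 * C + 7) * ε := by ring
          _ ≤ K ^ (12 * C + d + 13) * ε := mul_le_mul_of_nonneg_right (hmono (by omega)) hε
          _ ≤ 1 := hεK)
      (by
        intro k hk
        rw [Finset.mem_filter] at hk
        rw [le_div_iff₀ (by positivity), ← hk.2]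
        exact hf k hk.1)
    refine ⟨q' * q * (d + 1), Nat.mul_pos (Nat.mul_pos hq'1 hq1) d.succ_pos, ?_, ?_⟩
    · push_cast
      have hd : (d : ℝ) + 1 ≤ K ^ (d + 1) := by exact_mod_cast natCast_le_pow hK (d + 1)
      calc (q' : ℝ) * q * (d + 1) ≤ (K ^ 2 * K ^ (4 * C + 3)) * K ^ (4 * C) * K ^ (d + 1) := by
            gcongr
            exact hq'K.trans (by gcongr; linarith)
        _ = K ^ (8 * C + d + 6) := by ring
        _ ≤ _ := hmono (by omega)
    · have hq'' : rzNorm (q' * (q * (d + 1) * p.coeff (d + 1))) * (2 * N) * N ^ d ≤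
          48 * (K ^ (4 * C + 3)) ^ 2 * (K ^ (4 * C) * (2 * ε)) := by
        rw [mul_div_assoc', le_div_iff₀ (by positivity)] at hq'
        push_cast at hq'
        exact hq'
      have heq : (((q' * q * (d + 1) : ℕ) : ℝ)) * p.coeff (d + 1) =
          q' * (q * (d + 1) * p.coeff (d + 1)) := by
        push_cast
        ring
      rw [heq]
      set z := rzNorm (q' * (q * (d + 1) * p.coeff (d + 1)))
      calc z * N ^ (d + 1) = z * (2 * N) * N ^ d / 2 := by ring
        _ ≤ 48 * (K ^ (4 * C + 3)) ^ 2 * (K ^ (4 * C) * (2 * ε)) / 2 := by gcongr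
        _ = 48 * (K ^ (12 * C + 6) * ε) := by ring
        _ ≤ K ^ 6 * (K ^ (12 * C + 6) * ε) := by gcongr; linarith
        _ = K ^ (12 * C + 12) * ε := by ring
        _ ≤ _ := mul_le_mul_of_nonneg_right (hmono (by omega)) hε

/-- A leading coefficient `α` for which `(D+1)! m^(D+1) α` is close to an integer for many `m`. -/
lemma exists_rzNorm_mul_le_of_dilates (D : ℕ) : ∃ C : ℕ, ∀ (K A L α : ℝ) (M : Finset ℤ), 2 ≤ K →
    1 ≤ A → K ^ C * A ≤ L → (∀ m ∈ M, A ≤ m ∧ m ≤ 2 * A) → A ≤ K * #M →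
    (∀ m ∈ M, rzNorm ((D + 1).factorial * (m : ℝ) ^ (D + 1) * α) * L ^ (D + 1) ≤
      K * (m : ℝ) ^ (D + 1)) →
    ∃ q : ℕ, 1 ≤ q ∧ (q : ℝ) ≤ K ^ C ∧ rzNorm (q * α) * L ^ (D + 1) ≤ K ^ C := by
  obtain ⟨V, hV⟩ := exists_rzNorm_mul_coeff_le (D + 1)
  set F := (D + 1).factorial
  refine ⟨(2 * V + 1) * (D + 1) + F + D + 2, fun K A L α M hK hA hL hM hcard h => ?_⟩
  have hK0 : 0 < K := by linarith
  have hK1 : 1 ≤ K := by linarith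
  have hA0 : 0 < A := by linarith
  have hmono : ∀ {i j : ℕ}, i ≤ j → K ^ i ≤ K ^ j := fun hij => pow_le_pow_right₀ hK1 hij
  have hL0 : 0 < L := lt_of_lt_of_le (by positivity) hL
  have hFK : (F : ℝ) ≤ K ^ F := natCast_le_pow hK F
  rcases le_total (K ^ (2 * V)) A with hAV | hAV
  · have hAM : A ≤ (⌊A⌋₊ + 1 : ℕ) := by push_cast; exact (Nat.lt_floor_add_one A).le
    have hdil : (2 * A / L) ^ (D + 1) ≤ 2 * A / L := by
      refine pow_le_of_le_one (by positivity) ?_ (by omega)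
      rw [div_le_one hL0]
      refine le_trans ?_ hL
      gcongr
      exact hK.trans (by simpa using hmono (show 1 ≤ (2 * V + 1) * (D + 1) + F + D + 2 by omega))
    obtain ⟨q, hq1, hqK, hq⟩ := hV (K ^ 2) (K * (2 * A / L) ^ (D + 1)) ⌈A⌉ (⌊A⌋₊ + 1) M
      (C (F * α) * X ^ (D + 1)) (by nlinarith)
      (by
        intro m hm
        obtain ⟨h1, h2⟩ := hM m hm
        refine Finset.mem_Ico.2 ⟨Int.ceil_le.2 h1, ?_⟩
        have h3 : (m : ℝ) < ((⌈A⌉ + (⌊A⌋₊ + 1 : ℕ) : ℤ) : ℝ) := by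
          push_cast
          linarith [Int.le_ceil A, Nat.lt_floor_add_one A]
        exact_mod_cast h3)
      (by rw [← pow_mul]; exact hAV.trans hAM)
      (by
        push_cast
        have := Nat.floor_le hA0.le
        nlinarith)
      (by positivity)
      (by
        calc (K ^ 2) ^ V * (K * (2 * A / L) ^ (D + 1)) ≤ (K ^ 2) ^ V * (K * (2 * A / L)) := by
              gcongr
          _ = (K ^ (2 * V + 1) * 2 * A) / L := by ring
          _ ≤ 1 := by
            rw [div_le_one hL0]
            refine le_trans ?_ hL
            gcongr
            calc K ^ (2 * V + 1) * 2 ≤ K ^ (2 * V + 1) * K := by gcongr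
              _ = K ^ (2 * V + 2) := by ring
              _ ≤ _ := hmono (by nlinarith))
      (natDegree_C_mul_X_pow_le _ _)
      (by
        intro m hm
        have h1 := h m hm
        obtain ⟨h2, h3⟩ := hM m hm
        have h4 : (0 : ℝ) ≤ m := by linarith
        rw [← le_div_iff₀ (by positivity)] at h1
        have h5 : eval (m : ℝ) (C (F * α) * X ^ (D + 1)) = F * (m : ℝ) ^ (D + 1) * α := by
          simp
          ring
        rw [h5]
        refine h1.trans ?_
        rw [div_pow, mul_div_assoc']
        gcongr)
    rw [← pow_mul] at hqK hq
    refine ⟨q * F, Nat.mul_pos hq1 (Nat.factorial_pos _), ?_, ?_⟩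
    · push_cast
      calc (q : ℝ) * F ≤ K ^ (2 * V) * K ^ F := by gcongr
        _ = K ^ (2 * V + F) := by ring
        _ ≤ _ := hmono (by nlinarith)
    · have heq : ((q * F : ℕ) : ℝ) * α = q * (C (F * α) * X ^ (D + 1) : ℝ[X]).coeff (D + 1) := by
        rw [coeff_C_mul_X_pow, if_pos rfl]
        push_cast
        ring
      rw [heq]
      set z := rzNorm (q * (C (F * α) * X ^ (D + 1) : ℝ[X]).coeff (D + 1))
      have hz : 0 ≤ z := rzNorm_nonneg _
      have h1 : z * A ^ (D + 1) ≤ K ^ (2 * V) * (K * (2 * A / L) ^ (D + 1)) := by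
        refine le_trans ?_ hq
        gcongr
      rw [div_pow, mul_pow, mul_div_assoc', mul_div_assoc', le_div_iff₀ (by positivity)] at h1
      have h2 : z * L ^ (D + 1) * A ^ (D + 1) ≤ K ^ (2 * V + 1) * 2 ^ (D + 1) * A ^ (D + 1) := by
        calc _ = z * A ^ (D + 1) * L ^ (D + 1) := by ring
          _ ≤ _ := h1
          _ = _ := by ring
      have h3 := le_of_mul_le_mul_right h2 (by positivity)
      calc z * L ^ (D + 1) ≤ K ^ (2 * V + 1) * 2 ^ (D + 1) := h3
        _ ≤ K ^ (2 * V + 1) * K ^ (D + 1) := by gcongr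
        _ = K ^ (2 * V + D + 2) := by ring
        _ ≤ _ := hmono (by nlinarith)
  · obtain ⟨m, hm⟩ : M.Nonempty := by
      rw [Finset.nonempty_iff_ne_empty]
      rintro rfl
      simp at hcard
      linarith
    obtain ⟨h1, h2⟩ := hM m hm
    have hm0 : (0 : ℝ) < m := by linarith
    have hm0' : (0 : ℤ) < m := by exact_mod_cast hm0
    obtain ⟨m, rfl⟩ := Int.eq_ofNat_of_zero_le hm0'.le
    have h3 := h m hm
    simp only [Int.cast_natCast] at h1 h2 h3 hm0
    have hmK : (m : ℝ) ^ (D + 1) ≤ K ^ ((2 * V + 1) * (D + 1)) := by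
      rw [pow_mul]
      gcongr
      calc (m : ℝ) ≤ K * K ^ (2 * V) := h2.trans (by gcongr)
        _ = _ := by ring
    refine ⟨F * m ^ (D + 1), Nat.mul_pos (Nat.factorial_pos _)
      (pow_pos (by exact_mod_cast hm0) _), ?_, ?_⟩
    · push_cast
      calc (F : ℝ) * (m : ℝ) ^ (D + 1) ≤ K ^ F * K ^ ((2 * V + 1) * (D + 1)) := by gcongr
        _ = K ^ (F + (2 * V + 1) * (D + 1)) := by ring
        _ ≤ _ := hmono (by omega)
    · push_cast
      refine h3.trans ?_
      calc K * (m : ℝ) ^ (D + 1) ≤ K * K ^ ((2 * V + 1) * (D + 1)) := by gcongr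
        _ = K ^ (1 + (2 * V + 1) * (D + 1)) := by ring
        _ ≤ _ := hmono (by omega)

lemma rzNorm_le_of_eq_add {x y z : ℝ} {k : ℤ} (h : x = y + k + z) : rzNorm x ≤ rzNorm y + |z| := by
  rw [h, add_right_comm, rzNorm_add_intCast]
  exact (rzNorm_add_le _ _).trans (by gcongr; exact rzNorm_le_abs z)

/-- Subtracting an integral and a small multiple of the top monomial lowers the degree. -/
lemma natDegree_sub_leading_le {e : ℕ} {p : ℝ[X]} (hp : p.natDegree ≤ e + 1) {q k θ c : ℝ}
    (h : q * p.coeff (e + 1) = k + θ) :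
    (C q * p - C k * X ^ (e + 1) - C θ * (X - C c) ^ (e + 1)).natDegree ≤ e := by
  refine natDegree_le_pred (n := e + 1) ?_ ?_
  · refine (natDegree_sub_le _ _).trans (max_le ((natDegree_sub_le _ _).trans
      (max_le ?_ (natDegree_C_mul_X_pow_le k (e + 1)))) ?_)
    · exact (natDegree_C_mul_le _ _).trans hp
    · refine (natDegree_C_mul_le _ _).trans (le_of_eq ?_)
      rw [natDegree_pow, natDegree_X_sub_C, mul_one]
  · have h1 : ((X - C c) ^ (e + 1) : ℝ[X]).coeff (e + 1) = 1 := by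
      have := ((monic_X_sub_C c).pow (e + 1)).coeff_natDegree
      rwa [natDegree_pow, natDegree_X_sub_C, mul_one] at this
    rw [coeff_sub, coeff_sub, coeff_C_mul, coeff_C_mul, coeff_C_mul, coeff_X_pow, if_pos rfl, h1, h]
    ring

lemma exists_diffOp_iterate_eq_add (j e : ℕ) (p : ℝ[X]) (q θ c : ℝ) (k m : ℤ) (hm : m ≠ 0)
    (n : ℤ) : ∃ l : ℤ, q * diffOp^[j] (fun n : ℤ => p.eval (m * n : ℝ)) n =
      diffOp^[j] (fun n : ℤ => (C q * p - C (k : ℝ) * X ^ e - C θ * (X - C c) ^ e).eval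
        (m * n : ℝ)) n + l + θ * m ^ e * diffOp^[j] (fun n : ℤ => (n - c / m : ℝ) ^ e) n := by
  obtain ⟨l, hl⟩ := exists_diffOp_iterate_intCast j (fun n => k * (m * n) ^ e) n
  refine ⟨l, ?_⟩
  rw [← hl, ← diffOp_iterate_const_mul, ← diffOp_iterate_const_mul, ← diffOp_iterate_add,
    ← diffOp_iterate_add]
  refine congrFun (congrArg diffOp^[j] (funext fun n => ?_)) n
  have hm' : (m : ℝ) ≠ 0 := by exact_mod_cast hm
  have h1 : (m * n - c : ℝ) ^ e = m ^ e * (n - c / m) ^ e := by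
    rw [← mul_pow]
    congr 1
    field_simp
  simp only [eval_sub, eval_mul, eval_C, eval_pow, eval_X, h1]
  push_cast
  ring

lemma exists_smooth_multiple_of_smooth_dilates (d e : ℕ) (he : e ≤ d) :
    ∃ R : ℕ, ∀ (K A a b : ℝ) (M : Finset ℤ) (p : ℝ[X]), 2 ≤ K → 1 ≤ A → 2 * A ≤ b - a →
      K ^ R * A ≤ b - a → (∀ m ∈ M, A ≤ m ∧ m ≤ 2 * A) → A ≤ K * #M → p.natDegree ≤ e →
      (∀ m ∈ M, ∀ j ≤ d, ∀ n : ℤ, a ≤ m * n → m * n ≤ b →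
        ((b - a) / m) ^ j * rzNorm (diffOp^[j] (fun n : ℤ => p.eval (m * n : ℝ)) n) ≤ K) →
      ∃ q : ℕ, 1 ≤ q ∧ (q : ℝ) ≤ K ^ R ∧ ∀ j ≤ d, ∀ n : ℤ, a ≤ n → n ≤ b →
        (b - a) ^ j * rzNorm (q * diffOp^[j] (fun n : ℤ => p.eval (n : ℝ)) n) ≤ K ^ R := by
  induction e with
  | zero =>
    refine ⟨0, fun K A a b M p hK hA hab hL hM hcard hp h =>
      ⟨1, le_rfl, by simp, fun j _ n _ _ => ?_⟩⟩
    rcases j with _ | j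
    · simp only [pow_zero, one_mul]
      exact (rzNorm_le_half _).trans (by norm_num)
    · have h1 : diffOp (fun n : ℤ => p.eval (n : ℝ)) = fun _ => 0 := by
        have := diffOp_eval 1 0 p
        rw [polyDiff_eq_zero hp] at this
        simpa using this
      rw [Function.iterate_succ_apply, h1, diffOp_iterate_zero]
      simp [rzNorm]
  | succ e ih =>
    obtain ⟨R, hR⟩ := ih (by omega)
    obtain ⟨T, hT⟩ := exists_rzNorm_mul_le_of_dilates e
    obtain ⟨B, hB⟩ := exists_forall_abs_diffOp_iterate_pow_le d (e + 1)
    refine ⟨(T + B + 2) * R + (T + B + 2), fun K A a b M p hK hA hab hL hM hcard hp h => ?_⟩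
    have hK0 : 0 < K := by linarith
    have hK1 : 1 ≤ K := by linarith
    have hL0 : 0 < b - a := by linarith
    have hmono : ∀ {i j : ℕ}, i ≤ j → K ^ i ≤ K ^ j := fun hij => pow_le_pow_right₀ hK1 hij
    have hBK : (B : ℝ) ≤ K ^ B := natCast_le_pow hK B
    have hMpos : ∀ m ∈ M, (0 : ℝ) < m := fun m hm => by linarith [(hM m hm).1]
    have hMdiv : ∀ m ∈ M, 1 ≤ (b - a) / m := fun m hm => by
      rw [le_div_iff₀ (hMpos m hm)]
      linarith [(hM m hm).2]
    obtain ⟨Q, hQ1, hQT, hQ⟩ := hT K A (b - a) (p.coeff (e + 1)) M hK hA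
      (le_trans (mul_le_mul_of_nonneg_right (hmono (by nlinarith)) (by linarith)) hL) hM hcard
      (by
        intro m hm
        have hm0 := hMpos m hm
        have hceil := Int.ceil_lt_add_one (a / m)
        have h1 := h m hm (e + 1) he ⌈a / m⌉
          (by
            have := Int.le_ceil (a / m)
            rw [div_le_iff₀ hm0] at this
            linarith)
          (by
            have h2 : m * (⌈a / m⌉ : ℝ) ≤ m * (a / m + 1) := by gcongr
            rw [mul_add, mul_div_cancel₀ _ hm0.ne'] at h2
            linarith [(hM m hm).2])
        rw [diffOp_iterate_eval_eq m (e + 1) p hp, div_pow, div_mul_eq_mul_div,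
          div_le_iff₀ (by positivity)] at h1
        linarith)
    set k := round (Q * p.coeff (e + 1))
    set θ := Q * p.coeff (e + 1) - k with hθ
    have hθL : |θ| * (b - a) ^ (e + 1) ≤ K ^ T := hQ
    set r := C (Q : ℝ) * p - C (k : ℝ) * X ^ (e + 1) - C θ * (X - C (⌈a⌉ : ℝ)) ^ (e + 1) with hr
    have hrdeg : r.natDegree ≤ e := natDegree_sub_leading_le hp (by rw [hθ]; ring)
    have hθB : ∀ m : ℤ, (0 : ℝ) < m → 1 ≤ (b - a) / m → ∀ j ≤ d, ∀ n : ℤ, a ≤ m * n → m * n ≤ b →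
        ((b - a) / m) ^ j * |θ * m ^ (e + 1) *
          diffOp^[j] (fun n : ℤ => (n - ⌈a⌉ / m : ℝ) ^ (e + 1)) n| ≤ K ^ (T + B) := by
      intro m hm hm1 j hj n han hnb
      have h1 := hB j hj (⌈a⌉ / m) ((b - a) / m) n hm1 (by
        have h2 : (n : ℝ) - ⌈a⌉ / m = (m * n - ⌈a⌉) / m := by field_simp
        have h3 := Int.le_ceil a
        have h5 : (⌈a⌉ : ℝ) ≤ b := by
          have h4 := Int.ceil_le (a := a) (z := m * n)
          have : ⌈a⌉ ≤ m * n := h4.2 (by push_cast; exact han)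
          have : (⌈a⌉ : ℝ) ≤ m * n := by exact_mod_cast this
          linarith
        rw [h2, abs_div, abs_of_pos hm]
        gcongr
        rw [abs_le]
        constructor <;> linarith)
      rw [abs_mul, abs_mul, abs_pow, abs_of_pos hm]
      calc _ = |θ| * m ^ (e + 1) * (((b - a) / m) ^ j *
            |diffOp^[j] (fun n : ℤ => (n - ⌈a⌉ / m : ℝ) ^ (e + 1)) n|) := by ring
        _ ≤ |θ| * m ^ (e + 1) * (B * ((b - a) / m) ^ (e + 1)) := by gcongr
        _ = B * (|θ| * (b - a) ^ (e + 1)) := by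
          rw [div_pow]
          field_simp
        _ ≤ K ^ B * K ^ T := by gcongr
        _ = _ := by ring
    obtain ⟨q, hq1, hqK, hq⟩ := hR (K ^ (T + B + 2)) A a b M r
      (hK.trans (by simpa using hmono (show 1 ≤ T + B + 2 by omega))) hA hab
      (by
        rw [← pow_mul]
        exact le_trans (mul_le_mul_of_nonneg_right (hmono (by omega)) (by linarith)) hL)
      hM
      (hcard.trans (mul_le_mul_of_nonneg_right
        (by simpa using hmono (show 1 ≤ T + B + 2 by omega)) (Nat.cast_nonneg _)))
      hrdeg
      (by
        intro m hm j hj n han hnb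
        have hm0 := hMpos m hm
        have hm0' : m ≠ 0 := by
          rintro rfl
          simp at hm0
        obtain ⟨l, hl⟩ := exists_diffOp_iterate_eq_add j (e + 1) p Q θ ⌈a⌉ k m hm0' n
        rw [← hr] at hl
        set x := diffOp^[j] (fun n : ℤ => p.eval (m * n : ℝ)) n
        set z := θ * m ^ (e + 1) * diffOp^[j] (fun n : ℤ => (n - ⌈a⌉ / m : ℝ) ^ (e + 1)) n with hz
        set y := diffOp^[j] (fun n : ℤ => r.eval (m * n : ℝ)) n
        have h1 : rzNorm y ≤ Q * rzNorm x + |z| := by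
          have h2 : y = Q * x + (-l : ℤ) + -z := by push_cast; linarith
          refine (rzNorm_le_of_eq_add h2).trans ?_
          rw [abs_neg]
          gcongr
          exact rzNorm_natCast_mul_le _ _
        have h3 := h m hm j hj n han hnb
        have h4 := hθB m hm0 (hMdiv m hm) j hj n han hnb
        rw [← hz] at h4
        have hd0 : 0 ≤ ((b - a) / m) ^ j := by positivity
        have hx0 : 0 ≤ ((b - a) / m) ^ j * rzNorm x := mul_nonneg hd0 (rzNorm_nonneg x)
        calc ((b - a) / m) ^ j * rzNorm y ≤ ((b - a) / m) ^ j * (Q * rzNorm x + |z|) := by gcongr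
          _ = Q * (((b - a) / m) ^ j * rzNorm x) + ((b - a) / m) ^ j * |z| := by ring
          _ ≤ K ^ T * K + K ^ (T + B) := by gcongr
          _ = K ^ (T + 1) + K ^ (T + B) := by ring
          _ ≤ K ^ (T + B + 1) + K ^ (T + B + 1) :=
            add_le_add (hmono (by omega)) (hmono (by omega))
          _ = 2 * K ^ (T + B + 1) := by ring
          _ ≤ K * K ^ (T + B + 1) := by gcongr
          _ = _ := by ring)
    rw [← pow_mul] at hqK hq
    refine ⟨q * Q, Nat.mul_pos hq1 hQ1, ?_, ?_⟩
    · push_cast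
      calc (q : ℝ) * Q ≤ K ^ ((T + B + 2) * R) * K ^ T := by gcongr
        _ = K ^ ((T + B + 2) * R + T) := by ring
        _ ≤ _ := hmono (by omega)
    · intro j hj n han hnb
      obtain ⟨l, hl⟩ := exists_diffOp_iterate_eq_add j (e + 1) p Q θ ⌈a⌉ k 1 one_ne_zero n
      rw [← hr] at hl
      have h4 := hθB 1 (by simp) (by simp; linarith) j hj n (by simpa using han) (by simpa using hnb)
      simp only [Int.cast_one, one_mul, div_one, one_pow, mul_one] at hl h4
      have h3 := hq j hj n han hnb
      set x := diffOp^[j] (fun n : ℤ => p.eval (n : ℝ)) n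
      set z := θ * diffOp^[j] (fun n : ℤ => (n - ⌈a⌉ : ℝ) ^ (e + 1)) n with hz
      set y := diffOp^[j] (fun n : ℤ => r.eval (n : ℝ)) n
      have h1 : rzNorm ((q * Q : ℕ) * x) ≤ rzNorm (q * y) + q * |z| := by
        have h2 : ((q * Q : ℕ) : ℝ) * x = q * y + (q * l : ℤ) + q * z := by
          push_cast
          linear_combination (q : ℝ) * hl
        refine (rzNorm_le_of_eq_add h2).trans ?_
        rw [abs_mul, Nat.abs_cast]
      calc (b - a) ^ j * rzNorm ((q * Q : ℕ) * x)
          ≤ (b - a) ^ j * (rzNorm (q * y) + q * |z|) := by gcongr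
        _ = (b - a) ^ j * rzNorm (q * y) + q * ((b - a) ^ j * |z|) := by ring
        _ ≤ K ^ ((T + B + 2) * R) + K ^ ((T + B + 2) * R) * K ^ (T + B) := by gcongr
        _ = K ^ ((T + B + 2) * R) + K ^ ((T + B + 2) * R + (T + B)) := by ring
        _ ≤ K ^ ((T + B + 2) * R + (T + B + 1)) + K ^ ((T + B + 2) * R + (T + B + 1)) :=
          add_le_add (hmono (by omega)) (hmono (by omega))
        _ = 2 * K ^ ((T + B + 2) * R + (T + B + 1)) := by ring
        _ ≤ K * K ^ ((T + B + 2) * R + (T + B + 1)) := by gcongr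
        _ = _ := by ring

lemma le_smoothNorm {d j : ℕ} (hj : j ≤ d) (P : ℤ → ℝ) {a b : ℝ} {n : ℤ} (ha : a ≤ n)
    (hb : n ≤ b) : (b - a) ^ j * rzNorm (diffOp^[j] P n) ≤ smoothNorm d P a b := by
  refine le_csSup ⟨(1 + (b - a)) ^ d * (1 / 2), ?_⟩ ⟨j, hj, n, ha, hb, rfl⟩
  rintro _ ⟨i, hi, m, -, -, rfl⟩
  have h0 : 0 ≤ b - a := by linarith
  refine mul_le_mul ?_ (rzNorm_le_half _) (rzNorm_nonneg _) (by positivity)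
  exact (pow_le_pow_left₀ h0 (by linarith) i).trans (pow_le_pow_right₀ (by linarith) hi)

/-- The polynomial `∑_{j=0}^{d} α_j X^j`. -/
noncomputable def coeffPoly (d : ℕ) (α : ℕ → ℝ) : ℝ[X] :=
  ∑ j ∈ Finset.range (d + 1), C (α j) * X ^ j

lemma natDegree_coeffPoly_le (d : ℕ) (α : ℕ → ℝ) : (coeffPoly d α).natDegree ≤ d :=
  natDegree_sum_le_of_forall_le _ _ fun _ hi =>
    (natDegree_C_mul_X_pow_le _ _).trans (Nat.lt_succ_iff.1 (Finset.mem_range.1 hi))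

lemma polyEval_eq_eval (d : ℕ) (α : ℕ → ℝ) (n : ℤ) :
    polyEval d α n = (coeffPoly d α).eval (n : ℝ) := by
  simp [polyEval, coeffPoly, eval_finsetSum]

/-- Corollary 2.3 (concatenating dilated smoothness): if `‖P(a·)‖_{C^∞((1/a)I)} ≤ 1/δ`
for at least `δA` integers `a ∈ [A, 2A]`, with `|I| ≥ 2A`, then either
`|I| ≪_d δ^{-O_d(1)} A`, or `‖qP‖_{C^∞(I)} ≪_d δ^{-O_d(1)}` for some integer
`1 ≤ q ≪_d δ^{-O_d(1)}`. -/
theorem concatenating_dilated_smoothness (d : ℕ) :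
    ∃ C : ℝ, 0 < C ∧
      ∀ δ : ℝ, 0 < δ → δ < 1 / 2 →
      ∀ (α : ℕ → ℝ) (A : ℝ), 1 ≤ A →
      ∀ a b : ℝ, 2 * A ≤ b - a →
        δ * A ≤ (((Finset.Icc ⌈A⌉ ⌊2 * A⌋).filter
            fun m => smoothNorm d (fun n => polyEval d α (m * n)) (a / (m : ℝ)) (b / (m : ℝ))
              ≤ 1 / δ).card : ℝ) →
        b - a ≤ C * δ ^ (-C) * A ∨
          ∃ q : ℕ, 1 ≤ q ∧ (q : ℝ) ≤ C * δ ^ (-C) ∧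
            smoothNorm d (fun n => (q : ℝ) * polyEval d α n) a b ≤ C * δ ^ (-C) := by
  obtain ⟨R, hR⟩ := exists_smooth_multiple_of_smooth_dilates d d le_rfl
  refine ⟨(R + 1 : ℕ), by positivity, fun δ hδ0 hδ α A hA a b hab hcard => ?_⟩
  have hK : 2 ≤ 1 / δ := by
    rw [le_div_iff₀ hδ0]
    linarith
  have hpow : δ ^ (-((R + 1 : ℕ) : ℝ)) = (1 / δ) ^ (R + 1) := by
    rw [Real.rpow_neg hδ0.le, Real.rpow_natCast, one_div, inv_pow]
  rw [hpow]
  have hle : (1 / δ) ^ R ≤ ((R + 1 : ℕ) : ℝ) * (1 / δ) ^ (R + 1) := by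
    calc (1 / δ) ^ R ≤ (1 / δ) ^ (R + 1) := pow_le_pow_right₀ (by linarith) (by omega)
      _ ≤ _ := le_mul_of_one_le_left (by positivity) (by exact_mod_cast R.succ_pos)
  rw [or_iff_not_imp_left, not_le]
  intro hlong
  set S := (Finset.Icc ⌈A⌉ ⌊2 * A⌋).filter fun m =>
    smoothNorm d (fun n => polyEval d α (m * n)) (a / (m : ℝ)) (b / (m : ℝ)) ≤ 1 / δ
  obtain ⟨q, hq1, hqK, hq⟩ := hR (1 / δ) A a b S (coeffPoly d α) hK hA hab
    ((mul_le_mul_of_nonneg_right hle (by linarith)).trans hlong.le)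
    (by
      intro m hm
      have h1 := Finset.mem_Icc.1 (Finset.mem_filter.1 hm).1
      exact ⟨Int.ceil_le.1 h1.1, Int.le_floor.1 h1.2⟩)
    (by
      rw [one_div, inv_mul_eq_div, le_div_iff₀ hδ0]
      linarith)
    (natDegree_coeffPoly_le d α)
    (by
      intro m hm j hj n han hnb
      obtain ⟨h1, h2⟩ := Finset.mem_filter.1 hm
      have h3 := Int.ceil_le.1 (Finset.mem_Icc.1 h1).1
      have hm0 : (0 : ℝ) < m := by linarith
      refine le_trans ?_ h2
      have h4 := le_smoothNorm hj (fun n => polyEval d α (m * n)) (a := a / m) (b := b / m) (n := n)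
        (by rw [div_le_iff₀ hm0]; linarith) (by rw [le_div_iff₀ hm0]; linarith)
      simp only [polyEval_eq_eval, Int.cast_mul] at h4 ⊢
      rwa [← sub_div] at h4)
  refine ⟨q, hq1, hqK.trans hle, Real.sSup_le ?_ (by positivity)⟩
  rintro _ ⟨j, hj, n, han, hnb, rfl⟩
  rw [diffOp_iterate_const_mul, funext (polyEval_eq_eval d α)]
  exact (hq j hj n han hnb).trans hle
end

section
/- There exists an absolute constant C such that the following holds. Let X, H, M ≥ 1 be reals with X^{1/3} ≤ H ≤ X and M ≤ C^{−1} X^{1/2} (more precisely M ≪ X^{1/2} with a suitable absolute implied constant), and let J be a subinterval of (M, 2M]. Then for any integer Q with M/H ≤ Q ≤ M/(HX)^{1/4}, the set S := {(m, n) ∈ ℤ² : m ∈ J, X < nm ≤ X+H} can be partitioned as the disjoint union over coprime pairs of positive integers (a, q) with 1 ≤ q ≤ Q and C^{−1}(X/M²)q ≤ a ≤ C(X/M²)q, of families 𝒫_{a,q} of arithmetic progressions P ⊆ S in ℤ², where each family satisfies #𝒫_{a,q} ≤ C · M³/(X Q² q), and each P ∈ 𝒫_{a,q} is an arithmetic progression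 of common difference (q, −a) and of length (number of terms) at most HQ/M. -/
open Finset

theorem round_le_round_of_le {x y : ℝ} (h : x ≤ y) : round x ≤ round y := by
  rw [round_eq, round_eq]
  exact Int.floor_mono (by linarith)

/-- Dirichlet approximation with a canonical choice of the fraction `a / q` for each `θ`: the
numbers with a given fraction form an interval. -/
theorem exists_dirichlet_assignment {Q : ℕ} (hQ : 0 < Q) :
    ∃ (q : ℝ → ℕ) (a : ℝ → ℤ), (∀ θ, 0 < q θ ∧ q θ ≤ Q ∧ IsCoprime (a θ) (q θ : ℤ) ∧
        |q θ * θ - a θ| ≤ 1 / ((Q : ℝ) + 1)) ∧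
      ∀ x y z, x ≤ y → y ≤ z → q x = q z → a x = a z → q y = q x ∧ a y = a x := by
  classical
  have hex : ∀ θ : ℝ, ∃ k : ℕ, 0 < k ∧ |k * θ - round (k * θ)| ≤ 1 / ((Q : ℝ) + 1) := fun θ ↦
    let ⟨k, hk, _, h⟩ := Real.exists_nat_abs_mul_sub_round_le θ hQ
    ⟨k, hk, h⟩
  have hmin : ∀ (θ : ℝ) (k : ℕ) (b : ℤ), 0 < k → |k * θ - b| ≤ 1 / ((Q : ℝ) + 1) →
      Nat.find (hex θ) ≤ k := fun θ k b hk hb ↦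
    Nat.find_min' (hex θ) ⟨hk, (round_le _ b).trans hb⟩
  refine ⟨fun θ ↦ Nat.find (hex θ), fun θ ↦ round (Nat.find (hex θ) * θ), fun θ ↦ ?_, ?_⟩
  · obtain ⟨hpos, happ⟩ := Nat.find_spec (hex θ)
    refine ⟨hpos, ?_, ?_, happ⟩
    · obtain ⟨k, hk, hkQ, h⟩ := Real.exists_nat_abs_mul_sub_round_le θ hQ
      exact (Nat.find_min' (hex θ) ⟨hk, h⟩).trans hkQ
    · set q := Nat.find (hex θ) with hq
      set a := round (q * θ) with ha
      rw [Int.isCoprime_iff_gcd_eq_one]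
      set d := Int.gcd a q with hd
      have hdpos : 0 < d := Int.gcd_pos_of_ne_zero_right _ (by exact_mod_cast hpos.ne')
      obtain ⟨a', ha'⟩ : (d : ℤ) ∣ a := Int.gcd_dvd_left ..
      obtain ⟨q', hq'⟩ : d ∣ q := by exact_mod_cast (Int.gcd_dvd_right a (q : ℤ))
      have hq'pos : 0 < q' := by
        rcases Nat.eq_zero_or_pos q' with h | h
        · simp [h] at hq'; omega
        · exact h
      have hle : q ≤ q' := by
        refine hmin θ q' a' hq'pos (le_trans ?_ happ)
        rw [ha', show (q : ℝ) = d * q' by exact_mod_cast hq']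
        push_cast
        rw [show (d : ℝ) * q' * θ - d * a' = d * (q' * θ - a') by ring, abs_mul, Nat.abs_cast]
        exact le_mul_of_one_le_left (abs_nonneg _) (by exact_mod_cast hdpos)
      nlinarith
  · intro x y z hxy hyz hq ha
    obtain ⟨hpx, hx⟩ := Nat.find_spec (hex x)
    obtain ⟨hpy, hy⟩ := Nat.find_spec (hex y)
    obtain ⟨hpz, hz⟩ := Nat.find_spec (hex z)
    simp only at hq ha ⊢
    have hminx := hmin x
    have hminy := hmin y
    have hminz := hmin z
    rw [← ha, ← hq] at hz
    rw [← hq] at ha hminz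
    set q := Nat.find (hex x)
    set r := Nat.find (hex y)
    set a := round ((q : ℝ) * x)
    set b := round ((r : ℝ) * y)
    set ε := 1 / ((Q : ℝ) + 1)
    rw [abs_le] at hx hy hz
    have hq0 : (0 : ℝ) < q := by exact_mod_cast hpx
    have hr0 : (0 : ℝ) < r := by exact_mod_cast hpy
    have hqx := mul_le_mul_of_nonneg_left hxy hq0.le
    have hqz := mul_le_mul_of_nonneg_left hyz hq0.le
    have hrx := mul_le_mul_of_nonneg_left hxy hr0.le
    have hrz := mul_le_mul_of_nonneg_left hyz hr0.le
    have hrq : r ≤ q := hminy q a hpx (abs_le.2 ⟨by linarith, by linarith⟩)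
    have hrq' : (r : ℝ) ≤ q := by exact_mod_cast hrq
    have hε : 0 < ε := by positivity
    have hqr : q ≤ r := by
      rcases le_total ((a : ℝ) * r) (b * q) with h | h
      · refine hminz r b hpy (abs_le.2 ⟨by linarith, ?_⟩)
        have : q * (r * z - b) ≤ q * ε := by nlinarith
        exact le_of_mul_le_mul_left this hq0
      · refine hminx r b hpy (abs_le.2 ⟨?_, by linarith⟩)
        have : q * (-ε) ≤ q * (r * x - b) := by nlinarith
        exact le_of_mul_le_mul_left this hq0
    have hrq : r = q := le_antisymm hrq hqr
    refine ⟨hrq, le_antisymm ?_ ?_⟩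
    · rw [ha]; exact round_le_round_of_le (by rw [hrq]; exact hqz)
    · exact round_le_round_of_le (by rw [hrq]; exact hqx)

/-- A finite convex set of lattice points on the line `a m + q n = c` is an arithmetic progression
of common difference `(q, -a)`. -/
theorem exists_eq_image_range_of_line {a q N : ℕ} {c : ℤ} (hq : 0 < q)
    (haq : IsCoprime (a : ℤ) (q : ℤ)) {P : Finset (ℤ × ℤ)}
    (hline : ∀ x ∈ P, a * x.1 + q * x.2 = c)
    (hconv : ∀ x ∈ P, ∀ y ∈ P, ∀ z : ℤ × ℤ, a * z.1 + q * z.2 = c → x.1 ≤ z.1 → z.1 ≤ y.1 → z ∈ P)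
    (hlen : ∀ x ∈ P, ∀ y ∈ P, y.1 - x.1 < q * N) :
    ∃ (u : ℤ × ℤ) (k : ℕ), k ≤ N ∧ P = (Finset.range k).image
      fun j : ℕ ↦ (u.1 + (j : ℤ) * (q : ℤ), u.2 - (j : ℤ) * (a : ℤ)) := by
  rcases P.eq_empty_or_nonempty with rfl | hP
  · exact ⟨0, 0, by simp, by simp⟩
  obtain ⟨u, hu, hmin⟩ := P.exists_min_image Prod.fst hP
  obtain ⟨v, hv, hmax⟩ := P.exists_max_image Prod.fst hP
  have hq' : (0 : ℤ) < q := by exact_mod_cast hq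
  have key : ∀ x ∈ P, ∃ l : ℕ, x.1 = u.1 + l * q ∧ x.2 = u.2 - l * a := by
    intro x hx
    have h1 := hline x hx
    have h2 := hline u hu
    obtain ⟨l, hl⟩ : (q : ℤ) ∣ x.1 - u.1 :=
      haq.symm.dvd_of_dvd_mul_left ⟨u.2 - x.2, by linear_combination h1 - h2⟩
    have hl0 : 0 ≤ l := by
      have := hmin x hx
      by_contra! h
      nlinarith
    lift l to ℕ using hl0
    refine ⟨l, by linear_combination hl, ?_⟩
    have : (q : ℤ) * x.2 = q * (u.2 - l * a) := by linear_combination h1 - h2 - a * hl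
    exact mul_left_cancel₀ hq'.ne' this
  obtain ⟨l, hl, -⟩ := key v hv
  refine ⟨u, l + 1, ?_, ?_⟩
  · have := hlen u hu v hv
    have h : (q : ℤ) * l < q * N := by linarith
    have := lt_of_mul_lt_mul_left h hq'.le
    omega
  · ext x
    simp only [mem_image, mem_range]
    constructor
    · intro hx
      obtain ⟨j, hj1, hj2⟩ := key x hx
      refine ⟨j, ?_, by ext <;> simp [hj1, hj2]⟩
      have := hmax x hx
      have h : (j : ℤ) * q ≤ l * q := by linarith
      have := le_of_mul_le_mul_right h hq'
      omega
    · rintro ⟨j, hj, rfl⟩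
      refine hconv u hu v hv _ ?_ ?_ ?_
      · have := hline u hu
        linear_combination this
      · simp only; nlinarith
      · have : (j : ℤ) ≤ l := by omega
        simp only [hl]; nlinarith

theorem sum_one_div_sqrt_le (s : Finset ℤ) (u T : ℝ) (hT : 0 ≤ T)
    (hs : ∀ c ∈ s, u + 1 ≤ (c : ℝ) ∧ (c : ℝ) ≤ u + T) :
    ∑ c ∈ s, 1 / √((c : ℝ) - u) ≤ 2 * √T := by
  induction s using Finset.induction_on_max generalizing T with
  | empty => simp
  | insert c s hmax ih =>
    rw [sum_insert fun h ↦ lt_irrefl _ (hmax c h)]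
    obtain ⟨h1, h2⟩ := hs c (mem_insert_self ..)
    have h3 := ih (c - u - 1) (by linarith) fun d hd ↦ by
      have : (d : ℝ) ≤ c - 1 := by exact_mod_cast Int.le_sub_one_of_lt (hmax d hd)
      exact ⟨(hs d (mem_insert_of_mem hd)).1, by linarith⟩
    have h4 : √((c : ℝ) - u) ≤ √T := Real.sqrt_le_sqrt (by linarith)
    have h5 : 0 < √((c : ℝ) - u) := Real.sqrt_pos.2 (by linarith)
    have h6 := Real.sq_sqrt (show (0 : ℝ) ≤ c - u by linarith)
    have h7 := Real.sq_sqrt (show (0 : ℝ) ≤ c - u - 1 by linarith)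
    have h8 : 1 / √((c : ℝ) - u) ≤ 2 * (√((c : ℝ) - u) - √((c : ℝ) - u - 1)) := by
      rw [div_le_iff₀ h5]
      nlinarith [sq_nonneg (√((c : ℝ) - u) - √((c : ℝ) - u - 1))]
    linarith

theorem card_le_of_sub_le (s : Finset ℤ) {D : ℝ} (hD : 0 ≤ D + 1)
    (hs : ∀ b ∈ s, ∀ b' ∈ s, (b' : ℝ) - b ≤ D) : (#s : ℝ) ≤ D + 1 := by
  rcases s.eq_empty_or_nonempty with rfl | h
  · simpa using hD
  have hsub : s ⊆ Icc (s.min' h) (s.max' h) := fun b hb ↦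
    mem_Icc.2 ⟨s.min'_le b hb, s.le_max' b hb⟩
  have h1 := card_le_card hsub
  rw [Int.card_Icc] at h1
  have h2 := hs _ (s.min'_mem h) _ (s.max'_mem h)
  have h3 : (#s : ℤ) ≤ s.max' h + 1 - s.min' h := by
    have := s.min'_le_max' h
    omega
  have h4 : (#s : ℝ) ≤ s.max' h + 1 - s.min' h := by exact_mod_cast h3
  linarith

/-- The triples `(c, s, b)` record a line, a side of its apex, and a block on it. -/
theorem card_triples_le (κ : Finset (ℤ × Bool × ℤ)) {c₀ c₁ K B δ : ℝ} (hc : c₀ ≤ c₁)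
    (hδ : c₁ - c₀ ≤ 8 * δ) (hB : 1 ≤ B) (hBK : B ≤ K) (hδB : δ * B ≤ K)
    (hlow : ∀ k ∈ κ, c₀ ≤ (k.1 : ℝ)) (hup : ∀ k ∈ κ, (k.1 : ℝ) ≤ c₁ + 18 * K)
    (hnear : ∀ k ∈ κ, ∀ k' ∈ κ, k.1 = k'.1 → k.2.1 = k'.2.1 →
      (k'.2.2 : ℝ) - k.2.2 ≤ 6 * B + 1)
    (hfar : ∀ k ∈ κ, ∀ k' ∈ κ, k.1 = k'.1 → k.2.1 = k'.2.1 → c₁ + 1 < k.1 →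
      (k'.2.2 : ℝ) - k.2.2 ≤ √(8 * K) * (1 / √(k.1 - c₁)) + 1) :
    (#κ : ℝ) ≤ 300 * K := by
  classical
  have hfib : ∀ (c : ℤ) (D : ℝ), 0 ≤ D → (∀ k ∈ κ, ∀ k' ∈ κ, k.1 = k'.1 → k.2.1 = k'.2.1 →
      k.1 = c → (k'.2.2 : ℝ) - k.2.2 ≤ D) →
      (#{k ∈ κ | k.1 = c} : ℝ) ≤ 2 * (D + 1) := by
    intro c D hD h
    have hside : ∀ s : Bool, (#{k ∈ κ | k.1 = c ∧ k.2.1 = s} : ℝ) ≤ D + 1 := by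
      intro s
      rw [← card_image_of_injOn (f := fun k : ℤ × Bool × ℤ ↦ k.2.2)]
      · refine card_le_of_sub_le _ (by linarith) ?_
        simp only [mem_image, mem_filter]
        rintro _ ⟨k, ⟨hk, h1, h2⟩, rfl⟩ _ ⟨k', ⟨hk', h1', h2'⟩, rfl⟩
        exact h k hk k' hk' (h1.trans h1'.symm) (h2.trans h2'.symm) h1
      · rintro ⟨c, s, b⟩ hk ⟨c', s', b'⟩ hk' hb
        simp only [coe_filter, Set.mem_ofPred_eq] at hk hk' hb
        simp [hk.2.1, hk'.2.1, hk.2.2, hk'.2.2, hb]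
    have hsub : {k ∈ κ | k.1 = c} ⊆
        {k ∈ κ | k.1 = c ∧ k.2.1 = true} ∪ {k ∈ κ | k.1 = c ∧ k.2.1 = false} := by
      intro k hk
      simp only [mem_filter, mem_union] at hk ⊢
      rcases Bool.eq_false_or_eq_true k.2.1 with h | h <;> simp [hk, h]
    have h1 := (card_le_card hsub).trans (card_union_le _ _)
    have h2 : (#{k ∈ κ | k.1 = c} : ℝ) ≤
        #{k ∈ κ | k.1 = c ∧ k.2.1 = true} + #{k ∈ κ | k.1 = c ∧ k.2.1 = false} := by
      exact_mod_cast h1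
    linarith [hside true, hside false]
  set s := κ.image Prod.fst
  have hcard : (#κ : ℝ) = ∑ c ∈ s, (#{k ∈ κ | k.1 = c} : ℝ) := by
    exact_mod_cast card_eq_sum_card_image Prod.fst κ
  rw [hcard, ← sum_filter_add_sum_filter_not s fun c : ℤ ↦ (c : ℝ) ≤ c₁ + 1]
  have hs : ∀ c ∈ s, c₀ ≤ (c : ℝ) ∧ (c : ℝ) ≤ c₁ + 18 * K := by
    intro c hc
    obtain ⟨k, hk, rfl⟩ := mem_image.1 hc
    exact ⟨hlow k hk, hup k hk⟩
  have hnearsum : ∑ c ∈ s.filter (fun c : ℤ ↦ (c : ℝ) ≤ c₁ + 1), (#{k ∈ κ | k.1 = c} : ℝ) ≤ 160 * K := by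
    have h1 : ∀ c ∈ s.filter (fun c : ℤ ↦ (c : ℝ) ≤ c₁ + 1),
        (#{k ∈ κ | k.1 = c} : ℝ) ≤ 16 * B := fun c _ ↦
      (hfib c (6 * B + 1) (by linarith) fun k hk k' hk' h h' _ ↦ hnear k hk k' hk' h h').trans
        (by linarith)
    have h2 := sum_le_card_nsmul _ _ _ h1
    rw [nsmul_eq_mul] at h2
    have h3 : (#(s.filter fun c : ℤ ↦ (c : ℝ) ≤ c₁ + 1) : ℝ) ≤ (8 * δ + 1) + 1 := by
      refine card_le_of_sub_le _ (by linarith) fun b hb b' hb' ↦ ?_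
      rw [mem_filter] at hb hb'
      linarith [(hs b hb.1).1]
    nlinarith
  have hfarsum : ∑ c ∈ s.filter (fun c : ℤ ↦ ¬ (c : ℝ) ≤ c₁ + 1), (#{k ∈ κ | k.1 = c} : ℝ) ≤ 120 * K := by
    have h1 : ∀ c ∈ s.filter (fun c : ℤ ↦ ¬ (c : ℝ) ≤ c₁ + 1),
        (#{k ∈ κ | k.1 = c} : ℝ) ≤ 4 + 2 * √(8 * K) * (1 / √(c - c₁)) := fun c hc ↦ by
      rw [mem_filter, not_le] at hc
      refine (hfib c (√(8 * K) * (1 / √(c - c₁)) + 1) (by positivity)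
        fun k hk k' hk' h h' h'' ↦ ?_).trans (by linarith)
      subst h''
      exact hfar k hk k' hk' h h' hc.2
    have h2 := sum_le_sum h1
    rw [sum_add_distrib, ← mul_sum, sum_const, nsmul_eq_mul] at h2
    have h3 : (#(s.filter fun c : ℤ ↦ ¬ (c : ℝ) ≤ c₁ + 1) : ℝ) ≤ (18 * K - 1) + 1 := by
      refine card_le_of_sub_le _ (by linarith) fun b hb b' hb' ↦ ?_
      rw [mem_filter, not_le] at hb hb'
      linarith [(hs b' hb'.1).2]
    have h4 := sum_one_div_sqrt_le (s.filter fun c : ℤ ↦ ¬ (c : ℝ) ≤ c₁ + 1) c₁ (18 * K)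
      (by linarith) fun c hc ↦ by
        rw [mem_filter, not_le] at hc
        exact ⟨hc.2.le, (hs c hc.1).2⟩
    have h5 : √(8 * K) * √(18 * K) = 12 * K := by
      rw [← Real.sqrt_mul (by linarith), show 8 * K * (18 * K) = (12 * K) ^ 2 by ring,
        Real.sqrt_sq (by linarith)]
    have h6 := mul_le_mul_of_nonneg_left h4 (show 0 ≤ 2 * √(8 * K) by positivity)
    nlinarith
  linarith

theorem scale_bounds {X H M Q q : ℝ} (hX : 0 < X) (hH : 0 < H) (hM : 0 < M) (hHX : H ≤ X)
    (hXH : X ≤ H ^ 3) (hq : 1 ≤ q) (hqQ : q ≤ Q) (hQ : Q ^ 2 * √(H * X) ≤ M ^ 2) :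
    1 ≤ M ^ 2 / (√(H * X) * q * Q) ∧
    M ^ 2 / (√(H * X) * q * Q) ≤ M ^ 3 / (X * Q ^ 2 * q) ∧
    q * H / M * (M ^ 2 / (√(H * X) * q * Q)) ≤ M ^ 3 / (X * Q ^ 2 * q) ∧
    q * H / M ≤ M / Q := by
  have hr : 0 < √(H * X) := by positivity
  have hr2 : √(H * X) ^ 2 = H * X := Real.sq_sqrt (by positivity)
  set r := √(H * X)
  have hq0 : 0 < q := by linarith
  have hQ0 : 0 < Q := by linarith
  have hqQ2 : q * Q ≤ Q ^ 2 := by nlinarith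
  have hrqQ : r * (q * Q) ≤ M ^ 2 := by nlinarith
  have hHr : H ≤ r := by
    apply le_of_sq_le_sq _ hr.le
    nlinarith
  have hXr : X ≤ H * r := by
    apply le_of_sq_le_sq _ (by positivity)
    rw [mul_pow, hr2]
    nlinarith
  have hXQ : X * Q ≤ M * r := by
    apply le_of_sq_le_sq _ (by positivity)
    calc (X * Q) ^ 2 = X * Q ^ 2 * X := by ring
      _ ≤ X * Q ^ 2 * (H * r) := by gcongr
      _ = X * H * (Q ^ 2 * r) := by ring
      _ ≤ X * H * M ^ 2 := by gcongr
      _ = (M * r) ^ 2 := by rw [mul_pow, hr2]; ring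
  refine ⟨?_, ?_, ?_, ?_⟩
  · rw [one_le_div (by positivity)]
    linarith
  · rw [div_le_div_iff₀ (by positivity) (by positivity)]
    calc M ^ 2 * (X * Q ^ 2 * q) = (M ^ 2 * Q * q) * (X * Q) := by ring
      _ ≤ (M ^ 2 * Q * q) * (M * r) := by gcongr
      _ = _ := by ring
  · rw [div_mul_div_comm, div_le_div_iff₀ (by positivity) (by positivity)]
    calc q * H * M ^ 2 * (X * Q ^ 2 * q) = (M ^ 2 * q * Q) * (q * Q) * (H * X) := by ring
      _ = (M ^ 2 * q * Q * r) * (r * (q * Q)) := by rw [← hr2]; ring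
      _ ≤ (M ^ 2 * q * Q * r) * M ^ 2 := by gcongr
      _ = _ := by ring
  · rw [div_le_div_iff₀ hM hQ0]
    calc q * H * Q = H * (q * Q) := by ring
      _ ≤ r * (q * Q) := by gcongr
      _ ≤ M * M := by linarith

/-- Two points of the hyperbola neighborhood on the line `a m + q n = c`, on the same side of the
apex, are close to each other. -/
theorem separation_bounds {X H a q c m n m' n' : ℝ} (ha : 0 < a) (hq : 0 < q)
    (hc : a * m + q * n = c) (hc' : a * m' + q * n' = c) (hm : m ≤ m')
    (hside : a * m ≤ q * n ∧ a * m' ≤ q * n' ∨ q * n ≤ a * m ∧ q * n' ≤ a * m')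
    (h : X ≤ n * m ∧ n * m ≤ X + H) (h' : X ≤ n' * m' ∧ n' * m' ≤ X + H) :
    a * (m' - m) ^ 2 ≤ q * H ∧
      ∀ w, 0 ≤ w → w ^ 2 ≤ c ^ 2 - 4 * a * q * (X + H) → (m' - m) * w ≤ q * H := by
  have haq : 0 < a * q := by positivity
  have e : (a * m - q * n) ^ 2 = c ^ 2 - 4 * a * q * (n * m) := by rw [← hc]; ring
  have e' : (a * m' - q * n') ^ 2 = c ^ 2 - 4 * a * q * (n' * m') := by rw [← hc']; ring
  have l : a * q * (n * m) ≤ a * q * (X + H) := by gcongr; exact h.2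
  have l' : a * q * (n' * m') ≤ a * q * (X + H) := by gcongr; exact h'.2
  have key : q * (n' * m') - q * (n * m) = (m' - m) * (c - a * (m + m')) := by
    linear_combination m' * hc' - m * hc
  have hd : 0 ≤ m' - m := by linarith
  have ham : a * m ≤ a * m' := by gcongr
  have b1 : q * (n' * m') - q * (n * m) ≤ q * H := by nlinarith
  have b2 : q * (n * m) - q * (n' * m') ≤ q * H := by nlinarith
  rcases hside with ⟨s, s'⟩ | ⟨s, s'⟩
  · refine ⟨by nlinarith, fun w hw hwc ↦ ?_⟩
    have w1 : w ≤ q * n - a * m := le_of_sq_le_sq (by nlinarith) (by linarith)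
    have w2 : w ≤ q * n' - a * m' := le_of_sq_le_sq (by nlinarith) (by linarith)
    nlinarith
  · refine ⟨by nlinarith, fun w hw hwc ↦ ?_⟩
    have w1 : w ≤ a * m - q * n := le_of_sq_le_sq (by nlinarith) (by linarith)
    have w2 : w ≤ a * m' - q * n' := le_of_sq_le_sq (by nlinarith) (by linarith)
    nlinarith

theorem le_two_mul_sqrt {X M a q : ℝ} (hX : 0 < X) (hM : 0 < M) (hq : 0 < q)
    (ha : X * q / (8 * M ^ 2) ≤ a) : q * X / (2 * M) ≤ 2 * √(a * q * X) := by
  have ha0 : 0 < a := lt_of_lt_of_le (by positivity) ha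
  apply le_of_sq_le_sq _ (by positivity)
  rw [mul_pow, Real.sq_sqrt (by positivity)]
  have h : X * q / (8 * M ^ 2) * q * X ≤ a * q * X := by gcongr
  have e : X * q / (8 * M ^ 2) * q * X = (q * X / (2 * M)) ^ 2 / 2 := by field_simp; norm_num
  nlinarith [sq_nonneg (q * X / (2 * M))]

theorem line_bounds {X H M Q a q m n : ℝ} (hX : 0 < X) (hH : 0 < H) (hM : 0 < M) (hq : 0 < q)
    (hQ : 0 < Q) (ha : X * q / (8 * M ^ 2) ≤ a) (hδ : q * H / M ≤ M / Q)
    (hm : M < m) (hm' : m ≤ 2 * M) (h : X < n * m) (h' : n * m ≤ X + H)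
    (happ : |q * (X / m ^ 2) - a| ≤ 1 / (Q + 1)) :
    2 * √(a * q * X) ≤ a * m + q * n ∧
      a * m + q * n ≤ 2 * √(a * q * (X + H)) + 18 * (M ^ 3 / (X * Q ^ 2 * q)) := by
  have ha0 : 0 < a := lt_of_lt_of_le (by positivity) ha
  have hm0 : 0 < m := by linarith
  have hn0 : 0 < n := pos_of_mul_pos_left (hX.trans h) hm0.le
  have hlow : ∀ Z, 0 ≤ Z → Z ≤ n * m → 2 * √(a * q * Z) ≤ a * m + q * n := fun Z hZ hZn ↦ by
    apply le_of_sq_le_sq _ (by positivity)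
    rw [mul_pow, Real.sq_sqrt (by positivity)]
    have : a * q * Z ≤ a * q * (n * m) := by gcongr
    nlinarith [sq_nonneg (a * m - q * n)]
  refine ⟨hlow X hX.le h.le, ?_⟩
  set c := a * m + q * n with hc
  set c₁ := 2 * √(a * q * (X + H)) with hc₁
  have hc₁sq : c₁ ^ 2 = 4 * (a * q * (X + H)) := by
    rw [hc₁, mul_pow, Real.sq_sqrt (by positivity)]; norm_num
  have hc₁low : q * X / (2 * M) ≤ c₁ := by
    refine (le_two_mul_sqrt hX hM hq ha).trans ?_
    rw [hc₁]
    gcongr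
    linarith
  have hsplit : |a * m - q * n| ≤ 3 * (M / Q) := by
    have e : a * m - q * n = -(m * (q * (X / m ^ 2) - a)) - q * ((n * m - X) / m) := by
      field_simp; ring
    have e1 : |m * (q * (X / m ^ 2) - a)| ≤ 2 * M * (1 / Q) := by
      rw [abs_mul, abs_of_pos hm0]
      have : 1 / (Q + 1) ≤ 1 / Q := by gcongr; linarith
      exact mul_le_mul hm' (happ.trans this) (abs_nonneg _) (by positivity)
    have e2 : 0 ≤ q * ((n * m - X) / m) := by
      have : 0 ≤ n * m - X := by linarith
      positivity
    have e3 : q * ((n * m - X) / m) ≤ q * H / M := by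
      rw [mul_div_assoc]
      gcongr
      linarith
    rw [mul_one_div, mul_div_assoc] at e1
    rw [e, abs_le]
    rw [abs_le] at e1
    constructor <;> linarith
  have hsq : c ^ 2 - c₁ ^ 2 ≤ 9 * (M / Q) ^ 2 := by
    have h1 : (a * m - q * n) ^ 2 ≤ (3 * (M / Q)) ^ 2 :=
      sq_le_sq' (abs_le.1 hsplit).1 (abs_le.1 hsplit).2
    have h2 : a * q * (n * m) ≤ a * q * (X + H) := by gcongr
    nlinarith
  by_contra! hlt
  have hK : 0 < M ^ 3 / (X * Q ^ 2 * q) := by positivity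
  have h1 : 18 * (M ^ 3 / (X * Q ^ 2 * q)) * (q * X / (2 * M)) = 9 * (M / Q) ^ 2 := by
    field_simp; norm_num
  have h2 : 0 < q * X / (2 * M) := by positivity
  nlinarith

/-- The line, the side of the apex and the block of length `L` containing a lattice point. -/
def lineKey (a q L : ℤ) (x : ℤ × ℤ) : ℤ × Bool × ℤ :=
  (a * x.1 + q * x.2, decide (a * x.1 ≤ q * x.2), x.1 / L)

theorem ediv_sub_ediv_le {m m' L : ℤ} (hL : 0 < L) {D : ℝ} (hD : 0 ≤ D)
    (h : m ≤ m' → ((m' : ℝ) - m) / L ≤ D) : ((m' / L : ℤ) : ℝ) - (m / L : ℤ) ≤ D + 1 := by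
  have hL' : (0 : ℝ) < L := by exact_mod_cast hL
  rcases le_total m m' with hm | hm
  · have h1 : ((m' / L : ℤ) : ℝ) ≤ m' / L := by
      rw [le_div_iff₀ hL']
      exact_mod_cast Int.ediv_mul_le m' hL.ne'
    have h2 : (m : ℝ) / L ≤ (m / L : ℤ) + 1 := by
      rw [div_le_iff₀ hL']
      exact_mod_cast (Int.lt_ediv_add_one_mul_self m hL).le
    have h3 := h hm
    rw [sub_div] at h3
    linarith
  · have : ((m' / L : ℤ) : ℝ) ≤ (m / L : ℤ) := by exact_mod_cast Int.ediv_le_ediv hL hm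
    linarith

set_option maxHeartbeats 600000 in
theorem card_image_lineKey_le {X H M : ℝ} {Q a q : ℕ} {L : ℤ} (hX : 0 < X) (hH : 0 < H)
    (hM : 0 < M) (hHX : H ≤ X) (hXH : X ≤ H ^ 3) (hq : 1 ≤ q) (hqQ : q ≤ Q)
    (hQ : (Q : ℝ) ^ 2 * √(H * X) ≤ M ^ 2) (ha : X * q / (8 * M ^ 2) ≤ a)
    (ha' : (a : ℝ) ≤ 2 * X * q / M ^ 2) (hL : q * (H * Q / (2 * M)) ≤ (L : ℝ))
    {S : Finset (ℤ × ℤ)} (hS : ∀ x ∈ S, M < (x.1 : ℝ) ∧ (x.1 : ℝ) ≤ 2 * M ∧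
      X < ((x.2 * x.1 : ℤ) : ℝ) ∧ ((x.2 * x.1 : ℤ) : ℝ) ≤ X + H ∧
      |q * (X / (x.1 : ℝ) ^ 2) - a| ≤ 1 / ((Q : ℝ) + 1)) :
    (#(S.image (lineKey a q L)) : ℝ) ≤ 300 * (M ^ 3 / (X * Q ^ 2 * q)) := by
  have hq1 : (1 : ℝ) ≤ q := by exact_mod_cast hq
  have hqQ' : (q : ℝ) ≤ Q := by exact_mod_cast hqQ
  obtain ⟨hB, hBK, hδB, hδ⟩ := scale_bounds hX hH hM hHX hXH hq1 hqQ' hQ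
  have hq0 : (0 : ℝ) < q := by linarith
  have hQ0 : (0 : ℝ) < Q := by linarith
  have ha0 : (0 : ℝ) < a := lt_of_lt_of_le (by positivity) ha
  have hLpos : (0 : ℝ) < L := lt_of_lt_of_le (by positivity) hL
  have hL0 : 0 < L := by exact_mod_cast hLpos
  have hr2 : √(H * X) ^ 2 = H * X := Real.sq_sqrt (by positivity)
  have hc₀sq : (2 * √(a * q * X)) ^ 2 = 4 * (a * q * X) := by
    rw [mul_pow, Real.sq_sqrt (by positivity)]; norm_num
  have hc₁sq : (2 * √(a * q * (X + H))) ^ 2 = 4 * (a * q * (X + H)) := by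
    rw [mul_pow, Real.sq_sqrt (by positivity)]; norm_num
  have hc₀₁ : 2 * √(a * q * X) ≤ 2 * √(a * q * (X + H)) := by gcongr; linarith
  have hc₀low : q * X / (2 * M) ≤ 2 * √(a * q * X) := le_two_mul_sqrt hX hM hq0 ha
  have hlines : ∀ x ∈ S, 2 * √(a * q * X) ≤ a * x.1 + q * x.2 ∧ a * x.1 + q * x.2 ≤
      2 * √(a * q * (X + H)) + 18 * (M ^ 3 / (X * Q ^ 2 * q)) := fun x hx ↦ by
    obtain ⟨h1, h2, h3, h4, h5⟩ := hS x hx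
    push_cast at h3 h4
    exact line_bounds hX hH hM hq0 hQ0 ha hδ h1 h2 h3 h4 h5
  have hsep : ∀ x ∈ S, ∀ y ∈ S, (a : ℤ) * x.1 + q * x.2 = a * y.1 + q * y.2 →
      decide ((a : ℤ) * x.1 ≤ q * x.2) = decide ((a : ℤ) * y.1 ≤ q * y.2) → x.1 ≤ y.1 →
      (a : ℝ) * (y.1 - x.1) ^ 2 ≤ q * H ∧ ∀ w : ℝ, 0 ≤ w →
        w ^ 2 ≤ (a * x.1 + q * x.2 : ℝ) ^ 2 - 4 * a * q * (X + H) →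
        ((y.1 : ℝ) - x.1) * w ≤ q * H := by
    intro x hx y hy hxy hside hle
    obtain ⟨-, -, h3, h4, -⟩ := hS x hx
    obtain ⟨-, -, h3', h4', -⟩ := hS y hy
    push_cast at h3 h4 h3' h4'
    refine separation_bounds ha0 hq0 rfl (by exact_mod_cast hxy.symm) (by exact_mod_cast hle) ?_
      ⟨h3.le, h4⟩ ⟨h3'.le, h4'⟩
    rw [decide_eq_decide] at hside
    by_cases hs : (a : ℤ) * x.1 ≤ q * x.2
    · exact Or.inl ⟨by exact_mod_cast hs, by exact_mod_cast hside.1 hs⟩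
    · exact Or.inr ⟨by exact_mod_cast (not_le.1 hs).le,
        by exact_mod_cast (not_le.1 (mt hside.2 hs)).le⟩
  set c₀ := 2 * √((a : ℝ) * q * X)
  set c₁ := 2 * √((a : ℝ) * q * (X + H))
  set K := M ^ 3 / (X * Q ^ 2 * q) with hK
  set B := M ^ 2 / (√(H * X) * q * Q) with hBdef
  have hc₀pos : 0 < c₀ := lt_of_lt_of_le (by positivity) hc₀low
  refine card_triples_le _ (δ := q * H / M) hc₀₁ ?_ hB hBK hδB ?_ ?_ ?_ ?_
  · have h1 : (c₁ - c₀) * (q * X / (2 * M)) ≤ 8 * (q * H / M) * (q * X / (2 * M)) := by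
      calc (c₁ - c₀) * (q * X / (2 * M)) ≤ (c₁ - c₀) * ((c₁ + c₀) / 2) := by
            exact mul_le_mul_of_nonneg_left (by linarith) (by linarith)
        _ = 2 * q * H * a := by nlinarith
        _ ≤ 2 * q * H * (2 * X * q / M ^ 2) := by gcongr
        _ = 8 * (q * H / M) * (q * X / (2 * M)) := by field_simp; norm_num
    exact le_of_mul_le_mul_right h1 (by positivity)
  · simp only [mem_image]
    rintro _ ⟨x, hx, rfl⟩
    simpa [lineKey] using (hlines x hx).1
  · simp only [mem_image]
    rintro _ ⟨x, hx, rfl⟩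
    simpa [lineKey] using (hlines x hx).2
  · simp only [mem_image]
    rintro _ ⟨x, hx, rfl⟩ _ ⟨y, hy, rfl⟩ hc hs
    refine ediv_sub_ediv_le hL0 (by linarith) fun hle ↦ ?_
    obtain ⟨h1, -⟩ := hsep x hx y hy hc hs hle
    have ht : (0 : ℝ) ≤ y.1 - x.1 := by exact_mod_cast sub_nonneg.2 hle
    set t : ℝ := (y.1 : ℝ) - x.1
    have h2 : t / L ≤ t / (q * (H * Q / (2 * M))) := by gcongr
    refine h2.trans ?_
    apply le_of_sq_le_sq _ (by linarith)
    have h3 : X * q / (8 * M ^ 2) * t ^ 2 ≤ q * H := le_trans (by gcongr) h1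
    have h4 : t ^ 2 ≤ 8 * M ^ 2 * H / X := by
      rw [le_div_iff₀ hX]
      rw [div_mul_eq_mul_div, div_le_iff₀ (by positivity)] at h3
      nlinarith
    calc (t / (q * (H * Q / (2 * M)))) ^ 2 = t ^ 2 * (4 * M ^ 2 / (q * H * Q) ^ 2) := by
          field_simp; norm_num
      _ ≤ 8 * M ^ 2 * H / X * (4 * M ^ 2 / (q * H * Q) ^ 2) := by gcongr
      _ = 32 * (M ^ 4 / (H * X * q ^ 2 * Q ^ 2)) := by field_simp; norm_num
      _ = 32 * B ^ 2 := by rw [hBdef, div_pow, mul_pow, mul_pow, hr2]; ring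
      _ ≤ (6 * B) ^ 2 := by nlinarith
  · simp only [mem_image]
    rintro _ ⟨x, hx, rfl⟩ _ ⟨y, hy, rfl⟩ hc hs hfar
    refine ediv_sub_ediv_le hL0 (by positivity) fun hle ↦ ?_
    obtain ⟨-, h1⟩ := hsep x hx y hy hc hs hle
    have ht : (0 : ℝ) ≤ y.1 - x.1 := by exact_mod_cast sub_nonneg.2 hle
    set t : ℝ := (y.1 : ℝ) - x.1
    simp only [lineKey] at hfar ⊢
    push_cast at hfar ⊢
    set c : ℝ := a * x.1 + q * x.2
    have hd : 0 < c - c₁ := by linarith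
    have h2 := h1 √((c - c₁) * (q * X / (2 * M))) (by positivity) (by
      rw [Real.sq_sqrt (by positivity)]
      have : (c - c₁) * (q * X / (2 * M)) ≤ (c - c₁) * c₁ := by gcongr; linarith
      nlinarith)
    have h3 : t ^ 2 * ((c - c₁) * (q * X / (2 * M))) ≤ (q * H) ^ 2 := by
      have := pow_le_pow_left₀ (by positivity) h2 2
      rwa [mul_pow, Real.sq_sqrt (by positivity)] at this
    have h4 : t / L ≤ t / (q * (H * Q / (2 * M))) := by gcongr
    refine h4.trans ?_
    rw [mul_one_div, ← Real.sqrt_div' _ hd.le]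
    apply Real.le_sqrt_of_sq_le
    rw [le_div_iff₀ hd]
    calc (t / (q * (H * Q / (2 * M)))) ^ 2 * (c - c₁)
        = t ^ 2 * ((c - c₁) * (q * X / (2 * M))) * (8 * M ^ 3 / (q ^ 3 * H ^ 2 * Q ^ 2 * X)) := by
          field_simp; norm_num
      _ ≤ (q * H) ^ 2 * (8 * M ^ 3 / (q ^ 3 * H ^ 2 * Q ^ 2 * X)) := by gcongr
      _ = 8 * K := by rw [hK]; field_simp

theorem le_cube_and_sq_mul_sqrt_le {X H M Q : ℝ} (hX : 1 ≤ X) (hH : 1 ≤ H) (hQ : 0 ≤ Q)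
    (hXH : X ^ ((1 : ℝ) / 3) ≤ H) (hQM : Q ≤ M / (H * X) ^ ((1 : ℝ) / 4)) :
    X ≤ H ^ 3 ∧ Q ^ 2 * √(H * X) ≤ M ^ 2 := by
  have hX0 : 0 ≤ X := by linarith
  have hHX : 0 < H * X := by positivity
  constructor
  · have := pow_le_pow_left₀ (by positivity) hXH 3
    rwa [← Real.rpow_natCast, ← Real.rpow_mul hX0, show (1 : ℝ) / 3 * (3 : ℕ) = 1 by norm_num,
      Real.rpow_one] at this
  · rw [le_div_iff₀ (by positivity)] at hQM
    have := pow_le_pow_left₀ (by positivity) hQM 2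
    rwa [mul_pow, ← Real.rpow_natCast ((H * X) ^ _), ← Real.rpow_mul hHX.le,
      show (1 : ℝ) / 4 * (2 : ℕ) = 1 / 2 by norm_num, ← Real.sqrt_eq_rpow] at this

theorem numerator_bounds {X M Q q a m : ℝ} (hM : 0 < M) (hMX : 16 * M ^ 2 ≤ X) (hq : 1 ≤ q)
    (hQ : 1 ≤ Q) (hm : M < m) (hm' : m ≤ 2 * M) (h : |q * (X / m ^ 2) - a| ≤ 1 / (Q + 1)) :
    X * q / (8 * M ^ 2) ≤ a ∧ a ≤ 2 * X * q / M ^ 2 := by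
  have hX : 0 < X := lt_of_lt_of_le (by positivity) hMX
  have hm0 : 0 < m := by linarith
  have h1 : 1 / (Q + 1) ≤ 1 / 2 := by gcongr; linarith
  have h2 : 16 ≤ q * (X / M ^ 2) := by
    have : 16 ≤ X / M ^ 2 := by rwa [le_div_iff₀ (by positivity)]
    nlinarith
  have h3 : q * (X / m ^ 2) ≤ q * (X / M ^ 2) := by gcongr
  have h4 : q * (X / M ^ 2) / 4 ≤ q * (X / m ^ 2) := by
    calc q * (X / M ^ 2) / 4 = q * (X / (2 * M) ^ 2) := by field_simp; norm_num
      _ ≤ _ := by gcongr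
  rw [show X * q / (8 * M ^ 2) = q * (X / M ^ 2) / 8 by field_simp,
    show 2 * X * q / M ^ 2 = 2 * (q * (X / M ^ 2)) by ring]
  rw [abs_le] at h
  constructor <;> linarith

theorem finite_hyperbola_neighborhood {J : Set ℝ} {X H M : ℝ} (hX : 0 < X) (hM : 0 < M)
    (hJ : J ⊆ Set.Ioc M (2 * M)) :
    {x : ℤ × ℤ | (x.1 : ℝ) ∈ J ∧ X < ((x.2 * x.1 : ℤ) : ℝ) ∧
      ((x.2 * x.1 : ℤ) : ℝ) ≤ X + H}.Finite := by
  refine ((Set.finite_Icc (0 : ℤ) ⌊2 * M⌋).prod (Set.finite_Icc (0 : ℤ) ⌊X + H⌋)).subset ?_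
  rintro ⟨m, n⟩ ⟨h1, h2, h3⟩
  obtain ⟨h4, h5⟩ := hJ h1
  simp only at h2 h3 h4 h5
  have hm : 0 < m := by exact_mod_cast hM.trans h4
  have hnm : 0 < n * m := by exact_mod_cast hX.trans h2
  have hn : 0 < n := pos_of_mul_pos_left hnm hm.le
  refine ⟨⟨hm.le, Int.le_floor.2 h5⟩, hn.le, ?_⟩
  exact le_trans (by nlinarith) (Int.le_floor.2 h3)

theorem mul_mem_of_line {a q c : ℤ} {x y z : ℤ × ℤ} {X Y : ℝ} (ha : 0 ≤ a) (hq : 0 < q)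
    (hx : a * x.1 + q * x.2 = c) (hy : a * y.1 + q * y.2 = c) (hz : a * z.1 + q * z.2 = c)
    (hxz : x.1 ≤ z.1) (hzy : z.1 ≤ y.1)
    (hside : decide (a * x.1 ≤ q * x.2) = decide (a * y.1 ≤ q * y.2))
    (hx1 : X < ((x.2 * x.1 : ℤ) : ℝ)) (hx2 : ((x.2 * x.1 : ℤ) : ℝ) ≤ Y)
    (hy1 : X < ((y.2 * y.1 : ℤ) : ℝ)) (hy2 : ((y.2 * y.1 : ℤ) : ℝ) ≤ Y) :
    X < ((z.2 * z.1 : ℤ) : ℝ) ∧ ((z.2 * z.1 : ℤ) : ℝ) ≤ Y ∧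
      decide (a * z.1 ≤ q * z.2) = decide (a * x.1 ≤ q * x.2) := by
  have key : ∀ u v : ℤ × ℤ, a * u.1 + q * u.2 = c → a * v.1 + q * v.2 = c →
      2 * (q * (v.2 * v.1) - q * (u.2 * u.1)) =
        (v.1 - u.1) * ((q * u.2 - a * u.1) + (q * v.2 - a * v.1)) := fun u v hu hv ↦ by
    linear_combination (v.1 + u.1) * hv - (v.1 + u.1) * hu
  have hsub := fun (u v : ℤ × ℤ) (h : q * (u.2 * u.1) ≤ q * (v.2 * v.1)) ↦
    (Int.cast_le (R := ℝ)).2 (le_of_mul_le_mul_left h hq)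
  have k1 := key x z hx hz
  have k2 := key z y hz hy
  have a1 := mul_le_mul_of_nonneg_left hxz ha
  have a2 := mul_le_mul_of_nonneg_left hzy ha
  rw [decide_eq_decide] at hside
  by_cases hs : a * x.1 ≤ q * x.2
  · have hs' := hside.1 hs
    have hz' : a * z.1 ≤ q * z.2 := by linarith
    refine ⟨hx1.trans_le (hsub x z ?_), (hsub z y ?_).trans hy2, by simp [hs, hz']⟩
    · nlinarith [mul_nonneg (sub_nonneg.2 hxz) (add_nonneg (sub_nonneg.2 hs) (sub_nonneg.2 hz'))]
    · nlinarith [mul_nonneg (sub_nonneg.2 hzy) (add_nonneg (sub_nonneg.2 hz') (sub_nonneg.2 hs'))]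
  · have hs' := mt hside.2 hs
    have hz' : ¬ a * z.1 ≤ q * z.2 := by linarith
    refine ⟨hy1.trans_le (hsub y z ?_), (hsub z x ?_).trans hx2, by simp [hs, hz']⟩ <;>
      rw [not_le] at hs hs' hz'
    · nlinarith [mul_nonneg (sub_nonneg.2 hzy)
        (add_nonneg (sub_nonneg.2 hz'.le) (sub_nonneg.2 hs'.le))]
    · nlinarith [mul_nonneg (sub_nonneg.2 hxz)
        (add_nonneg (sub_nonneg.2 hs.le) (sub_nonneg.2 hz'.le))]

/-- Theorem 1.11 / Theorem 8.1 (partition of a hyperbola neighborhood): there is an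
absolute constant `C` such that for `X^{1/3} ≤ H ≤ X`, `M ≤ C⁻¹ X^{1/2}`, any
subinterval `J ⊆ (M, 2M]` and any integer `M/H ≤ Q ≤ M/(HX)^{1/4}`, the set
`S = {(m,n) ∈ ℤ² : m ∈ J, X < nm ≤ X+H}` can be partitioned into families
`Pfam_{a,q}` (indexed by coprime pairs with `1 ≤ q ≤ Q` and `a ≍ (X/M²) q`) of at most
`C M³/(X Q² q)` arithmetic progressions of common difference `(q, -a)` and length at
most `HQ/M`. -/
theorem hyperbola_neighborhood_partition :
    ∃ C : ℝ, 0 < C ∧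
      ∀ X H M : ℝ, 1 ≤ X → 1 ≤ H → 1 ≤ M →
        X ^ ((1 : ℝ) / 3) ≤ H → H ≤ X → M ≤ C⁻¹ * X ^ ((1 : ℝ) / 2) →
      ∀ J : Set ℝ, Convex ℝ J → J ⊆ Set.Ioc M (2 * M) →
      ∀ Q : ℕ, M / H ≤ (Q : ℝ) → (Q : ℝ) ≤ M / (H * X) ^ ((1 : ℝ) / 4) →
        ∃ Pfam : ℕ → ℕ → Finset (Finset (ℤ × ℤ)),
          -- only valid index pairs `(a, q)` carry a nonempty family
          (∀ a q : ℕ, (Pfam a q).Nonempty →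
            1 ≤ q ∧ q ≤ Q ∧ Nat.Coprime a q ∧
              C⁻¹ * (X / M ^ 2) * q ≤ (a : ℝ) ∧ (a : ℝ) ≤ C * (X / M ^ 2) * q) ∧
          -- each family has at most `C M³ / (X Q² q)` members
          (∀ a q : ℕ, 1 ≤ q → ((Pfam a q).card : ℝ) ≤ C * M ^ 3 / (X * Q ^ 2 * q)) ∧
          -- each member is an arithmetic progression of common difference `(q, -a)`
          -- and length at most `HQ/M`, contained in the hyperbola neighborhood
          (∀ a q : ℕ, ∀ P ∈ Pfam a q,
            (∀ x ∈ P, ((x : ℤ × ℤ).1 : ℝ) ∈ J ∧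
              X < ((x.2 * x.1 : ℤ) : ℝ) ∧ ((x.2 * x.1 : ℤ) : ℝ) ≤ X + H) ∧
            ∃ (u : ℤ × ℤ) (k : ℕ), (k : ℝ) ≤ H * Q / M ∧
              P = (Finset.range k).image
                fun j : ℕ => (u.1 + (j : ℤ) * (q : ℤ), u.2 - (j : ℤ) * (a : ℤ))) ∧
          -- the members, taken over all index pairs, partition the set `S`
          (∀ x : ℤ × ℤ,
            (((x.1 : ℝ)) ∈ J ∧ X < ((x.2 * x.1 : ℤ) : ℝ) ∧ ((x.2 * x.1 : ℤ) : ℝ) ≤ X + H)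
              ↔ ∃! P : Finset (ℤ × ℤ), (∃ a q : ℕ, P ∈ Pfam a q) ∧ x ∈ P) := by
  classical
  refine ⟨1000, by norm_num, fun X H M hX hH hM hXH hHX hMX J hJ hJM Q hQ1 hQ2 ↦ ?_⟩
  have hX0 : 0 < X := by linarith
  have hH0 : 0 < H := by linarith
  have hM0 : 0 < M := by linarith
  obtain ⟨hXH3, hQsq⟩ := le_cube_and_sq_mul_sqrt_le hX hH (Nat.cast_nonneg Q) hXH hQ2
  have hMX' : 16 * M ^ 2 ≤ X := by
    rw [← Real.sqrt_eq_rpow] at hMX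
    have h1 := pow_le_pow_left₀ hM0.le hMX 2
    rw [mul_pow, Real.sq_sqrt hX0.le] at h1
    norm_num at h1
    linarith
  have hQ0 : (0 : ℝ) < Q := lt_of_lt_of_le (by positivity) hQ1
  have hQpos : 0 < Q := by exact_mod_cast hQ0
  have hQone : (1 : ℝ) ≤ Q := by exact_mod_cast hQpos
  set N := ⌊H * Q / M⌋₊
  have hlen : 1 ≤ H * Q / M := by
    rw [le_div_iff₀ hM0]
    rw [div_le_iff₀ hH0] at hQ1
    linarith
  have hNpos : 0 < N := Nat.floor_pos.2 hlen
  have hNle : (N : ℝ) ≤ H * Q / M := Nat.floor_le (by linarith)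
  have hNge : H * Q / (2 * M) ≤ (N : ℝ) := by
    have h1 := Nat.lt_floor_add_one (H * Q / M)
    have h2 : (1 : ℝ) ≤ N := by exact_mod_cast hNpos
    rw [show H * Q / (2 * M) = H * Q / M / 2 by field_simp]
    linarith
  obtain ⟨den, num, happ, hord⟩ := exists_dirichlet_assignment hQpos
  set slope : ℤ → ℝ := fun m ↦ X / (m : ℝ) ^ 2 with hslope
  set S := (finite_hyperbola_neighborhood (H := H) hX0 hM0 hJM).toFinset with hSdef
  have hS : ∀ x : ℤ × ℤ, x ∈ S ↔ (x.1 : ℝ) ∈ J ∧ X < ((x.2 * x.1 : ℤ) : ℝ) ∧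
      ((x.2 * x.1 : ℤ) : ℝ) ≤ X + H := fun x ↦ by simp [hSdef]
  have hnum : ∀ x ∈ S, X * den (slope x.1) / (8 * M ^ 2) ≤ num (slope x.1) ∧
      (num (slope x.1) : ℝ) ≤ 2 * X * den (slope x.1) / M ^ 2 := fun x hx ↦ by
    obtain ⟨h1, -, -, h4⟩ := happ (slope x.1)
    obtain ⟨h5, h6⟩ := hJM ((hS x).1 hx).1
    exact numerator_bounds hM0 hMX' (by exact_mod_cast h1) hQone h5 h6 h4
  let arc : ℕ → ℕ → Finset (ℤ × ℤ) := fun a q ↦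
    {x ∈ S | den (slope x.1) = q ∧ num (slope x.1) = a}
  let piece : ℕ → ℕ → ℤ × Bool × ℤ → Finset (ℤ × ℤ) := fun a q k ↦
    {x ∈ arc a q | lineKey a q (q * N) x = k}
  have harc : ∀ a q x, x ∈ arc a q → x ∈ S ∧ 0 < q ∧ q ≤ Q ∧ IsCoprime (a : ℤ) (q : ℤ) ∧
      X * q / (8 * M ^ 2) ≤ a ∧ (a : ℝ) ≤ 2 * X * q / M ^ 2 ∧
      |q * (X / (x.1 : ℝ) ^ 2) - a| ≤ 1 / ((Q : ℝ) + 1) := fun a q x hx ↦ by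
    obtain ⟨hxS, h1, h2⟩ := mem_filter.1 hx
    obtain ⟨h3, h4, h5, h6⟩ := happ (slope x.1)
    obtain ⟨h7, h8⟩ := hnum x hxS
    rw [h1] at h3 h4 h5 h6 h7 h8
    rw [h2] at h5 h6 h7 h8
    push_cast at h6 h7 h8
    exact ⟨hxS, h3, h4, h5, h7, h8, h6⟩
  refine ⟨fun a q ↦ ((arc a q).image (lineKey a q (q * N))).image (piece a q), ?_, ?_, ?_, ?_⟩
  · intro a q hne
    obtain ⟨x, hx⟩ := image_nonempty.1 (image_nonempty.1 hne)
    obtain ⟨-, h1, h2, h3, h4, h5, -⟩ := harc a q x hx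
    have h6 : 0 ≤ X / M ^ 2 * q := by positivity
    rw [show X * q / (8 * M ^ 2) = X / M ^ 2 * q / 8 by field_simp] at h4
    rw [show 2 * X * q / M ^ 2 = 2 * (X / M ^ 2 * q) by ring] at h5
    refine ⟨h1, h2, Nat.isCoprime_iff_coprime.1 h3, ?_, ?_⟩
    · rw [mul_assoc]; linarith
    · rw [mul_assoc]; linarith
  · intro a q hq
    have hq0 : (0 : ℝ) < q := by exact_mod_cast hq
    have hK : 0 ≤ M ^ 3 / (X * (Q : ℝ) ^ 2 * q) := by positivity
    rw [mul_div_assoc]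
    rcases (arc a q).eq_empty_or_nonempty with h | ⟨x, hx⟩
    · simp only [h, image_empty, card_empty, Nat.cast_zero]
      exact mul_nonneg (by norm_num) hK
    · obtain ⟨-, h1, h2, h3, h4, h5, -⟩ := harc a q x hx
      have hcard := card_image_lineKey_le (L := q * N) hX0 hH0 hM0 hHX hXH3 hq h2 hQsq h4 h5
        (by push_cast; gcongr) (S := arc a q) fun y hy ↦ by
          obtain ⟨g1, -, -, -, -, -, g2⟩ := harc a q y hy
          obtain ⟨g3, g4, g5⟩ := (hS y).1 g1
          exact ⟨(hJM g3).1, (hJM g3).2, g4, g5, g2⟩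
      have : (#(((arc a q).image (lineKey a q (q * N))).image (piece a q)) : ℝ) ≤
        #((arc a q).image (lineKey a q (q * N))) := by exact_mod_cast card_image_le
      linarith
  · intro a q P hP
    simp only [mem_image] at hP
    obtain ⟨k, ⟨x₀, hx₀, -⟩, rfl⟩ := hP
    obtain ⟨-, hq, -, haq, -⟩ := harc a q x₀ hx₀
    have hq' : (0 : ℤ) < q := by exact_mod_cast hq
    have hL : (0 : ℤ) < q * N := by positivity
    have hmem : ∀ x, x ∈ piece a q k ↔ (x ∈ S ∧ den (slope x.1) = q ∧ num (slope x.1) = a) ∧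
        lineKey a q (q * N) x = k := fun x ↦ by simp only [piece, arc, mem_filter]
    refine ⟨fun x hx ↦ (hS x).1 ((hmem x).1 hx).1.1, ?_⟩
    suffices h : ∃ (u : ℤ × ℤ) (l : ℕ), l ≤ N ∧ piece a q k = (Finset.range l).image
        fun j : ℕ ↦ (u.1 + (j : ℤ) * (q : ℤ), u.2 - (j : ℤ) * (a : ℤ)) by
      obtain ⟨u, l, hl, hP⟩ := h
      exact ⟨u, l, le_trans (by exact_mod_cast hl) hNle, hP⟩
    refine exists_eq_image_range_of_line (N := N) (c := k.1) hq haq ?_ ?_ ?_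
    · intro x hx
      exact congrArg Prod.fst ((hmem x).1 hx).2
    · intro x hx y hy z hz hxz hzy
      obtain ⟨⟨hxS, hx1, hx2⟩, rfl⟩ := (hmem x).1 hx
      obtain ⟨⟨hyS, hy1, hy2⟩, hyk⟩ := (hmem y).1 hy
      simp only [lineKey, Prod.mk.injEq] at hz hyk
      obtain ⟨hJx, hx3, hx4⟩ := (hS x).1 hxS
      obtain ⟨hJy, hy3, hy4⟩ := (hS y).1 hyS
      obtain ⟨h1, h2, h3⟩ := mul_mem_of_line (Int.natCast_nonneg a) hq' rfl hyk.1 hz hxz hzy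
        hyk.2.1.symm hx3 hx4 hy3 hy4
      have hxz' : (x.1 : ℝ) ≤ z.1 := by exact_mod_cast hxz
      have hzy' : (z.1 : ℝ) ≤ y.1 := by exact_mod_cast hzy
      have hxpos : (0 : ℝ) < x.1 := hM0.trans (hJM hJx).1
      have hzpos : (0 : ℝ) < z.1 := hxpos.trans_le hxz'
      obtain ⟨h4, h5⟩ := hord (slope y.1) (slope z.1) (slope x.1)
        (by simp only [hslope]; gcongr) (by simp only [hslope]; gcongr) (hy1.trans hx1.symm)
        (hy2.trans hx2.symm)
      refine (hmem z).2 ⟨⟨(hS z).2 ⟨hJ.ordConnected.out hJx hJy ⟨hxz', hzy'⟩, h1, h2⟩,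
        h4.trans hy1, h5.trans hy2⟩, ?_⟩
      simp only [lineKey, Prod.mk.injEq]
      refine ⟨hz, h3, le_antisymm ?_ (Int.ediv_le_ediv hL hxz)⟩
      rw [← hyk.2.2]
      exact Int.ediv_le_ediv hL hzy
    · intro x hx y hy
      have hxy : x.1 / ((q : ℤ) * N) = y.1 / ((q : ℤ) * N) :=
        congrArg (fun k ↦ k.2.2) (((hmem x).1 hx).2.trans ((hmem y).1 hy).2.symm)
      have h1 := Int.ediv_mul_le x.1 hL.ne'
      have h2 := Int.lt_ediv_add_one_mul_self y.1 hL
      rw [← hxy] at h2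
      linarith
  · intro x
    rw [← hS]
    simp only [mem_image]
    constructor
    · intro hx
      have hnn : 0 ≤ num (slope x.1) := by
        have := (hnum x hx).1
        have h0 : 0 ≤ X * den (slope x.1) / (8 * M ^ 2) := by positivity
        exact_mod_cast h0.trans this
      obtain ⟨a, ha⟩ := Int.eq_ofNat_of_zero_le hnn
      have hxa : x ∈ arc a (den (slope x.1)) := mem_filter.2 ⟨hx, rfl, ha⟩
      refine ⟨piece a (den (slope x.1)) (lineKey a (den (slope x.1)) (den (slope x.1) * N) x),
        ⟨⟨a, den (slope x.1), _, ⟨x, hxa, rfl⟩, rfl⟩, mem_filter.2 ⟨hxa, rfl⟩⟩, ?_⟩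
      rintro _ ⟨⟨b, r, k, -, rfl⟩, hxP⟩
      obtain ⟨hxb, rfl⟩ := mem_filter.1 hxP
      obtain ⟨-, rfl, hb⟩ := mem_filter.1 hxb
      obtain rfl : a = b := by exact_mod_cast ha.symm.trans hb
      rfl
    · rintro ⟨P, ⟨⟨a, q, k, -, rfl⟩, hxP⟩, -⟩
      exact (mem_filter.1 (mem_filter.1 hxP).1).1
end
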